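/- Short-time existence and uniqueness of smooth solutions for fully nonlinear parabolic systems on the torus (Theorem 1.1 for M = 𝕋^n with the trivial bundle): Let T > 0, let u₀ : ℝ^n → ℝ^l be C^∞ and ℤ^n-periodic, let W ⊆ ℝ^N be an open neighborhood of the range of j_r u₀, and let F : ℝ^n × [0,T] × W → ℝ^l be C^∞ with F(x+k,t,z) = F(x,t,z) for all k ∈ ℤ^n. Assume the equation ∂u/∂t = F(x,t,j_r u(x,t)) is strongly parabolic at u₀ with some constant λ > 0. Then there exists δ ∈ (0,T] such that there is one and only one C^∞ function u : ℝ^n × [0,δ] → ℝ^l, ℤ^n-periodic in x and with j_r u(x,t) ∈ W for all (x,t), satisfying ∂u/∂t = F(x,t,j_r u(x,t)) on ℝ^n × [0,δ] and u(·,0) = u₀. -/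

import Mathlib

open scoped BigOperators
noncomputable section

/-- Euclidean space `ℝ^n`. -/
abbrev Vec (n : ℕ) := EuclideanSpace ℝ (Fin n)

/-- Iterated spatial partial derivative (within `D`) in the directions `I = (i_1, …, i_k)`. -/
def pderivW {n l : ℕ} (D : Set (Vec n)) (k : ℕ) (I : Fin k → Fin n)
    (w : Vec n → Vec l) : Vec n → Vec l :=
  fun x => iteratedFDerivWithin ℝ k w D x (fun j => EuclideanSpace.single (I j) 1)

/-- Spatial partial derivative `∂_I u(⋅,t)` of a space-time function (within `D`). -/
def spDerivW {n l : ℕ} (D : Set (Vec n)) (k : ℕ) (I : Fin k → Fin n)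
    (u : Vec n → ℝ → Vec l) : Vec n → ℝ → Vec l :=
  fun x t => pderivW D k I (fun y => u y t) x

/-- Time derivative `∂_t u` within the time interval `J`. -/
def tDerivW {n l : ℕ} (J : Set ℝ) (u : Vec n → ℝ → Vec l) : Vec n → ℝ → Vec l :=
  fun x t => derivWithin (fun s => u x s) J t

/-- Supremum norm `|w|_{0;Q}`. -/
def supQ {n l : ℕ} (Q : Set (Vec n × ℝ)) (w : Vec n → ℝ → Vec l) : ℝ :=
  sSup {c | ∃ p ∈ Q, c = ‖w p.1 p.2‖}

/-- The set of parabolic Hölder difference quotients of exponent `α` (parabolic order `r`). -/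
def holQuot {n l : ℕ} (r : ℕ) (α : ℝ) (Q : Set (Vec n × ℝ))
    (w : Vec n → ℝ → Vec l) : Set ℝ :=
  {c | ∃ p ∈ Q, ∃ q ∈ Q, p ≠ q ∧
    c = ‖w p.1 p.2 - w q.1 q.2‖ / (‖p.1 - q.1‖ ^ α + |p.2 - q.2| ^ (α / r))}

/-- Parabolic Hölder seminorm `[w]_{α;Q}`. -/
def parSemi {n l : ℕ} (r : ℕ) (α : ℝ) (Q : Set (Vec n × ℝ))
    (w : Vec n → ℝ → Vec l) : ℝ :=
  sSup (holQuot r α Q w)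

/-- Parabolic Hölder norm `‖u‖_{C^{r+α,1+α/r}(D × J)}`. -/
def parNorm {n l : ℕ} (r : ℕ) (α : ℝ) (D : Set (Vec n)) (J : Set ℝ)
    (u : Vec n → ℝ → Vec l) : ℝ :=
  (∑ k ∈ Finset.range (r + 1), ∑ I : Fin k → Fin n, supQ (D ×ˢ J) (spDerivW D k I u))
    + supQ (D ×ˢ J) (tDerivW J u)
    + (∑ I : Fin r → Fin n, parSemi r α (D ×ˢ J) (spDerivW D r I u))
    + parSemi r α (D ×ˢ J) (tDerivW J u)

/-- Membership in the parabolic Hölder space `C^{r+α,1+α/r}(D × J, ℝ^l)`. -/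
def MemPar {n l : ℕ} (r : ℕ) (α : ℝ) (D : Set (Vec n)) (J : Set ℝ)
    (u : Vec n → ℝ → Vec l) : Prop :=
  ContinuousOn (fun p : Vec n × ℝ => u p.1 p.2) (D ×ˢ J) ∧
  (∀ t ∈ J, ContDiffOn ℝ r (fun x => u x t) D) ∧
  (∀ x ∈ D, DifferentiableOn ℝ (fun s => u x s) J) ∧
  (∀ k, k ≤ r → ∀ I : Fin k → Fin n,
    ContinuousOn (fun p : Vec n × ℝ => spDerivW D k I u p.1 p.2) (D ×ˢ J)) ∧
  ContinuousOn (fun p : Vec n × ℝ => tDerivW J u p.1 p.2) (D ×ˢ J) ∧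
  (∀ I : Fin r → Fin n, BddAbove (holQuot r α (D ×ˢ J) (spDerivW D r I u))) ∧
  BddAbove (holQuot r α (D ×ˢ J) (tDerivW J u))

/-- The norm of `C^{α,α/r}(Q)`. -/
def lowNorm {n l : ℕ} (r : ℕ) (α : ℝ) (Q : Set (Vec n × ℝ))
    (f : Vec n → ℝ → Vec l) : ℝ :=
  supQ Q f + parSemi r α Q f

/-- Membership in `C^{α,α/r}(Q, ℝ^l)`. -/
def MemLow {n l : ℕ} (r : ℕ) (α : ℝ) (Q : Set (Vec n × ℝ))
    (f : Vec n → ℝ → Vec l) : Prop :=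
  ContinuousOn (fun p : Vec n × ℝ => f p.1 p.2) Q ∧ BddAbove (holQuot r α Q f)

/-- Spatial Hölder quotient set. -/
def spHolQuot {n l : ℕ} (D : Set (Vec n)) (α : ℝ) (w : Vec n → Vec l) : Set ℝ :=
  {c | ∃ x ∈ D, ∃ y ∈ D, x ≠ y ∧ c = ‖w x - w y‖ / ‖x - y‖ ^ α}

/-- The elliptic Hölder norm `‖u₀‖_{C^{r+α}(D)}`. -/
def spNorm {n l : ℕ} (r : ℕ) (α : ℝ) (D : Set (Vec n)) (u₀ : Vec n → Vec l) : ℝ :=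
  (∑ k ∈ Finset.range (r + 1), ∑ I : Fin k → Fin n,
    sSup {c | ∃ x ∈ D, c = ‖pderivW D k I u₀ x‖})
    + ∑ I : Fin r → Fin n, sSup (spHolQuot D α (pderivW D r I u₀))

/-- Membership in `C^{r+α}(D, ℝ^l)`. -/
def MemSp {n l : ℕ} (r : ℕ) (α : ℝ) (D : Set (Vec n)) (u₀ : Vec n → Vec l) : Prop :=
  ContDiffOn ℝ r u₀ D ∧ ∀ I : Fin r → Fin n, BddAbove (spHolQuot D α (pderivW D r I u₀))

/-- Action `(L_t u)(x)` of the time-dependent linear differential operator of order `r` with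
coefficients `A k I a b` (`k = |I| ≤ r`). -/
def applyL {n l : ℕ} (r : ℕ) (D : Set (Vec n))
    (A : (k : ℕ) → (Fin k → Fin n) → Fin l → Fin l → Vec n → ℝ → ℝ)
    (u : Vec n → ℝ → Vec l) : Vec n → ℝ → Vec l :=
  fun x t => (EuclideanSpace.equiv (Fin l) ℝ).symm fun a =>
    ∑ k ∈ Finset.range (r + 1), ∑ I : Fin k → Fin n, ∑ b : Fin l,
      A k I a b x t * spDerivW D k I u x t b

/-- Legendre–Hadamard strong ellipticity with constant `lam` on `Q`. -/
def StrongEllip {n l : ℕ} (r : ℕ)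
    (A : (k : ℕ) → (Fin k → Fin n) → Fin l → Fin l → Vec n → ℝ → ℝ)
    (Q : Set (Vec n × ℝ)) (lam : ℝ) : Prop :=
  ∀ p ∈ Q, ∀ ξ : Vec n, ∀ v : Vec l,
    lam * ‖ξ‖ ^ r * ‖v‖ ^ 2 ≤
      (-1 : ℝ) ^ (r / 2 - 1) *
        ∑ I : Fin r → Fin n, ∑ a : Fin l, ∑ b : Fin l,
          A r I a b p.1 p.2 * (∏ j, ξ (I j)) * v a * v b

/-- `ℤ^n`-periodicity. -/
def PerZ {n : ℕ} {β : Type*} (g : Vec n → β) : Prop :=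
  ∀ x : Vec n, ∀ m : Fin n → ℤ,
    g (x + (EuclideanSpace.equiv (Fin n) ℝ).symm fun i => (m i : ℝ)) = g x

/-- Real-valued functions viewed as `ℝ^1`-valued. -/
def toV1 {n : ℕ} (g : Vec n → ℝ → ℝ) : Vec n → ℝ → Vec 1 :=
  fun x t => (EuclideanSpace.equiv (Fin 1) ℝ).symm fun _ => g x t

/-- The `r`-jet space: components indexed by the derivative order `k ≤ r`,
a tuple of `k` spatial directions, and the component index `b`. -/
abbrev Jet (n l r : ℕ) := (k : Fin (r + 1)) → ((Fin (k : ℕ) → Fin n) → Fin l → ℝ)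

/-- The `r`-jet `j_r w(x) = (w(x), Dw(x), …, D^r w(x))` (derivatives within `D`). -/
def jetOf {n l : ℕ} (D : Set (Vec n)) (r : ℕ) (w : Vec n → Vec l) (x : Vec n) :
    Jet n l r :=
  fun k I b => pderivW D (k : ℕ) I w x b

/-- The basis jet vector corresponding to the jet component `(k, I, b)`;
differentiating in this direction gives `∂F/∂z^b_I`. -/
def jetBasisG {n l : ℕ} (r k : ℕ) (I : Fin k → Fin n) (b : Fin l) : Jet n l r :=
  fun k' I' b' => if h : (k' : ℕ) = k then
    (if (I' ∘ Fin.cast h.symm) = I ∧ b' = b then (1 : ℝ) else 0) else 0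

/-- The integer vector `m` as a vector of `ℝ^n`. -/
def intVec {n : ℕ} (m : Fin n → ℤ) : Vec n :=
  (EuclideanSpace.equiv (Fin n) ℝ).symm fun i => (m i : ℝ)

@[simp] lemma intVec_apply {n : ℕ} (m : Fin n → ℤ) (i : Fin n) : intVec m i = m i := rfl

/-- The coordinate unit vector. -/
abbrev eVec {n : ℕ} (i : Fin n) : Vec n := EuclideanSpace.single i 1

/-- The algebra of smooth `ℤ^n`-periodic real functions. -/
def smoothPeriodic (n : ℕ) : Subalgebra ℝ (Vec n → ℝ) where
  carrier := {f | ContDiff ℝ (⊤ : ℕ∞) f ∧ PerZ f}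
  mul_mem' := fun ⟨a, b⟩ ⟨c, d⟩ => ⟨a.mul c, fun x m => by
    rw [Pi.mul_apply, Pi.mul_apply, b x m, d x m]⟩
  add_mem' := fun ⟨a, b⟩ ⟨c, d⟩ => ⟨a.add c, fun x m => by
    rw [Pi.add_apply, Pi.add_apply, b x m, d x m]⟩
  algebraMap_mem' := fun c => ⟨contDiff_const, fun _ _ => rfl⟩

/-- The type of smooth `ℤ^n`-periodic real functions. -/
def SP (n : ℕ) : Type := smoothPeriodic n

namespace SP

variable {n : ℕ}

instance : CommRing (SP n) := inferInstanceAs (CommRing (smoothPeriodic n))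
instance : Algebra ℝ (SP n) := inferInstanceAs (Algebra ℝ (smoothPeriodic n))
instance : CoeFun (SP n) (fun _ => Vec n → ℝ) := ⟨fun f => f.1⟩

/-- Bundle a smooth periodic function. -/
def mk (f : Vec n → ℝ) (hf : ContDiff ℝ (⊤ : ℕ∞) f) (hp : PerZ f) : SP n := ⟨f, hf, hp⟩

@[simp] lemma mk_apply (f : Vec n → ℝ) (hf hp) (x : Vec n) : (mk f hf hp) x = f x := rfl

lemma smooth (f : SP n) : ContDiff ℝ (⊤ : ℕ∞) f := f.2.1
lemma per (f : SP n) (x : Vec n) (m : Fin n → ℤ) : f (x + intVec m) = f x := f.2.2 x m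
lemma cont (f : SP n) : Continuous f := f.smooth.continuous
lemma diff (f : SP n) : Differentiable ℝ f := f.smooth.differentiable (by simp)

@[ext] lemma ext {f g : SP n} (h : ∀ x, f x = g x) : f = g := Subtype.ext (funext h)

@[simp] lemma add_apply (f g : SP n) (x : Vec n) : (f + g) x = f x + g x := rfl
@[simp] lemma sub_apply (f g : SP n) (x : Vec n) : (f - g) x = f x - g x := rfl
@[simp] lemma neg_apply (f : SP n) (x : Vec n) : (-f) x = - f x := rfl
@[simp] lemma mul_apply (f g : SP n) (x : Vec n) : (f * g) x = f x * g x := rfl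
@[simp] lemma smul_apply (c : ℝ) (f : SP n) (x : Vec n) : (c • f) x = c * f x := rfl
@[simp] lemma zero_apply (x : Vec n) : (0 : SP n) x = 0 := rfl
@[simp] lemma one_apply (x : Vec n) : (1 : SP n) x = 1 := rfl

/-- Evaluation at a point. -/
def evalL (x : Vec n) : SP n →ₗ[ℝ] ℝ where
  toFun f := f x
  map_add' _ _ := rfl
  map_smul' _ _ := rfl

@[simp] lemma sum_apply {ι : Type*} (s : Finset ι) (f : ι → SP n) (x : Vec n) :
    (∑ i ∈ s, f i) x = ∑ i ∈ s, f i x := map_sum (evalL x) f s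

/-- Partial derivative. -/
def D (i : Fin n) : SP n →ₗ[ℝ] SP n where
  toFun f := mk (fun x => fderiv ℝ f x (eVec i))
    ((f.smooth.fderiv_right (m := (⊤ : ℕ∞)) (by simp)).clm_apply contDiff_const)
    (fun x m => by
      have : (fun y => f (y + intVec m)) = f := funext fun y => f.per y m
      change fderiv ℝ f (x + intVec m) _ = _
      rw [← fderiv_comp_add_right, this])
  map_add' f g := by
    ext x
    change fderiv ℝ ((f : Vec n → ℝ) + (g : Vec n → ℝ)) x _ = _
    rw [fderiv_add (f.diff x) (g.diff x)]; rfl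
  map_smul' c f := by
    ext x
    change fderiv ℝ (c • (f : Vec n → ℝ)) x _ = _
    rw [fderiv_const_smul (f.diff x)]; rfl

lemma D_apply (i : Fin n) (f : SP n) (x : Vec n) : D i f x = fderiv ℝ f x (eVec i) := rfl

lemma D_mul (i : Fin n) (f g : SP n) : D i (f * g) = D i f * g + f * D i g := by
  ext x
  change fderiv ℝ ((f : Vec n → ℝ) * (g : Vec n → ℝ)) x _ = _
  rw [fderiv_mul (f.diff x) (g.diff x)]
  simp [D_apply]; ring

lemma D_comm (i j : Fin n) (f : SP n) : D i (D j f) = D j (D i f) := by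
  ext x
  have key : ∀ i j : Fin n, D i (D j f) x = fderiv ℝ (fderiv ℝ f) x (eVec i) (eVec j) := by
    intro i j
    change fderiv ℝ (fun y => fderiv ℝ f y (eVec j)) x (eVec i) = _
    have hd : DifferentiableAt ℝ (fderiv ℝ f) x :=
      ((f.smooth.fderiv_right (m := (⊤ : ℕ∞)) (by simp)).differentiable (by simp)) x
    rw [fderiv_clm_apply hd (differentiableAt_const _)]
    simp
  rw [key, key]
  exact (f.smooth.contDiffAt.isSymmSndFDerivAt (by
    simp only [minSmoothness_of_isRCLikeNormedField]
    exact WithTop.coe_le_coe.2 (le_top (a := (2 : ℕ∞))))) _ _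

/-- Iterated partial derivative `∂_I`. -/
def dI : (k : ℕ) → (Fin k → Fin n) → (SP n →ₗ[ℝ] SP n)
  | 0, _ => LinearMap.id
  | k + 1, I => (D (I 0)).comp (dI k (Fin.tail I))

@[simp] lemma dI_zero (I : Fin 0 → Fin n) (f : SP n) : dI 0 I f = f := rfl
lemma dI_succ (k : ℕ) (I : Fin (k + 1) → Fin n) (f : SP n) :
    dI (k + 1) I f = D (I 0) (dI k (Fin.tail I) f) := rfl

lemma D_dI_comm (i : Fin n) (k : ℕ) (I : Fin k → Fin n) (f : SP n) :
    D i (dI k I f) = dI k I (D i f) := by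
  induction k with
  | zero => rfl
  | succ k ih => rw [dI_succ, dI_succ, D_comm, ih]

lemma dI_succ' (k : ℕ) (I : Fin (k + 1) → Fin n) (f : SP n) :
    dI (k + 1) I f = dI k (Fin.tail I) (D (I 0) f) := by
  rw [dI_succ, D_dI_comm]

lemma iteratedFDeriv_apply (k : ℕ) (I : Fin k → Fin n) (f : SP n) (x : Vec n) :
    iteratedFDeriv ℝ k f x (fun j => eVec (I j)) = dI k I f x := by
  induction k generalizing x with
  | zero => simp
  | succ k ih =>
    rw [iteratedFDeriv_succ_apply_left, dI_succ, D_apply]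
    have hd : DifferentiableAt ℝ (iteratedFDeriv ℝ k f) x :=
      (f.smooth.differentiable_iteratedFDeriv (by exact_mod_cast WithTop.coe_lt_top _)) x
    have : (dI k (Fin.tail I) f : Vec n → ℝ) =
        fun y => iteratedFDeriv ℝ k f y (fun j => eVec (Fin.tail I j)) :=
      funext fun y => (ih _ y).symm
    rw [this]
    have h2 := (hd.hasFDerivAt.continuousMultilinear_apply_const
      (fun j => (eVec (Fin.tail I j) : Vec n))).fderiv
    rw [h2]; rfl

/-- The projection to the torus. -/
def toTorus (x : Vec n) : UnitAddTorus (Fin n) := fun i => (x i : UnitAddCircle)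

/-- A section of the projection to the torus. -/
def rep (t : UnitAddTorus (Fin n)) : Vec n :=
  WithLp.toLp 2 fun i => (AddCircle.equivIco (1 : ℝ) 0 (t i) : ℝ)

lemma toTorus_rep (t : UnitAddTorus (Fin n)) : toTorus (rep t) = t := by
  funext i
  exact (AddCircle.equivIco (1 : ℝ) 0).symm_apply_apply (t i)

lemma rep_mem (t : UnitAddTorus (Fin n)) (i : Fin n) : rep t i ∈ Set.Icc (0 : ℝ) 1 := by
  have := (AddCircle.equivIco (1 : ℝ) 0 (t i)).2
  simp only [zero_add] at this
  exact ⟨this.1, this.2.le⟩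

lemma exists_intVec_of_toTorus_eq {x y : Vec n} (h : toTorus x = toTorus y) :
    ∃ m : Fin n → ℤ, x = y + intVec m := by
  have : ∀ i, ∃ m : ℤ, x i = y i + m := fun i => by
    have := congrFun h i
    simp only [toTorus] at this
    rw [QuotientAddGroup.eq] at this
    obtain ⟨m, hm⟩ := AddSubgroup.mem_zmultiples_iff.1 this
    refine ⟨-m, ?_⟩
    simp at hm ⊢
    linarith
  choose m hm using this
  exact ⟨m, by ext i; simp [hm]⟩

lemma exists_rep (x : Vec n) : ∃ m : Fin n → ℤ, x = rep (toTorus x) + intVec m :=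
  exists_intVec_of_toTorus_eq (toTorus_rep _).symm

lemma PerZ.apply_rep {β : Type*} {f : Vec n → β} (hf : PerZ f) (x : Vec n) :
    f (rep (toTorus x)) = f x := by
  obtain ⟨m, hm⟩ := exists_rep x
  conv_rhs => rw [hm]
  exact (hf _ m).symm

lemma toTorus_add (x y : Vec n) : toTorus (x + y) = toTorus x + toTorus y := by
  funext i; simp [toTorus]

lemma isOpenQuotientMap_toTorus : IsOpenQuotientMap (toTorus (n := n)) := by
  have h1 : IsOpenQuotientMap (fun x : Fin n → ℝ => fun i => (x i : UnitAddCircle)) :=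
    IsOpenQuotientMap.piMap fun _ => QuotientAddGroup.isOpenQuotientMap_mk
  exact h1.comp (EuclideanSpace.equiv (Fin n) ℝ).toHomeomorph.isOpenQuotientMap

lemma continuous_comp_rep {Y : Type*} [TopologicalSpace Y] {f : Vec n → Y} (hf : Continuous f)
    (hp : PerZ f) : Continuous fun t => f (rep t) := by
  rw [← isOpenQuotientMap_toTorus.continuous_comp_iff]
  exact hf.congr fun x => (PerZ.apply_rep hp x).symm

end SP

/-- A curve of continuous functions whose pointwise time derivative is continuous in the uniform
norm is differentiable in the uniform norm. -/
lemma hasDerivWithinAt_of_pointwise {X : Type*} [TopologicalSpace X] [CompactSpace X]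
    {f f' : ℝ → C(X, ℝ)} {a b : ℝ} (hf' : ContinuousOn f' (Set.Icc a b))
    (h : ∀ x, ∀ t ∈ Set.Icc a b, HasDerivWithinAt (fun s => f s x) (f' t x) (Set.Icc a b) t)
    {t : ℝ} (ht : t ∈ Set.Icc a b) : HasDerivWithinAt f (f' t) (Set.Icc a b) t := by
  rw [hasDerivWithinAt_iff_isLittleO, Asymptotics.isLittleO_iff]
  intro ε hε
  obtain ⟨δ, hδ, H⟩ := Metric.continuousOn_iff.1 hf' t ht ε hε
  have hmem : Set.Icc a b ∩ Metric.ball t δ ∈ nhdsWithin t (Set.Icc a b) :=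
    Filter.inter_mem self_mem_nhdsWithin (mem_nhdsWithin_of_mem_nhds (Metric.ball_mem_nhds _ hδ))
  filter_upwards [hmem] with s hs
  rw [ContinuousMap.norm_le _ (by positivity)]
  intro x
  have hconv : Convex ℝ (Set.Icc a b ∩ Metric.ball t δ) :=
    (convex_Icc a b).inter (convex_ball t δ)
  have := hconv.norm_image_sub_le_of_norm_hasDerivWithin_le
    (f := fun s => f s x - s * f' t x) (f' := fun s => f' s x - f' t x) (C := ε)
    (x := t) (y := s)
    (fun u hu => by
      have h1 := (h x u hu.1).mono (Set.inter_subset_left (t := Metric.ball t δ))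
      have h2 := ((hasDerivWithinAt_id u (Set.Icc a b ∩ Metric.ball t δ)).mul_const (f' t x))
      simpa [Function.comp_def, Pi.sub_def] using h1.sub h2)
    (fun u hu => by
      have := (H u hu.1 hu.2).le
      rw [dist_eq_norm] at this
      exact (ContinuousMap.norm_coe_le_norm (f' u - f' t) x).trans this)
    ⟨ht, Metric.mem_ball_self hδ⟩ hs
  refine le_trans (le_of_eq ?_) this
  congr 1
  simp
  ring

namespace SP

variable {n : ℕ}

/-- A smooth periodic function as a continuous function on the torus. -/
def toC : SP n →ₗ[ℝ] C(UnitAddTorus (Fin n), ℝ) where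
  toFun f := ⟨fun t => f (rep t), continuous_comp_rep f.cont f.2.2⟩
  map_add' _ _ := rfl
  map_smul' _ _ := rfl

lemma toC_apply (f : SP n) (t : UnitAddTorus (Fin n)) : toC f t = f (rep t) := rfl

lemma toC_toTorus (f : SP n) (x : Vec n) : toC f (toTorus x) = f x := PerZ.apply_rep f.2.2 x

lemma toC_mul (f g : SP n) : toC (f * g) = toC f * toC g := rfl

lemma toC_one : toC (1 : SP n) = 1 := rfl

lemma abs_le_norm_toC (f : SP n) (x : Vec n) : |f x| ≤ ‖toC f‖ := by
  rw [← toC_toTorus]; exact ContinuousMap.norm_coe_le_norm (toC f) _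

lemma norm_toC_le {f : SP n} {c : ℝ} (hc : 0 ≤ c) (h : ∀ x, |f x| ≤ c) : ‖toC f‖ ≤ c :=
  (ContinuousMap.norm_le _ hc).2 fun t => h (rep t)

/-- Joint continuity in space and time gives continuity in time in the uniform norm. -/
lemma continuousOn_toC {f : ℝ → SP n} {S : Set ℝ}
    (h : ContinuousOn (fun p : Vec n × ℝ => f p.2 p.1) (Set.univ ×ˢ S)) :
    ContinuousOn (fun t => toC (f t)) S := by
  rw [continuousOn_iff_continuous_domRestrict]
  have hq : IsOpenQuotientMap (Prod.map id toTorus : S × Vec n → S × UnitAddTorus (Fin n)) :=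
    IsOpenQuotientMap.id.prodMap isOpenQuotientMap_toTorus
  have hc : Continuous fun p : S × UnitAddTorus (Fin n) => toC (f p.1) p.2 := by
    rw [← hq.continuous_comp_iff]
    have h1 : Continuous fun p : S × Vec n => f p.1 p.2 :=
      h.comp_continuous (f := fun p : S × Vec n => (p.2, (p.1 : ℝ))) (by fun_prop)
        (fun p => ⟨trivial, p.1.2⟩)
    exact h1.congr fun p => (toC_toTorus _ _).symm
  exact (ContinuousMap.curry ⟨_, hc⟩).continuous

section

local instance instMeasureSpaceCircle : MeasureTheory.MeasureSpace UnitAddCircle :=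
  ⟨AddCircle.haarAddCircle⟩

local instance instHaarCircle :
    MeasureTheory.Measure.IsAddHaarMeasure
      (MeasureTheory.volume : MeasureTheory.Measure UnitAddCircle) :=
  inferInstanceAs (MeasureTheory.Measure.IsAddHaarMeasure AddCircle.haarAddCircle)

local instance instProbCircle :
    MeasureTheory.IsProbabilityMeasure
      (MeasureTheory.volume : MeasureTheory.Measure UnitAddCircle) :=
  inferInstanceAs (MeasureTheory.IsProbabilityMeasure AddCircle.haarAddCircle)

lemma integrable_torus (f : C(UnitAddTorus (Fin n), ℝ)) :
    MeasureTheory.Integrable (fun t => f t) :=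
  f.continuous.integrable_of_hasCompactSupport (HasCompactSupport.of_compactSpace _)

/-- The mean value over the torus. -/
def avgC : C(UnitAddTorus (Fin n), ℝ) →L[ℝ] ℝ :=
  LinearMap.mkContinuous
    { toFun := fun f => ∫ t, f t
      map_add' := fun f g => MeasureTheory.integral_add (integrable_torus f) (integrable_torus g)
      map_smul' := fun c f => MeasureTheory.integral_const_mul c _ } 1 (fun f => by
    have := MeasureTheory.norm_integral_le_of_norm_le_const
      (μ := (MeasureTheory.volume : MeasureTheory.Measure (UnitAddTorus (Fin n))))
      (Filter.Eventually.of_forall fun t => ContinuousMap.norm_coe_le_norm f t)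
    simpa using this)

lemma avgC_apply (f : C(UnitAddTorus (Fin n), ℝ)) : avgC f = ∫ t, f t := rfl

/-- The mean value of a smooth periodic function. -/
def avg : SP n →ₗ[ℝ] ℝ := avgC.toLinearMap.comp toC

lemma avg_apply (f : SP n) : avg f = avgC (toC f) := rfl

lemma avg_mono {f g : SP n} (h : ∀ x, f x ≤ g x) : avg f ≤ avg g :=
  MeasureTheory.integral_mono (integrable_torus _) (integrable_torus _) fun t => h (rep t)

lemma avg_one : avg (1 : SP n) = 1 := by
  rw [avg_apply, toC_one, avgC_apply]; simp

/-- Translate of a smooth periodic function. -/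
def shift (y : Vec n) (f : SP n) : SP n :=
  mk (fun x => f (x + y)) (f.smooth.comp (contDiff_id.add contDiff_const)) fun x m => by
    change f ((x + intVec m) + y) = f (x + y)
    rw [add_right_comm, f.per]

lemma avg_shift (y : Vec n) (f : SP n) : avg (shift y f) = avg f := by
  have : toC (shift y f) = fun t => toC f (t + toTorus y) := by
    funext t
    rw [toC_apply]
    conv_rhs => rw [← toTorus_rep t, ← toTorus_add, toC_toTorus]
    rfl
  rw [avg_apply, avg_apply, avgC_apply, avgC_apply, this]
  exact MeasureTheory.integral_add_right_eq_self (fun t => toC f t) (toTorus y)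

end

lemma avg_D (i : Fin n) (f : SP n) : avg (D i f) = 0 := by
  have h : HasDerivWithinAt (fun s : ℝ => toC (shift (s • eVec i) f))
      (toC (shift ((0 : ℝ) • eVec i) (D i f))) (Set.Icc 0 1) 0 := by
    refine hasDerivWithinAt_of_pointwise (f' := fun s : ℝ => toC (shift (s • eVec i) (D i f)))
      (continuousOn_toC ?_) ?_ (by simp)
    · refine Continuous.continuousOn ?_
      exact (D i f).cont.comp (by fun_prop)
    · intro x t _
      refine HasDerivAt.hasDerivWithinAt ?_
      have h1 : HasDerivAt (fun s : ℝ => rep x + s • eVec i) (eVec i) t := by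
        simpa using ((hasDerivAt_id t).smul_const (eVec i)).const_add (rep x)
      exact (f.diff _).hasFDerivAt.comp_hasDerivAt t h1
  have h2 := avgC.hasFDerivAt.comp_hasDerivWithinAt (0 : ℝ) h
  have h3 : (avgC ∘ fun s : ℝ => toC (shift (s • eVec i) f)) = fun _ => avg f :=
    funext fun s => avg_shift _ f
  rw [h3] at h2
  have h4 := (hasDerivWithinAt_const (0 : ℝ) (Set.Icc (0 : ℝ) 1) (avg f))
  have h5 := (uniqueDiffOn_Icc (zero_lt_one (α := ℝ))).uniqueDiffWithinAt
    (x := 0) (by simp) |>.eq_deriv _ h2 h4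
  exact (avg_shift _ _).symm.trans h5

/-- The `L²` inner product. -/
def ip (f g : SP n) : ℝ := avg (f * g)

/-- The squared `L²` norm. -/
def nsq (f : SP n) : ℝ := avg (f * f)

lemma ip_comm (f g : SP n) : ip f g = ip g f := by rw [ip, mul_comm, ip]
lemma ip_self (f : SP n) : ip f f = nsq f := rfl
lemma ip_add_left (f g h : SP n) : ip (f + g) h = ip f h + ip g h := by simp [ip, add_mul]
lemma ip_sub_left (f g h : SP n) : ip (f - g) h = ip f h - ip g h := by simp [ip, sub_mul]
lemma ip_neg_left (f g : SP n) : ip (-f) g = - ip f g := by simp [ip]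
lemma ip_smul_left (c : ℝ) (f g : SP n) : ip (c • f) g = c * ip f g := by simp [ip]
lemma ip_sum_left {ι : Type*} (s : Finset ι) (f : ι → SP n) (g : SP n) :
    ip (∑ i ∈ s, f i) g = ∑ i ∈ s, ip (f i) g := by simp [ip, Finset.sum_mul]
lemma ip_add_right (f g h : SP n) : ip h (f + g) = ip h f + ip h g := by simp [ip, mul_add]
lemma ip_sub_right (f g h : SP n) : ip h (f - g) = ip h f - ip h g := by simp [ip, mul_sub]
lemma ip_neg_right (f g : SP n) : ip f (-g) = - ip f g := by simp [ip]
lemma ip_smul_right (c : ℝ) (f g : SP n) : ip f (c • g) = c * ip f g := by simp [ip]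
lemma ip_sum_right {ι : Type*} (s : Finset ι) (f : ι → SP n) (g : SP n) :
    ip g (∑ i ∈ s, f i) = ∑ i ∈ s, ip g (f i) := by simp [ip, Finset.mul_sum]
lemma ip_D_left (i : Fin n) (f g : SP n) : ip (D i f) g = - ip f (D i g) := by
  have := avg_D i (f * g)
  rw [D_mul, map_add] at this
  simp only [ip]
  linarith

lemma avg_nonneg {f : SP n} (h : ∀ x, 0 ≤ f x) : 0 ≤ avg f := by
  have := avg_mono (f := 0) (g := f) (by simpa using h)
  simpa using this

lemma nsq_nonneg (f : SP n) : 0 ≤ nsq f := avg_nonneg fun _ => mul_self_nonneg _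

lemma nsq_smul (c : ℝ) (f : SP n) : nsq (c • f) = c ^ 2 * nsq f := by
  rw [← ip_self, ip_smul_left, ip_smul_right, ip_self]; ring

lemma nsq_neg (f : SP n) : nsq (-f) = nsq f := by
  rw [← ip_self, ip_neg_left, ip_neg_right, ip_self]; ring

/-- Young's inequality. -/
lemma ip_le_young (f g : SP n) {ε : ℝ} (hε : 0 < ε) :
    ip f g ≤ ε * nsq f + 1 / (4 * ε) * nsq g := by
  have h := nsq_nonneg ((2 * ε) • f - g)
  rw [← ip_self, ip_sub_left, ip_sub_right, ip_sub_right, ip_comm g, ip_self, ip_self,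
    nsq_smul, ip_smul_left] at h
  have h2 : ip f g * (4 * ε) ≤ 4 * ε ^ 2 * nsq f + nsq g := by nlinarith
  rw [← le_div_iff₀ (by positivity)] at h2
  refine h2.trans (le_of_eq ?_)
  field_simp

lemma abs_ip_le_young (f g : SP n) {ε : ℝ} (hε : 0 < ε) :
    |ip f g| ≤ ε * nsq f + 1 / (4 * ε) * nsq g := by
  refine abs_le'.2 ⟨ip_le_young f g hε, ?_⟩
  have := ip_le_young (-f) g hε
  rwa [ip_neg_left, nsq_neg] at this

lemma nsq_le_of_abs_le {ι : Type*} (s : Finset ι) {f : SP n} {g : ι → SP n} {c : ℝ}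
    (h : ∀ x, (f x) ^ 2 ≤ c + ∑ i ∈ s, (g i x) ^ 2) : nsq f ≤ c + ∑ i ∈ s, nsq (g i) := by
  have : avg (f * f) ≤ avg (c • (1 : SP n) + ∑ i ∈ s, g i * g i) :=
    avg_mono fun x => by simpa [sq] using h x
  simpa [avg_one, nsq] using this

lemma nsq_sum_le {ι : Type*} (s : Finset ι) (f : ι → SP n) :
    nsq (∑ i ∈ s, f i) ≤ s.card * ∑ i ∈ s, nsq (f i) := by
  have : avg ((∑ i ∈ s, f i) * (∑ i ∈ s, f i)) ≤ avg ((s.card : ℝ) • ∑ i ∈ s, f i * f i) :=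
    avg_mono fun x => by
      have := sq_sum_le_card_mul_sum_sq (s := s) (f := fun i => f i x)
      simpa [sq] using this
  simpa [nsq] using this

lemma nsq_add_le (f g : SP n) : nsq (f + g) ≤ 2 * nsq f + 2 * nsq g := by
  have : avg ((f + g) * (f + g)) ≤ avg ((2 : ℝ) • (f * f) + (2 : ℝ) • (g * g)) :=
    avg_mono fun x => by simp; nlinarith [sq_nonneg (f x - g x)]
  simpa [nsq] using this

lemma nsq_mul_le {f g : SP n} {c : ℝ} (h : ∀ x, |f x| ≤ c) : nsq (f * g) ≤ c ^ 2 * nsq g := by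
  have : avg ((f * g) * (f * g)) ≤ avg ((c ^ 2) • (g * g)) :=
    avg_mono fun x => by
      have h1 : f x ^ 2 ≤ c ^ 2 := sq_le_sq' (by linarith [abs_le.1 (h x)]) (abs_le.1 (h x)).2
      simp; nlinarith [mul_le_mul_of_nonneg_right h1 (sq_nonneg (g x))]
  simpa [nsq] using this

lemma nsq_le_sup {f : SP n} {c : ℝ} (h : ∀ x, |f x| ≤ c) : nsq f ≤ c ^ 2 := by
  have := nsq_mul_le (g := 1) h
  have h1 : nsq (1 : SP n) = 1 := by simp [nsq, avg_one]
  simpa [h1] using this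

end SP

namespace SP

variable {n : ℕ}

/-- The phase `2 * π k ⬝ x`. -/
def phase (k : Fin n → ℤ) (x : Vec n) : ℝ := 2 * Real.pi * ∑ i, (k i : ℝ) * x i

lemma phase_add_intVec (k : Fin n → ℤ) (x : Vec n) (m : Fin n → ℤ) :
    phase k (x + intVec m) = phase k x + (∑ i, k i * m i : ℤ) * (2 * Real.pi) := by
  simp only [phase, PiLp.add_apply, intVec_apply, mul_add, Finset.sum_add_distrib]
  push_cast
  ring

lemma hasFDerivAt_phase (k : Fin n → ℤ) (x : Vec n) :
    HasFDerivAt (phase k)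
      ((2 * Real.pi) • ∑ i, (k i : ℝ) • (EuclideanSpace.proj i : Vec n →L[ℝ] ℝ)) x := by
  have : phase k = ((2 * Real.pi) • ∑ i, (k i : ℝ) • (EuclideanSpace.proj i : Vec n →L[ℝ] ℝ) :
      Vec n →L[ℝ] ℝ) := by
    funext y; simp [phase]
  rw [this]
  exact ContinuousLinearMap.hasFDerivAt _

lemma contDiff_phase (k : Fin n → ℤ) : ContDiff ℝ (⊤ : ℕ∞) (phase k) := by
  unfold phase; fun_prop

/-- `cos (2 * π k ⬝ x)`. -/
def cosK (k : Fin n → ℤ) : SP n :=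
  mk (fun x => Real.cos (phase k x)) (Real.contDiff_cos.comp (contDiff_phase k)) fun x m => by
    change Real.cos (phase k (x + intVec m)) = _
    rw [phase_add_intVec, Real.cos_add_int_mul_two_pi]

/-- `sin (2 * π k ⬝ x)`. -/
def sinK (k : Fin n → ℤ) : SP n :=
  mk (fun x => Real.sin (phase k x)) (Real.contDiff_sin.comp (contDiff_phase k)) fun x m => by
    change Real.sin (phase k (x + intVec m)) = _
    rw [phase_add_intVec, Real.sin_add_int_mul_two_pi]

lemma cosK_apply (k : Fin n → ℤ) (x : Vec n) : cosK k x = Real.cos (phase k x) := rfl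
lemma sinK_apply (k : Fin n → ℤ) (x : Vec n) : sinK k x = Real.sin (phase k x) := rfl

/-- The `i`-th frequency `2 * π k_i`. -/
def freq (k : Fin n → ℤ) (i : Fin n) : ℝ := 2 * Real.pi * k i

lemma freq_eq (k : Fin n → ℤ) (i : Fin n) :
    ((2 * Real.pi) • ∑ i, (k i : ℝ) • (EuclideanSpace.proj i : Vec n →L[ℝ] ℝ)) (eVec i)
      = freq k i := by
  simp [freq, PiLp.single_apply]

lemma D_cosK (i : Fin n) (k : Fin n → ℤ) : D i (cosK k) = -(freq k i • sinK k) := by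
  ext x
  have h := (hasFDerivAt_phase k x).cos.fderiv
  change fderiv ℝ (fun x => Real.cos (phase k x)) x (eVec i) = -(freq k i * Real.sin (phase k x))
  rw [h, _root_.smul_apply, freq_eq, smul_eq_mul]
  ring

lemma D_sinK (i : Fin n) (k : Fin n → ℤ) : D i (sinK k) = freq k i • cosK k := by
  ext x
  have h := (hasFDerivAt_phase k x).sin.fderiv
  change fderiv ℝ (fun x => Real.sin (phase k x)) x (eVec i) = freq k i * Real.cos (phase k x)
  rw [h, _root_.smul_apply, freq_eq, smul_eq_mul]
  ring

/-- The cosine coefficient. -/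
def ac (k : Fin n → ℤ) (f : SP n) : ℝ := ip f (cosK k)

/-- The sine coefficient. -/
def bc (k : Fin n → ℤ) (f : SP n) : ℝ := ip f (sinK k)

lemma ac_D (i : Fin n) (k : Fin n → ℤ) (f : SP n) : ac k (D i f) = freq k i * bc k f := by
  rw [ac, ip_D_left, D_cosK, ip_neg_right, ip_smul_right, neg_neg]; rfl

lemma bc_D (i : Fin n) (k : Fin n → ℤ) (f : SP n) : bc k (D i f) = -(freq k i * ac k f) := by
  rw [bc, ip_D_left, D_sinK, ip_smul_right]; rfl

lemma avg_cosK_eq_zero {k : Fin n → ℤ} (hk : k ≠ 0) : avg (cosK k) = 0 := by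
  obtain ⟨i, hi⟩ := Function.ne_iff.1 hk
  have h := avg_D i (sinK k)
  rw [D_sinK, map_smul, smul_eq_mul] at h
  refine (mul_eq_zero.1 h).resolve_left ?_
  have : (k i : ℝ) ≠ 0 := by exact_mod_cast hi
  simp [freq, Real.pi_ne_zero, this]

lemma avg_cosK (k : Fin n → ℤ) : avg (cosK k) = if k = 0 then 1 else 0 := by
  split_ifs with h
  · subst h
    rw [← avg_one (n := n)]
    congr 1
    ext x; simp [cosK_apply, phase]
  · exact avg_cosK_eq_zero h

lemma avg_sinK (k : Fin n → ℤ) : avg (sinK k) = 0 := by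
  by_cases hk : k = 0
  · have : sinK k = 0 := by ext x; simp [sinK_apply, phase, hk]
    rw [this, map_zero]
  obtain ⟨i, hi⟩ := Function.ne_iff.1 hk
  have h := avg_D i (cosK k)
  rw [D_cosK, map_neg, map_smul, smul_eq_mul, neg_eq_zero] at h
  refine (mul_eq_zero.1 h).resolve_left ?_
  have : (k i : ℝ) ≠ 0 := by exact_mod_cast hi
  simp [freq, Real.pi_ne_zero, this]

lemma phase_add (k j : Fin n → ℤ) (x : Vec n) : phase (k + j) x = phase k x + phase j x := by
  simp [phase, add_mul, Finset.sum_add_distrib, mul_add]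

lemma phase_sub (k j : Fin n → ℤ) (x : Vec n) : phase (k - j) x = phase k x - phase j x := by
  simp [phase, sub_mul, Finset.sum_sub_distrib, mul_sub]

lemma ac_cosK (k j : Fin n → ℤ) :
    ac k (cosK j) = ((if j + k = 0 then 1 else 0) + (if j = k then 1 else 0)) / 2 := by
  have : cosK j * cosK k = (1 / 2 : ℝ) • (cosK (j + k) + cosK (j - k)) := by
    ext x
    simp only [mul_apply, smul_apply, add_apply, cosK_apply, phase_add, phase_sub, Real.cos_add,
      Real.cos_sub]
    ring
  rw [ac, ip, this, map_smul, map_add, avg_cosK, avg_cosK]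
  simp only [sub_eq_zero, smul_eq_mul]
  ring

lemma bc_sinK (k j : Fin n → ℤ) :
    bc k (sinK j) = ((if j = k then 1 else 0) - (if j + k = 0 then 1 else 0)) / 2 := by
  have : sinK j * sinK k = (1 / 2 : ℝ) • (cosK (j - k) - cosK (j + k)) := by
    ext x
    simp only [mul_apply, smul_apply, sub_apply, cosK_apply, sinK_apply, phase_add, phase_sub,
      Real.cos_add, Real.cos_sub]
    ring
  rw [bc, ip, this, map_smul, map_sub, avg_cosK, avg_cosK]
  simp only [sub_eq_zero, smul_eq_mul]
  ring

lemma bc_cosK (k j : Fin n → ℤ) : bc k (cosK j) = 0 := by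
  have : cosK j * sinK k = (1 / 2 : ℝ) • (sinK (j + k) - sinK (j - k)) := by
    ext x
    simp only [mul_apply, smul_apply, sub_apply, cosK_apply, sinK_apply, phase_add, phase_sub,
      Real.sin_add, Real.sin_sub]
    ring
  rw [bc, ip, this, map_smul, map_sub, avg_sinK, avg_sinK]
  simp

lemma ac_sinK (k j : Fin n → ℤ) : ac k (sinK j) = 0 := by
  rw [ac, ip_comm]; exact bc_cosK j k

section

attribute [local instance] instMeasureSpaceCircle instHaarCircle instProbCircle

open MeasureTheory

/-- A smooth periodic function as a complex continuous function on the torus. -/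
def toCC (f : SP n) : C(UnitAddTorus (Fin n), ℂ) :=
  ⟨fun t => (toC f t : ℂ), Complex.continuous_ofReal.comp (toC f).continuous⟩

lemma mFourier_eq (k : Fin n → ℤ) (t : UnitAddTorus (Fin n)) :
    UnitAddTorus.mFourier k t = (toC (cosK k) t : ℂ) + toC (sinK k) t * Complex.I := by
  have h : UnitAddTorus.mFourier k (toTorus (rep t)) =
      Complex.exp (phase k (rep t) * Complex.I) := by
    simp only [UnitAddTorus.mFourier, ContinuousMap.coe_mk, toTorus, fourier_coe_apply]
    rw [← Complex.exp_sum]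
    congr 1
    simp only [phase]
    push_cast
    rw [Finset.mul_sum, Finset.sum_mul]
    exact Finset.sum_congr rfl fun i _ => by ring
  rw [toTorus_rep] at h
  rw [h, Complex.exp_mul_I, ← Complex.ofReal_cos, ← Complex.ofReal_sin]
  rfl

lemma mFourierCoeff_toCC (k : Fin n → ℤ) (f : SP n) :
    UnitAddTorus.mFourierCoeff (toCC f) k = (ac k f : ℂ) - bc k f * Complex.I := by
  have h : ∀ t, UnitAddTorus.mFourier (-k) t • toCC f t
      = ((toC (f * cosK k) t : ℝ) : ℂ) - ((toC (f * sinK k) t : ℝ) : ℂ) * Complex.I := by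
    intro t
    rw [UnitAddTorus.mFourier_neg, mFourier_eq, toC_mul, toC_mul]
    simp [toCC]
    ring
  rw [UnitAddTorus.mFourierCoeff]
  simp_rw [h]
  have hi : ∀ g : SP n, Integrable (fun t => ((toC g t : ℝ) : ℂ)) := fun g =>
    (integrable_torus (toC g)).ofReal
  rw [integral_sub (hi _) ((hi _).mul_const _), integral_mul_const, integral_complex_ofReal,
    integral_complex_ofReal]
  rfl

/-- Parseval's identity. -/
lemma hasSum_ip (f g : SP n) :
    HasSum (fun k => ac k f * ac k g + bc k f * bc k g) (ip f g) := by
  have h := UnitAddTorus.hasSum_prod_mFourierCoeff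
    (ContinuousMap.toLp (E := ℂ) 2 volume ℂ (toCC f))
    (ContinuousMap.toLp (E := ℂ) 2 volume ℂ (toCC g))
  simp only [UnitAddTorus.mFourierCoeff_toLp, mFourierCoeff_toCC] at h
  have h2 := Complex.hasSum_re h
  have e : (∫ t, (starRingEnd ℂ) ((ContinuousMap.toLp (E := ℂ) 2 volume ℂ (toCC f)) t) *
      (ContinuousMap.toLp (E := ℂ) 2 volume ℂ (toCC g)) t) = ((ip f g : ℝ) : ℂ) := by
    rw [ip, avg_apply, avgC_apply, ← integral_complex_ofReal]
    apply integral_congr_ae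
    filter_upwards [ContinuousMap.coeFn_toLp (p := 2) (𝕜 := ℂ) volume (toCC f),
      ContinuousMap.coeFn_toLp (p := 2) (𝕜 := ℂ) volume (toCC g)] with t h1 h2
    rw [h1, h2, toC_mul]
    simp [toCC]
  rw [e, Complex.ofReal_re] at h2
  refine h2.congr_fun fun k => ?_
  simp

/-- The squared modulus of the Fourier coefficient. -/
def qc (k : Fin n → ℤ) (f : SP n) : ℝ := ac k f ^ 2 + bc k f ^ 2

lemma qc_nonneg (k : Fin n → ℤ) (f : SP n) : 0 ≤ qc k f := by unfold qc; positivity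

lemma hasSum_nsq (f : SP n) : HasSum (fun k => qc k f) (nsq f) := by
  refine (hasSum_ip f f).congr_fun fun k => ?_
  simp only [qc]; ring

/-- Pointwise bound by the sum of the Fourier coefficients. -/
lemma abs_le_tsum {f : SP n} (h : Summable fun k => √(qc k f)) (x : Vec n) :
    |f x| ≤ ∑' k, √(qc k f) := by
  have hn : ∀ k, ‖UnitAddTorus.mFourierCoeff (toCC f) k‖ = √(qc k f) := by
    intro k
    rw [mFourierCoeff_toCC, Complex.norm_def, Complex.normSq_apply]
    simp [qc, sq]
  have hs : Summable (UnitAddTorus.mFourierCoeff (toCC f)) := by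
    refine Summable.of_norm (h.congr fun k => (hn k).symm)
  have h1 := UnitAddTorus.hasSum_mFourier_series_apply_of_summable hs (toTorus x)
  have h2 : ‖toCC f (toTorus x)‖ = |f x| := by
    rw [← toC_toTorus f x]; simp [toCC]
  rw [← h2]
  have hb : ∀ k, ‖UnitAddTorus.mFourierCoeff (toCC f) k • UnitAddTorus.mFourier k (toTorus x)‖
      ≤ √(qc k f) := fun k => by
    rw [norm_smul, hn]
    have := ContinuousMap.norm_coe_le_norm (UnitAddTorus.mFourier k) (toTorus x)
    rw [UnitAddTorus.mFourier_norm] at this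
    exact mul_le_of_le_one_right (Real.sqrt_nonneg _) this
  exact h1.norm_le_of_bounded h.hasSum hb

end

end SP

namespace SP

variable {n : ℕ}

lemma ac_add (k : Fin n → ℤ) (f g : SP n) : ac k (f + g) = ac k f + ac k g := ip_add_left _ _ _
lemma bc_add (k : Fin n → ℤ) (f g : SP n) : bc k (f + g) = bc k f + bc k g := ip_add_left _ _ _
lemma ac_sub (k : Fin n → ℤ) (f g : SP n) : ac k (f - g) = ac k f - ac k g := ip_sub_left _ _ _
lemma bc_sub (k : Fin n → ℤ) (f g : SP n) : bc k (f - g) = bc k f - bc k g := ip_sub_left _ _ _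
lemma ac_smul (c : ℝ) (k : Fin n → ℤ) (f : SP n) : ac k (c • f) = c * ac k f := ip_smul_left _ _ _
lemma bc_smul (c : ℝ) (k : Fin n → ℤ) (f : SP n) : bc k (c • f) = c * bc k f := ip_smul_left _ _ _
lemma ac_neg (k : Fin n → ℤ) (f : SP n) : ac k (-f) = - ac k f := ip_neg_left _ _
lemma bc_neg (k : Fin n → ℤ) (f : SP n) : bc k (-f) = - bc k f := ip_neg_left _ _
lemma ac_sum (k : Fin n → ℤ) {ι : Type*} (s : Finset ι) (f : ι → SP n) :
    ac k (∑ i ∈ s, f i) = ∑ i ∈ s, ac k (f i) := ip_sum_left _ _ _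
lemma bc_sum (k : Fin n → ℤ) {ι : Type*} (s : Finset ι) (f : ι → SP n) :
    bc k (∑ i ∈ s, f i) = ∑ i ∈ s, bc k (f i) := ip_sum_left _ _ _

/-- The symbol of the (positive) Laplacian. -/
def xi2 (k : Fin n → ℤ) : ℝ := ∑ i, freq k i ^ 2

lemma xi2_nonneg (k : Fin n → ℤ) : 0 ≤ xi2 k := Finset.sum_nonneg fun _ _ => sq_nonneg _

/-- The positive Laplacian. -/
def lap : SP n →ₗ[ℝ] SP n := -∑ i, (D i).comp (D i)

lemma lap_apply (f : SP n) : lap f = -∑ i, D i (D i f) := by simp [lap]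

/-- Powers of the positive Laplacian. -/
def lapP : ℕ → (SP n →ₗ[ℝ] SP n)
  | 0 => LinearMap.id
  | m + 1 => lap.comp (lapP m)

@[simp] lemma lapP_zero (f : SP n) : lapP 0 f = f := rfl
lemma lapP_succ (m : ℕ) (f : SP n) : lapP (m + 1) f = lap (lapP m f) := rfl

lemma D_lap (i : Fin n) (f : SP n) : D i (lap f) = lap (D i f) := by
  simp only [lap_apply, map_neg, map_sum]
  congr 1
  exact Finset.sum_congr rfl fun j _ => by rw [D_comm i j, D_comm i j]

lemma D_lapP (i : Fin n) (m : ℕ) (f : SP n) : D i (lapP m f) = lapP m (D i f) := by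
  induction m with
  | zero => rfl
  | succ m ih => rw [lapP_succ, lapP_succ, D_lap, ih]

lemma ac_lap (k : Fin n → ℤ) (f : SP n) : ac k (lap f) = xi2 k * ac k f := by
  rw [lap_apply, ac_neg, ac_sum, xi2, Finset.sum_mul, ← Finset.sum_neg_distrib]
  exact Finset.sum_congr rfl fun i _ => by rw [ac_D, bc_D]; ring

lemma bc_lap (k : Fin n → ℤ) (f : SP n) : bc k (lap f) = xi2 k * bc k f := by
  rw [lap_apply, bc_neg, bc_sum, xi2, Finset.sum_mul, ← Finset.sum_neg_distrib]
  exact Finset.sum_congr rfl fun i _ => by rw [bc_D, ac_D]; ring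

lemma ac_lapP (k : Fin n → ℤ) (m : ℕ) (f : SP n) : ac k (lapP m f) = xi2 k ^ m * ac k f := by
  induction m with
  | zero => simp
  | succ m ih => rw [lapP_succ, ac_lap, ih]; ring

lemma bc_lapP (k : Fin n → ℤ) (m : ℕ) (f : SP n) : bc k (lapP m f) = xi2 k ^ m * bc k f := by
  induction m with
  | zero => simp
  | succ m ih => rw [lapP_succ, bc_lap, ih]; ring

lemma qc_dI (k : Fin n → ℤ) (m : ℕ) (I : Fin m → Fin n) (f : SP n) :
    qc k (dI m I f) = (∏ j, freq k (I j) ^ 2) * qc k f := by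
  induction m with
  | zero => simp
  | succ m ih =>
    rw [Fin.prod_univ_succ, mul_assoc]
    have := ih (Fin.tail I)
    simp only [Fin.tail] at this
    rw [← this, dI_succ]
    simp only [qc, ac_D, bc_D]
    ring

lemma qc_lapP (k : Fin n → ℤ) (m : ℕ) (f : SP n) :
    qc k (lapP m f) = xi2 k ^ (2 * m) * qc k f := by
  simp only [qc, ac_lapP, bc_lapP]; ring

/-- The homogeneous Sobolev energy of order `m`. -/
def hs (m : ℕ) (f : SP n) : ℝ := ∑ I : Fin m → Fin n, nsq (dI m I f)

lemma hs_nonneg (m : ℕ) (f : SP n) : 0 ≤ hs m f := Finset.sum_nonneg fun _ _ => nsq_nonneg _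

lemma nsq_dI_le (m : ℕ) (I : Fin m → Fin n) (f : SP n) : nsq (dI m I f) ≤ hs m f :=
  Finset.single_le_sum (f := fun I => nsq (dI m I f)) (fun _ _ => nsq_nonneg _) (Finset.mem_univ I)

lemma hs_zero (f : SP n) : hs 0 f = nsq f := by simp [hs]

lemma hasSum_hs (m : ℕ) (f : SP n) : HasSum (fun k => xi2 k ^ m * qc k f) (hs m f) := by
  have h : HasSum (fun k => ∑ I : Fin m → Fin n, qc k (dI m I f)) (hs m f) :=
    hasSum_sum fun I _ => hasSum_nsq (dI m I f)
  refine h.congr_fun fun k => ?_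
  simp only [qc_dI]
  rw [← Finset.sum_mul, xi2, Fintype.sum_pow]

lemma hs_dI_le (m j : ℕ) (I : Fin j → Fin n) (f : SP n) : hs m (dI j I f) ≤ hs (m + j) f := by
  refine hasSum_le (fun k => ?_) (hasSum_hs m (dI j I f)) (hasSum_hs (m + j) f)
  have : (∏ i, freq k (I i) ^ 2) ≤ xi2 k ^ j := by
    refine (Finset.prod_le_prod (fun i _ => sq_nonneg _) (g := fun _ => xi2 k)
      fun i _ => ?_).trans (by simp)
    exact Finset.single_le_sum (f := fun i => freq k i ^ 2) (fun _ _ => sq_nonneg _)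
      (Finset.mem_univ (I i))
  rw [qc_dI, pow_add, mul_assoc]
  exact mul_le_mul_of_nonneg_left (mul_le_mul_of_nonneg_right this (qc_nonneg _ _))
    (pow_nonneg (xi2_nonneg k) _)

lemma hasSum_ip_lapP (m : ℕ) (f g : SP n) :
    HasSum (fun k => xi2 k ^ m * (ac k f * ac k g + bc k f * bc k g)) (ip f (lapP m g)) := by
  refine (hasSum_ip f (lapP m g)).congr_fun fun k => ?_
  rw [ac_lapP, bc_lapP]; ring

lemma ip_lapP_self (m : ℕ) (f : SP n) : ip f (lapP m f) = hs m f := by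
  refine (hasSum_ip_lapP m f f).unique ((hasSum_hs m f).congr_fun fun k => ?_)
  simp only [qc]; ring

lemma nsq_lapP (m : ℕ) (f : SP n) : nsq (lapP m f) = hs (2 * m) f := by
  refine (hasSum_nsq (lapP m f)).unique ((hasSum_hs (2 * m) f).congr_fun fun k => ?_)
  exact qc_lapP k m f

lemma sum_tuple_succ {M : Type*} [AddCommMonoid M] (p : ℕ) (F : (Fin (p + 1) → Fin n) → M) :
    ∑ J, F J = ∑ i, ∑ J : Fin p → Fin n, F (Fin.cons i J) := by
  rw [← Fintype.sum_prod_type']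
  exact (Fintype.sum_equiv (Fin.consEquiv fun _ => Fin n) _ _ fun _ => rfl).symm

lemma ip_lap (g f : SP n) : ip g (lap f) = ∑ i, ip (D i g) (D i f) := by
  rw [lap_apply, ip_neg_right, ip_sum_right, ← Finset.sum_neg_distrib]
  exact Finset.sum_congr rfl fun i _ => (ip_D_left i g (D i f)).symm

lemma ip_lapP_add (p m : ℕ) (g f : SP n) :
    ip g (lapP (p + m) f) = ∑ J : Fin p → Fin n, ip (dI p J g) (lapP m (dI p J f)) := by
  induction p generalizing g f with
  | zero => simp
  | succ p ih =>
    rw [add_right_comm, lapP_succ, ip_lap, sum_tuple_succ]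
    refine Finset.sum_congr rfl fun i _ => ?_
    rw [D_lapP, ih]
    refine Finset.sum_congr rfl fun J _ => ?_
    rw [dI_succ', dI_succ', Fin.cons_zero, Fin.tail_cons]

lemma pow_le_interp {m M : ℕ} (h : m < M) {ε : ℝ} (hε : 0 < ε) :
    ∃ C : ℝ, 0 ≤ C ∧ ∀ X : ℝ, 0 ≤ X → X ^ m ≤ ε * X ^ M + C := by
  set R := max 1 (1 / ε)
  have hR1 : 1 ≤ R := le_max_left _ _
  refine ⟨R ^ m, by positivity, fun X hX => ?_⟩
  rcases le_total X R with hc | hc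
  · have := pow_le_pow_left₀ hX hc m
    have h2 : 0 ≤ ε * X ^ M := by positivity
    linarith
  · obtain ⟨d, rfl⟩ := Nat.exists_eq_add_of_lt h
    have hX1 : 1 ≤ X := hR1.trans hc
    have h1 : 1 ≤ ε * X := by
      have : 1 / ε ≤ X := (le_max_right _ _).trans hc
      rwa [div_le_iff₀ hε, mul_comm] at this
    have h2 : 1 ≤ ε * X * X ^ d := one_le_mul_of_one_le_of_one_le h1 (one_le_pow₀ hX1)
    have h3 : X ^ m ≤ X ^ m * (ε * X * X ^ d) := le_mul_of_one_le_right (by positivity) h2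
    have h4 : X ^ m * (ε * X * X ^ d) = ε * X ^ (m + d + 1) := by ring
    have : 0 ≤ R ^ m := by positivity
    linarith

/-- Interpolation between Sobolev energies. -/
lemma hs_interp {m M : ℕ} (h : m < M) {ε : ℝ} (hε : 0 < ε) :
    ∃ C : ℝ, 0 ≤ C ∧ ∀ f : SP n, hs m f ≤ ε * hs M f + C * nsq f := by
  obtain ⟨C, hC, H⟩ := pow_le_interp h hε
  refine ⟨C, hC, fun f => ?_⟩
  refine hasSum_le (fun k => ?_) (hasSum_hs m f)
    (((hasSum_hs M f).mul_left ε).add ((hasSum_nsq f).mul_left C))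
  have := mul_le_mul_of_nonneg_right (H (xi2 k) (xi2_nonneg k)) (qc_nonneg k f)
  linarith

lemma hs_le_add {m M : ℕ} (h : m ≤ M) (f : SP n) : hs m f ≤ hs M f + nsq f := by
  refine hasSum_le (fun k => ?_) (hasSum_hs m f) ((hasSum_hs M f).add (hasSum_nsq f))
  have h1 : xi2 k ^ m ≤ xi2 k ^ M + 1 := by
    rcases le_total (xi2 k) 1 with hc | hc
    · have := pow_le_one₀ (n := m) (xi2_nonneg k) hc
      have := pow_nonneg (xi2_nonneg k) M
      linarith
    · have := pow_le_pow_right₀ hc h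
      linarith
  have := mul_le_mul_of_nonneg_right h1 (qc_nonneg k f)
  linarith

lemma summable_prod_inv (n : ℕ) :
    Summable fun k : Fin n → ℤ => ∏ i, (1 + (k i : ℝ) ^ 2)⁻¹ := by
  have h1 : Summable fun j : ℤ => (1 + (j : ℝ) ^ 2)⁻¹ := by
    have h2 : Summable fun j : ℤ => (1 / |(j : ℝ)| ^ (2 : ℝ)) :=
      (Real.summable_one_div_int_add_rpow 0 2).2 (by norm_num) |>.congr fun j => by simp
    refine Summable.of_norm_bounded_eventually h2 ?_
    rw [Filter.eventually_cofinite]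
    refine (Set.finite_singleton (0 : ℤ)).subset fun j hj => ?_
    by_contra hne
    apply hj
    have hj0 : (0 : ℝ) < (j : ℝ) ^ 2 := by
      have : (j : ℝ) ≠ 0 := by exact_mod_cast hne
      positivity
    have e : |(j : ℝ)| ^ (2 : ℝ) = (j : ℝ) ^ 2 := by
      rw [Real.rpow_two, sq_abs]
    rw [e, Real.norm_of_nonneg (by positivity), ← one_div]
    exact one_div_le_one_div_of_le hj0 (by linarith)
  refine summable_of_sum_le (c := (∑' j : ℤ, (1 + (j : ℝ) ^ 2)⁻¹) ^ n)
    (fun k => Finset.prod_nonneg fun i _ => by positivity) fun s => ?_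
  classical
  have hsub : s ⊆ Fintype.piFinset fun i => s.image fun k => k i := fun k hk => by
    rw [Fintype.mem_piFinset]
    exact fun i => Finset.mem_image_of_mem _ hk
  refine (Finset.sum_le_sum_of_subset_of_nonneg hsub
    fun k _ _ => Finset.prod_nonneg fun i _ => by positivity).trans ?_
  rw [← Finset.prod_univ_sum (fun i => s.image fun k => k i) fun _ (j : ℤ) => (1 + (j : ℝ) ^ 2)⁻¹]
  refine (Finset.prod_le_prod (fun i _ => Finset.sum_nonneg fun j _ => by positivity)
    (g := fun _ => ∑' j : ℤ, (1 + (j : ℝ) ^ 2)⁻¹) fun i _ => ?_).trans (by simp)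
  exact h1.sum_le_tsum _ fun j _ => by positivity

lemma prod_one_add_le (k : Fin n → ℤ) :
    ∏ i, (1 + (k i : ℝ) ^ 2) ≤ 2 ^ n * (1 + xi2 k ^ n) := by
  have h1 : ∀ i, 1 + (k i : ℝ) ^ 2 ≤ 1 + xi2 k := fun i => by
    have h2 : freq k i ^ 2 ≤ xi2 k :=
      Finset.single_le_sum (f := fun i => freq k i ^ 2) (fun _ _ => sq_nonneg _) (Finset.mem_univ i)
    have h3 : (k i : ℝ) ^ 2 ≤ freq k i ^ 2 := by
      rw [freq, mul_pow]
      refine le_mul_of_one_le_left (sq_nonneg _) ?_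
      nlinarith [Real.pi_gt_three]
    linarith
  have h4 : ∏ i, (1 + (k i : ℝ) ^ 2) ≤ (1 + xi2 k) ^ n :=
    (Finset.prod_le_prod (fun i _ => by positivity) fun i _ => h1 i).trans (by simp)
  refine h4.trans ?_
  rcases le_total (xi2 k) 1 with hc | hc
  · have h5 : (1 + xi2 k) ^ n ≤ 2 ^ n :=
      pow_le_pow_left₀ (by linarith [xi2_nonneg k]) (by linarith) n
    have h6 : 0 ≤ xi2 k ^ n := pow_nonneg (xi2_nonneg k) n
    have h7 : (0 : ℝ) < 2 ^ n := by positivity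
    nlinarith
  · have h5 : (1 + xi2 k) ^ n ≤ (2 * xi2 k) ^ n :=
      pow_le_pow_left₀ (by linarith [xi2_nonneg k]) (by linarith) n
    rw [mul_pow] at h5
    have h7 : (0 : ℝ) < 2 ^ n := by positivity
    nlinarith

/-- Sobolev's inequality. -/
lemma sobolev (n : ℕ) : ∃ C : ℝ, 0 < C ∧ ∀ (f : SP n) (x : Vec n),
    f x ^ 2 ≤ C * (nsq f + hs n f) := by
  set S := ∑' k : Fin n → ℤ, ∏ i, (1 + (k i : ℝ) ^ 2)⁻¹
  have hS : 0 ≤ S := tsum_nonneg fun k => Finset.prod_nonneg fun i _ => by positivity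
  refine ⟨2 ^ n * S + 1, by positivity, fun f x => ?_⟩
  have hw : ∀ k : Fin n → ℤ, 0 < ∏ i, (1 + (k i : ℝ) ^ 2) := fun k =>
    Finset.prod_pos fun i _ => by positivity
  set E := nsq f + hs n f
  have hE : 0 ≤ E := add_nonneg (nsq_nonneg f) (hs_nonneg n f)
  have hsum : HasSum (fun k => 2 ^ n * (1 + xi2 k ^ n) * qc k f) (2 ^ n * E) := by
    refine (((hasSum_nsq f).add (hasSum_hs n f)).mul_left (2 ^ n)).congr_fun fun k => ?_
    ring
  have hfin : ∀ s : Finset (Fin n → ℤ), ∑ k ∈ s, √(qc k f) ≤ √(S * (2 ^ n * E)) := by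
    intro s
    refine Real.le_sqrt_of_sq_le ?_
    refine (Finset.sum_sq_le_sum_mul_sum_of_sq_le_mul s
      (f := fun k => ∏ i, (1 + (k i : ℝ) ^ 2)⁻¹)
      (g := fun k => (∏ i, (1 + (k i : ℝ) ^ 2)) * qc k f)
      (fun k _ => Finset.prod_nonneg fun i _ => by positivity)
      (fun k _ => mul_nonneg (hw k).le (qc_nonneg k f)) (fun k _ => ?_)).trans ?_
    · rw [Real.sq_sqrt (qc_nonneg k f), ← mul_assoc, ← Finset.prod_mul_distrib]
      rw [Finset.prod_eq_one fun i _ => inv_mul_cancel₀ (by positivity), one_mul]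
    · refine mul_le_mul ((summable_prod_inv n).sum_le_tsum _ fun k _ =>
        Finset.prod_nonneg fun i _ => by positivity) ?_
        (Finset.sum_nonneg fun k _ => mul_nonneg (hw k).le (qc_nonneg k f)) hS
      refine (Finset.sum_le_sum fun k _ =>
        mul_le_mul_of_nonneg_right (prod_one_add_le k) (qc_nonneg k f)).trans ?_
      rw [← hsum.tsum_eq]
      exact hsum.summable.sum_le_tsum _ fun k _ => by
        have := pow_nonneg (xi2_nonneg k) n
        have := qc_nonneg k f
        positivity
  have hsm : Summable fun k => √(qc k f) := summable_of_sum_le (fun _ => Real.sqrt_nonneg _) hfin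
  have h1 := (abs_le_tsum hsm x).trans (hsm.tsum_le_of_sum_le hfin)
  have h2 : f x ^ 2 ≤ S * (2 ^ n * E) := by
    rw [← sq_abs]
    refine (pow_le_pow_left₀ (abs_nonneg _) h1 2).trans ?_
    rw [Real.sq_sqrt (by positivity)]
  nlinarith

/-- The frequencies in the box of size `N`. -/
def box (n N : ℕ) : Finset (Fin n → ℤ) := Fintype.piFinset fun _ => Finset.Icc (-(N : ℤ)) N

lemma neg_mem_box {N : ℕ} {k : Fin n → ℤ} : -k ∈ box n N ↔ k ∈ box n N := by
  simp only [box, Fintype.mem_piFinset, Finset.mem_Icc, Pi.neg_apply]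
  exact forall_congr' fun i => by omega

/-- The Fourier truncation. -/
def proj (N : ℕ) (f : SP n) : SP n := ∑ k ∈ box n N, (ac k f • cosK k + bc k f • sinK k)

lemma ac_neg_freq (k : Fin n → ℤ) (f : SP n) : ac (-k) f = ac k f := by
  have : cosK (-k) = cosK k := by
    ext x
    have : phase (-k) x = - phase k x := by simp [phase]
    rw [cosK_apply, this, Real.cos_neg, cosK_apply]
  rw [ac, this, ac]

lemma bc_neg_freq (k : Fin n → ℤ) (f : SP n) : bc (-k) f = -bc k f := by
  have : sinK (-k) = -sinK k := by
    ext x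
    have : phase (-k) x = - phase k x := by simp [phase]
    rw [sinK_apply, this, Real.sin_neg, neg_apply, sinK_apply]
  rw [bc, this, ip_neg_right, bc]

lemma ac_proj (N : ℕ) (k : Fin n → ℤ) (f : SP n) :
    ac k (proj N f) = if k ∈ box n N then ac k f else 0 := by
  simp only [proj, ac_sum, ac_add, ac_smul, ac_cosK, ac_sinK, mul_zero,
    Finset.sum_const_zero, add_eq_zero_iff_eq_neg,
    add_zero,
    add_div, mul_add, Finset.sum_add_distrib]
  have h1 : ∀ j : Fin n → ℤ, ∑ x ∈ box n N, ac x f * ((if x = j then 1 else 0) / 2)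
      = if j ∈ box n N then ac j f / 2 else 0 := fun j => by
    simp [mul_ite, Finset.sum_ite_eq', div_eq_mul_inv]
  rw [h1, h1, ac_neg_freq]
  simp only [neg_mem_box]
  split_ifs <;> ring

lemma bc_proj (N : ℕ) (k : Fin n → ℤ) (f : SP n) :
    bc k (proj N f) = if k ∈ box n N then bc k f else 0 := by
  simp only [proj, bc_sum, bc_add, bc_smul, bc_sinK, bc_cosK, mul_zero, zero_add,
    add_eq_zero_iff_eq_neg, sub_div, mul_sub, Finset.sum_sub_distrib]
  have h1 : ∀ j : Fin n → ℤ, ∑ x ∈ box n N, bc x f * ((if x = j then 1 else 0) / 2)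
      = if j ∈ box n N then bc j f / 2 else 0 := fun j => by
    simp [mul_ite, Finset.sum_ite_eq', div_eq_mul_inv]
  rw [h1, h1, bc_neg_freq]
  simp only [neg_mem_box]
  split_ifs <;> ring

lemma ip_proj (N : ℕ) (f g : SP n) : ip (proj N f) g = ip f (proj N g) := by
  refine (hasSum_ip _ _).unique ((hasSum_ip f (proj N g)).congr_fun fun k => ?_)
  rw [ac_proj, bc_proj, ac_proj, bc_proj]
  split_ifs <;> simp

lemma D_proj (i : Fin n) (N : ℕ) (f : SP n) : D i (proj N f) = proj N (D i f) := by
  simp only [proj, map_sum, map_add, map_smul, D_cosK, D_sinK, ac_D, bc_D]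
  refine Finset.sum_congr rfl fun k _ => ?_
  module

lemma proj_add (N : ℕ) (f g : SP n) : proj N (f + g) = proj N f + proj N g := by
  simp only [proj, ac_add, bc_add, add_smul, ← Finset.sum_add_distrib]
  exact Finset.sum_congr rfl fun k _ => by abel

lemma proj_smul (N : ℕ) (c : ℝ) (f : SP n) : proj N (c • f) = c • proj N f := by
  simp only [proj, ac_smul, bc_smul, mul_smul, Finset.smul_sum, smul_add]

/-- The Fourier truncation as a linear map. -/
def projL (N : ℕ) : SP n →ₗ[ℝ] SP n where
  toFun := proj N
  map_add' := proj_add N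
  map_smul' := proj_smul N

lemma projL_apply (N : ℕ) (f : SP n) : projL N f = proj N f := rfl

lemma lapP_proj (m N : ℕ) (f : SP n) : lapP m (proj N f) = proj N (lapP m f) := by
  induction m with
  | zero => rfl
  | succ m ih =>
    rw [lapP_succ, lapP_succ, ih, lap_apply, lap_apply]
    simp only [← projL_apply, map_neg, map_sum]
    simp only [projL_apply, D_proj]

lemma qc_proj_le (N : ℕ) (k : Fin n → ℤ) (f : SP n) : qc k (proj N f) ≤ qc k f := by
  simp only [qc, ac_proj, bc_proj]
  split_ifs
  · rfl
  · have := qc_nonneg k f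
    simpa [qc] using this

lemma hs_proj_le (m N : ℕ) (f : SP n) : hs m (proj N f) ≤ hs m f :=
  hasSum_le (fun k => mul_le_mul_of_nonneg_left (qc_proj_le N k f) (pow_nonneg (xi2_nonneg k) m))
    (hasSum_hs m _) (hasSum_hs m f)

lemma nsq_sub_proj_le (N : ℕ) (f : SP n) : (N : ℝ) ^ 2 * nsq (f - proj N f) ≤ hs 1 f := by
  refine hasSum_le (fun k => ?_) ((hasSum_nsq (f - proj N f)).mul_left _) (hasSum_hs 1 f)
  simp only [qc, ac_sub, bc_sub, ac_proj, bc_proj]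
  split_ifs with h
  · have := xi2_nonneg k
    have := mul_nonneg (pow_nonneg this 1) (qc_nonneg k f)
    simpa [qc] using this
  · simp only [sub_zero, pow_one]
    refine mul_le_mul_of_nonneg_right ?_ (by positivity)
    simp only [box, Fintype.mem_piFinset, Finset.mem_Icc, not_forall] at h
    obtain ⟨i, hi⟩ := h
    have h1 : (N : ℤ) ^ 2 ≤ k i ^ 2 := by
      rw [sq_le_sq, abs_of_nonneg (Int.natCast_nonneg N), le_abs]
      omega
    have h2 : (N : ℝ) ^ 2 ≤ (k i : ℝ) ^ 2 := by exact_mod_cast h1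
    have h3 : (k i : ℝ) ^ 2 ≤ freq k i ^ 2 := by
      rw [freq, mul_pow]
      refine le_mul_of_one_le_left (sq_nonneg _) ?_
      nlinarith [Real.pi_gt_three]
    have h4 : freq k i ^ 2 ≤ xi2 k :=
      Finset.single_le_sum (f := fun i => freq k i ^ 2) (fun _ _ => sq_nonneg _) (Finset.mem_univ i)
    linarith

end SP

namespace SP

variable {n : ℕ}

lemma dI_one (I : Fin 1 → Fin n) (f : SP n) : dI 1 I f = D (I 0) f := rfl

lemma hs_D_le (m : ℕ) (i : Fin n) (f : SP n) : hs m (D i f) ≤ hs (m + 1) f :=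
  hs_dI_le m 1 (fun _ => i) f

lemma nsq_D_le (i : Fin n) (f : SP n) : nsq (D i f) ≤ hs 1 f := by
  rw [← hs_zero]; exact hs_D_le 0 i f

lemma nsq_mul_le_norm (f g : SP n) : nsq (f * g) ≤ ‖toC f‖ ^ 2 * nsq g :=
  nsq_mul_le (abs_le_norm_toC f)

/-- Commuting `∂_I` with multiplication costs one derivative. -/
lemma nsq_comm_dI (k : ℕ) (I : Fin (k + 1) → Fin n) (φ : SP n) : ∃ C : ℝ, 0 ≤ C ∧ ∀ w : SP n,
    nsq (dI (k + 1) I (φ * w) - φ * dI (k + 1) I w) ≤ C * (hs k w + nsq w) := by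
  induction k generalizing φ with
  | zero =>
    refine ⟨‖toC (D (I 0) φ)‖ ^ 2, by positivity, fun w => ?_⟩
    have : dI (0 + 1) I (φ * w) - φ * dI (0 + 1) I w = D (I 0) φ * w := by
      change D (I 0) (φ * w) - φ * D (I 0) w = _
      rw [D_mul]; ring
    rw [this, hs_zero]
    refine (nsq_mul_le_norm _ _).trans ?_
    have := mul_nonneg (sq_nonneg ‖toC (D (I 0) φ)‖) (nsq_nonneg w)
    linarith
  | succ k ih =>
    obtain ⟨C1, hC1, h1⟩ := ih (Fin.tail I) (D (I 0) φ)
    obtain ⟨C2, hC2, h2⟩ := ih (Fin.tail I) φ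
    set M := ‖toC (D (I 0) φ)‖ ^ 2
    have hM : 0 ≤ M := sq_nonneg _
    refine ⟨4 * M + 8 * C1 + 2 * (C2 * 2), by positivity, fun w => ?_⟩
    have e : dI (k + 1 + 1) I (φ * w) - φ * dI (k + 1 + 1) I w
        = ((dI (k + 1) (Fin.tail I) (D (I 0) φ * w) - D (I 0) φ * dI (k + 1) (Fin.tail I) w)
          + D (I 0) φ * dI (k + 1) (Fin.tail I) w)
          + (dI (k + 1) (Fin.tail I) (φ * D (I 0) w)
            - φ * dI (k + 1) (Fin.tail I) (D (I 0) w)) := by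
      rw [dI_succ' (k + 1), dI_succ' (k + 1), D_mul, map_add]; ring
    rw [e]
    refine (nsq_add_le _ _).trans ?_
    have a1 := nsq_add_le (dI (k + 1) (Fin.tail I) (D (I 0) φ * w)
      - D (I 0) φ * dI (k + 1) (Fin.tail I) w) (D (I 0) φ * dI (k + 1) (Fin.tail I) w)
    have a2 := h1 w
    have a3 : nsq (D (I 0) φ * dI (k + 1) (Fin.tail I) w) ≤ M * hs (k + 1) w :=
      (nsq_mul_le_norm _ _).trans (mul_le_mul_of_nonneg_left (nsq_dI_le _ _ _) hM)
    have a4 := h2 (D (I 0) w)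
    have a5 := hs_D_le k (I 0) w
    have a6 := nsq_D_le (I 0) w
    have a7 := hs_le_add (show 1 ≤ k + 1 by omega) w
    have a8 := hs_le_add (show k ≤ k + 1 by omega) w
    have a9 := nsq_nonneg w
    have b1 : C2 * (hs k (D (I 0) w) + nsq (D (I 0) w)) ≤ C2 * (2 * (hs (k + 1) w + nsq w)) :=
      mul_le_mul_of_nonneg_left (by linarith) hC2
    have b2 : C1 * (hs k w + nsq w) ≤ C1 * (2 * (hs (k + 1) w + nsq w)) :=
      mul_le_mul_of_nonneg_left (by linarith [hs_nonneg (k + 1) w]) hC1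
    have b3 : 0 ≤ M * nsq w := mul_nonneg hM a9
    nlinarith

/-- Powers of the Laplacian as combinations of iterated partial derivatives. -/
lemma exists_lapP_eq (m : ℕ) : ∃ c : (Fin (2 * m) → Fin n) → ℝ, ∀ f : SP n,
    lapP m f = ∑ I, c I • dI (2 * m) I f := by
  induction m with
  | zero => exact ⟨fun _ => 1, fun f => by simp⟩
  | succ m ih =>
    obtain ⟨c, hc⟩ := ih
    refine ⟨fun J : Fin (2 * m + 1 + 1) → Fin n =>
      if J 0 = J 1 then -c (Fin.tail (Fin.tail J)) else 0, fun f => ?_⟩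
    rw [lapP_succ, hc, lap_apply]
    have e : ∑ I : Fin (2 * m + 1 + 1) → Fin n,
        (if I 0 = I 1 then -c (Fin.tail (Fin.tail I)) else 0)
        • dI (2 * m + 1 + 1) I f = -∑ i, D i (D i (∑ I, c I • dI (2 * m) I f)) := by
      rw [sum_tuple_succ, ← Finset.sum_neg_distrib]
      refine Finset.sum_congr rfl fun i _ => ?_
      rw [sum_tuple_succ]
      have : ∀ j, (∑ J : Fin (2 * m) → Fin n,
          (if (Fin.cons i (Fin.cons j J : Fin (2 * m + 1) → Fin n) : Fin (2 * m + 1 + 1) → Fin n) 0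
            = (Fin.cons i (Fin.cons j J : Fin (2 * m + 1) → Fin n) : Fin (2 * m + 1 + 1) → Fin n) 1
            then -c (Fin.tail (Fin.tail (n := 2 * m + 1)
              (Fin.cons i (Fin.cons j J : Fin (2 * m + 1) → Fin n) : Fin (2 * m + 1 + 1) → Fin n)))
            else 0) • dI (2 * m + 1 + 1) (Fin.cons i (Fin.cons j J : Fin (2 * m + 1) → Fin n)) f)
          = if j = i then -∑ J, c J • D i (D i (dI (2 * m) J f)) else 0 := by
        intro j
        have h01 : ∀ J : Fin (2 * m) → Fin n,
          (Fin.cons i (Fin.cons j J : Fin (2 * m + 1) → Fin n) :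
            Fin (2 * m + 1 + 1) → Fin n) 1 = j :=
          fun J => rfl
        simp only [Fin.cons_zero, h01, Fin.tail_cons, dI_succ]
        split_ifs with h1 h2 h2
        · subst h1; simp
        · exact absurd h1.symm h2
        · exact absurd h2.symm h1
        · simp
      simp only [this, Finset.sum_ite_eq', Finset.mem_univ, if_true, map_sum, map_smul]
    exact e.symm

/-- Commuting a power of the Laplacian with multiplication costs one derivative. -/
lemma nsq_comm_lapP (m : ℕ) (φ : SP n) : ∃ C : ℝ, 0 ≤ C ∧ ∀ w : SP n,
    nsq (lapP (m + 1) (φ * w) - φ * lapP (m + 1) w) ≤ C * (hs (2 * m + 1) w + nsq w) := by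
  obtain ⟨c, hc⟩ := exists_lapP_eq (n := n) (m + 1)
  choose C hC H using fun I => nsq_comm_dI (n := n) (2 * m + 1) I φ
  refine ⟨(Finset.univ : Finset (Fin (2 * m + 1 + 1) → Fin n)).card * ∑ I, c I ^ 2 * C I,
    mul_nonneg (Nat.cast_nonneg _)
      (Finset.sum_nonneg fun I _ => mul_nonneg (sq_nonneg _) (hC I)), fun w => ?_⟩
  have e : lapP (m + 1) (φ * w) - φ * lapP (m + 1) w = ∑ I : Fin (2 * m + 1 + 1) → Fin n,
      c I • (dI (2 * m + 1 + 1) I (φ * w) - φ * dI (2 * m + 1 + 1) I w) := by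
    rw [hc, hc, Finset.mul_sum, ← Finset.sum_sub_distrib]
    exact Finset.sum_congr rfl fun I _ => by rw [smul_sub, mul_smul_comm]; rfl
  rw [e]
  refine (nsq_sum_le _ _).trans ?_
  rw [mul_assoc, Finset.sum_mul]
  refine mul_le_mul_of_nonneg_left (Finset.sum_le_sum fun I _ => ?_) (Nat.cast_nonneg _)
  rw [nsq_smul, mul_assoc]
  exact mul_le_mul_of_nonneg_left (H I w) (sq_nonneg _)

lemma ac_dI_even (k : Fin n → ℤ) (m : ℕ) (I : Fin (2 * m) → Fin n) (f : SP n) :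
    ac k (dI (2 * m) I f) = (-1) ^ m * (∏ j, freq k (I j)) * ac k f ∧
    bc k (dI (2 * m) I f) = (-1) ^ m * (∏ j, freq k (I j)) * bc k f := by
  induction m with
  | zero => simp
  | succ m ih =>
    obtain ⟨h1, h2⟩ := ih (Fin.tail (Fin.tail (n := 2 * m + 1) I))
    have e : dI (2 * (m + 1)) I f
        = D (I 0) (D (I 1) (dI (2 * m) (Fin.tail (Fin.tail (n := 2 * m + 1) I)) f)) := rfl
    have p : ∏ j, freq k (I j) = freq k (I 0) * (freq k (I 1) *
        ∏ j, freq k ((Fin.tail (Fin.tail (n := 2 * m + 1) I)) j)) := by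
      change ∏ j : Fin (2 * m + 1 + 1), freq k (I j) = _
      rw [Fin.prod_univ_succ, Fin.prod_univ_succ]; rfl
    rw [e, ac_D, bc_D, bc_D, ac_D, h1, h2, p]
    constructor <;> ring

/-- Total homogeneous energy of order `m` of a vector-valued function. -/
def HS {l : ℕ} (m : ℕ) (w : Fin l → SP n) : ℝ := ∑ a, hs m (w a)

/-- Total squared `L²` norm. -/
def NS {l : ℕ} (w : Fin l → SP n) : ℝ := ∑ a, nsq (w a)

lemma HS_nonneg {l : ℕ} (m : ℕ) (w : Fin l → SP n) : 0 ≤ HS m w :=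
  Finset.sum_nonneg fun _ _ => hs_nonneg _ _
lemma NS_nonneg {l : ℕ} (w : Fin l → SP n) : 0 ≤ NS w :=
  Finset.sum_nonneg fun _ _ => nsq_nonneg _
lemma hs_le_HS {l : ℕ} (m : ℕ) (w : Fin l → SP n) (a : Fin l) : hs m (w a) ≤ HS m w :=
  Finset.single_le_sum (f := fun a => hs m (w a)) (fun _ _ => hs_nonneg _ _) (Finset.mem_univ a)
lemma nsq_le_NS {l : ℕ} (w : Fin l → SP n) (a : Fin l) : nsq (w a) ≤ NS w :=
  Finset.single_le_sum (f := fun a => nsq (w a)) (fun _ _ => nsq_nonneg _) (Finset.mem_univ a)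

lemma HS_interp {l : ℕ} {m M : ℕ} (h : m < M) {ε : ℝ} (hε : 0 < ε) :
    ∃ C : ℝ, 0 ≤ C ∧ ∀ f : Fin l → SP n, HS m f ≤ ε * HS M f + C * NS f := by
  obtain ⟨C, hC, H⟩ := hs_interp (n := n) h hε
  refine ⟨C, hC, fun f => ?_⟩
  simp only [HS, NS, Finset.mul_sum, ← Finset.sum_add_distrib]
  exact Finset.sum_le_sum fun a _ => H (f a)

lemma HS_le_add {l : ℕ} {m M : ℕ} (h : m ≤ M) (f : Fin l → SP n) : HS m f ≤ HS M f + NS f := by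
  simp only [HS, NS, ← Finset.sum_add_distrib]
  exact Finset.sum_le_sum fun a _ => hs_le_add h (f a)

/-- Gårding's inequality for constant coefficients. -/
lemma garding_const {l h : ℕ} (A : (Fin (2 * h) → Fin n) → Fin l → Fin l → ℝ) {lam : ℝ}
    (hA : ∀ (ξ : Fin n → ℝ) (v : Fin l → ℝ), lam * (∑ i, ξ i ^ 2) ^ h * (∑ a, v a ^ 2) ≤
      (-1) ^ (h + 1) * ∑ I, ∑ a, ∑ b, A I a b * (∏ j, ξ (I j)) * v a * v b)
    (w : Fin l → SP n) :
    ∑ I, ∑ a, ∑ b, A I a b * ip (dI (2 * h) I (w b)) (lapP h (w a)) ≤ -(lam * HS (2 * h) w) := by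
  have h1 : HasSum (fun k => ∑ I, ∑ a, ∑ b, A I a b * (xi2 k ^ h *
      (ac k (dI (2 * h) I (w b)) * ac k (w a) + bc k (dI (2 * h) I (w b)) * bc k (w a))))
      (∑ I, ∑ a, ∑ b, A I a b * ip (dI (2 * h) I (w b)) (lapP h (w a))) :=
    hasSum_sum fun I _ => hasSum_sum fun a _ => hasSum_sum fun b _ =>
      (hasSum_ip_lapP h _ _).mul_left _
  have h2 : HasSum (fun k => -(lam * ∑ a, xi2 k ^ (2 * h) * qc k (w a))) (-(lam * HS (2 * h) w)) :=
    ((hasSum_sum fun a _ => hasSum_hs (2 * h) (w a)).mul_left lam).neg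
  refine hasSum_le (fun k => ?_) h1 h2
  have key : ∀ v : Fin l → ℝ, ∑ I, ∑ a, ∑ b, A I a b * (xi2 k ^ h * (((-1) ^ h *
      (∏ j, freq k (I j)) * v b) * v a)) ≤ -(lam * xi2 k ^ (2 * h) * ∑ a, v a ^ 2) := by
    intro v
    have h3 := mul_le_mul_of_nonneg_left (hA (freq k) v) (pow_nonneg (xi2_nonneg k) h)
    have h4 : ∑ I, ∑ a, ∑ b, A I a b * (xi2 k ^ h * (((-1) ^ h * (∏ j, freq k (I j)) * v b) * v a))
        = -(xi2 k ^ h * ((-1) ^ (h + 1) *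
          ∑ I, ∑ a, ∑ b, A I a b * (∏ j, freq k (I j)) * v a * v b)) := by
      simp only [Finset.mul_sum, ← Finset.sum_neg_distrib]
      refine Finset.sum_congr rfl fun I _ => Finset.sum_congr rfl fun a _ =>
        Finset.sum_congr rfl fun b _ => ?_
      ring
    rw [h4]
    have h5 : xi2 k ^ h * (lam * (∑ i, freq k i ^ 2) ^ h * ∑ a, v a ^ 2)
        = lam * xi2 k ^ (2 * h) * ∑ a, v a ^ 2 := by
      rw [← xi2]; ring
    linarith
  have k1 := key fun a => ac k (w a)
  have k2 := key fun a => bc k (w a)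
  have e1 : ∑ I, ∑ a, ∑ b, A I a b * (xi2 k ^ h *
      (ac k (dI (2 * h) I (w b)) * ac k (w a) + bc k (dI (2 * h) I (w b)) * bc k (w a)))
      = (∑ I, ∑ a, ∑ b, A I a b * (xi2 k ^ h * (((-1) ^ h *
          (∏ j, freq k (I j)) * ac k (w b)) * ac k (w a))))
        + ∑ I, ∑ a, ∑ b, A I a b * (xi2 k ^ h * (((-1) ^ h *
          (∏ j, freq k (I j)) * bc k (w b)) * bc k (w a))) := by
    simp only [← Finset.sum_add_distrib]
    refine Finset.sum_congr rfl fun I _ => Finset.sum_congr rfl fun a _ =>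
        Finset.sum_congr rfl fun b _ => ?_
    rw [(ac_dI_even k h I _).1, (ac_dI_even k h I _).2]; ring
  have e2 : ∑ a, xi2 k ^ (2 * h) * qc k (w a)
      = xi2 k ^ (2 * h) * ((∑ a, ac k (w a) ^ 2) + ∑ a, bc k (w a) ^ 2) := by
    rw [← Finset.mul_sum, ← Finset.sum_add_distrib]; rfl
  rw [e1, e2]
  linarith

end SP

namespace SP

variable {n : ℕ}

/-- Functionals of lower order relative to the homogeneous energy of order `r`. -/
def Negl {l : ℕ} (r : ℕ) (E : (Fin l → SP n) → ℝ) : Prop :=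
  ∀ ε : ℝ, 0 < ε → ∃ C : ℝ, 0 ≤ C ∧ ∀ w, |E w| ≤ ε * HS r w + C * NS w

namespace Negl

variable {l r : ℕ} {E E' : (Fin l → SP n) → ℝ}

lemma mono (h : Negl r E') (hle : ∀ w, |E w| ≤ |E' w|) : Negl r E := fun ε hε => by
  obtain ⟨C, hC, H⟩ := h ε hε
  exact ⟨C, hC, fun w => (hle w).trans (H w)⟩

lemma const_mul (c : ℝ) (h : Negl r E) : Negl r fun w => c * E w := fun ε hε => by
  obtain ⟨C, hC, H⟩ := h (ε / (|c| + 1)) (by positivity)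
  refine ⟨|c| * C, by positivity, fun w => ?_⟩
  rw [abs_mul]
  refine (mul_le_mul_of_nonneg_left (H w) (abs_nonneg c)).trans ?_
  have h1 : |c| * (ε / (|c| + 1)) ≤ ε := by
    rw [mul_div_assoc', div_le_iff₀ (by positivity)]; nlinarith [abs_nonneg c]
  have := mul_le_mul_of_nonneg_right h1 (HS_nonneg r w)
  linarith

lemma neg (h : Negl r E) : Negl r fun w => -E w := h.mono fun w => by rw [abs_neg]

lemma add (h : Negl r E) (h' : Negl r E') : Negl r fun w => E w + E' w := fun ε hε => by
  obtain ⟨C, hC, H⟩ := h (ε / 2) (by positivity)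
  obtain ⟨C', hC', H'⟩ := h' (ε / 2) (by positivity)
  refine ⟨C + C', by positivity, fun w => ?_⟩
  have := abs_add_le (E w) (E' w)
  linarith [H w, H' w]

lemma zero : Negl r fun _ : Fin l → SP n => 0 := fun ε hε =>
  ⟨0, le_rfl, fun w => by simpa using mul_nonneg hε.le (HS_nonneg r w)⟩

lemma sum {ι : Type*} (s : Finset ι) {F : ι → (Fin l → SP n) → ℝ} (h : ∀ i ∈ s, Negl r (F i)) :
    Negl r fun w => ∑ i ∈ s, F i w := by
  classical
  induction s using Finset.induction_on with
  | empty => simpa using zero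
  | insert i s hi ih =>
    simp only [Finset.sum_insert hi]
    exact (h i (Finset.mem_insert_self _ _)).add
      (ih fun j hj => h j (Finset.mem_insert_of_mem hj))

lemma of_le {m : ℕ} (hm : m < r) {C : ℝ} (hC : 0 ≤ C)
    (h : ∀ w, |E w| ≤ C * (HS m w + NS w)) : Negl r E := fun ε hε => by
  obtain ⟨C', hC', H⟩ := HS_interp (n := n) (l := l) hm (ε := ε / (C + 1)) (by positivity)
  refine ⟨C * (C' + 1), by positivity, fun w => (h w).trans ?_⟩
  have h1 : C * (ε / (C + 1)) ≤ ε := by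
    rw [mul_div_assoc', div_le_iff₀ (by positivity)]; nlinarith
  have := mul_le_mul_of_nonneg_right h1 (HS_nonneg r w)
  have := mul_le_mul_of_nonneg_left (H w) hC
  linarith

lemma ip {X R : (Fin l → SP n) → SP n} {C : ℝ} (hC : 0 ≤ C)
    (hX : ∀ w, nsq (X w) ≤ C * (HS r w + NS w)) (hR : Negl r fun w => nsq (R w)) :
    Negl r fun w => ip (X w) (R w) := fun ε hε => by
  set e := ε / (2 * (C + 1)) with he
  have he0 : 0 < e := by positivity
  have h1 : e * C ≤ ε / 2 := by
    rw [he, div_mul_eq_mul_div, div_le_div_iff₀ (by positivity) (by positivity)]; nlinarith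
  obtain ⟨C', hC', H⟩ := hR.const_mul (1 / (4 * e)) (ε / 2) (by positivity)
  refine ⟨ε / 2 + C', by positivity, fun w => (abs_ip_le_young _ _ he0).trans ?_⟩
  have h2 := (le_abs_self _).trans (H w)
  have h3 := mul_le_mul_of_nonneg_left (hX w) he0.le
  have h4 := mul_le_mul_of_nonneg_right h1 (add_nonneg (HS_nonneg r w) (NS_nonneg w))
  linarith

lemma bound (h : Negl r E) : ∃ C : ℝ, 0 ≤ C ∧ ∀ w, |E w| ≤ C * (HS r w + NS w) := by
  obtain ⟨C, hC, H⟩ := h 1 one_pos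
  refine ⟨C + 1, by positivity, fun w => (H w).trans ?_⟩
  nlinarith [HS_nonneg r w, NS_nonneg w, mul_nonneg hC (HS_nonneg r w)]

lemma ip_sub_ip {X X₀ Y Y₀ : (Fin l → SP n) → SP n} {C : ℝ} (hC : 0 ≤ C)
    (hX : ∀ w, nsq (X₀ w) ≤ C * (HS r w + NS w)) (hY : ∀ w, nsq (Y₀ w) ≤ C * (HS r w + NS w))
    (hRX : Negl r fun w => nsq (X w - X₀ w)) (hRY : Negl r fun w => nsq (Y w - Y₀ w)) :
    Negl r fun w => SP.ip (X w) (Y w) - SP.ip (X₀ w) (Y₀ w) := by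
  obtain ⟨C', hC', H⟩ := hRX.bound
  have h := (((Negl.ip hC hX hRY).add (Negl.ip hC hY hRX)).add
    (Negl.ip hC' (fun w => (le_abs_self _).trans (H w)) hRY))
  refine h.mono fun w => le_of_eq ?_
  congr 1
  simp only [ip_sub_left, ip_sub_right]
  rw [ip_comm (Y₀ w) (X w), ip_comm (Y₀ w) (X₀ w)]
  ring

end Negl

lemma nsq_mul_le_of_norm {l r : ℕ} (φ : SP n) (X : (Fin l → SP n) → SP n) {w : Fin l → SP n}
    (h : nsq (X w) ≤ HS r w) : nsq (φ * X w) ≤ ‖toC φ‖ ^ 2 * (HS r w + NS w) :=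
  (nsq_mul_le_norm _ _).trans
    (mul_le_mul_of_nonneg_left (h.trans (by linarith [NS_nonneg w])) (sq_nonneg _))

lemma negl_comm_dI {l : ℕ} (k : ℕ) (I : Fin (k + 1) → Fin n) (φ : SP n) (b : Fin l) :
    Negl (k + 1) fun w : Fin l → SP n =>
      nsq (dI (k + 1) I (φ * w b) - φ * dI (k + 1) I (w b)) := by
  obtain ⟨C, hC, H⟩ := nsq_comm_dI k I φ
  refine Negl.of_le (lt_add_one k) hC fun w => ?_
  rw [abs_of_nonneg (nsq_nonneg _)]
  exact (H (w b)).trans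
    (mul_le_mul_of_nonneg_left (add_le_add (hs_le_HS k w b) (nsq_le_NS w b)) hC)

lemma negl_comm_lapP {l : ℕ} (m : ℕ) (φ : SP n) (b : Fin l) :
    Negl (2 * (m + 1)) fun w : Fin l → SP n =>
      nsq (lapP (m + 1) (φ * w b) - φ * lapP (m + 1) (w b)) := by
  obtain ⟨C, hC, H⟩ := nsq_comm_lapP m φ
  refine Negl.of_le (show 2 * m + 1 < 2 * (m + 1) by omega) hC fun w => ?_
  rw [abs_of_nonneg (nsq_nonneg _)]
  exact (H (w b)).trans
    (mul_le_mul_of_nonneg_left (add_le_add (hs_le_HS _ w b) (nsq_le_NS w b)) hC)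

/-- A smooth periodic quadratic partition of unity on whose members given smooth periodic functions
are nearly constant. -/
lemma exists_partition {ι : Type*} [Fintype ι] (A : ι → SP n) {η : ℝ} (hη : 0 < η) :
    ∃ (κ : Type) (_ : Fintype κ) (φ : κ → SP n) (y : κ → Vec n), (∑ m, φ m * φ m = 1) ∧
      ∀ m i x, φ m x ≠ 0 → |A i x - A i (y m)| ≤ η := by
  classical
  let β : Vec n → SP n := fun y => mk
    (fun x => Real.smoothTransition (η ^ 2 - ∑ i, (A i x - A i y) ^ 2))
    (Real.smoothTransition.contDiff.comp (contDiff_const.sub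
      (ContDiff.sum fun i _ => ((A i).smooth.sub contDiff_const).pow 2)))
    (fun x m => by
      exact congrArg (fun s => Real.smoothTransition (η ^ 2 - s)) (Finset.sum_congr rfl
        fun i _ => congrArg (fun c => (c - A i y) ^ 2) ((A i).per x m)))
  have hβ : ∀ y x, β y x = Real.smoothTransition (η ^ 2 - ∑ i, (A i x - A i y) ^ 2) :=
    fun _ _ => rfl
  have hβ0 : ∀ y x, 0 ≤ β y x := fun y x => Real.smoothTransition.nonneg _
  have hβη : ∀ y i x, β y x ≠ 0 → |A i x - A i y| ≤ η := by
    intro y i x h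
    by_contra! hc
    refine h (Real.smoothTransition.zero_of_nonpos ?_)
    have h1 := Finset.single_le_sum (f := fun i => (A i x - A i y) ^ 2)
      (fun _ _ => sq_nonneg _) (Finset.mem_univ i)
    have h2 : η ^ 2 ≤ (A i x - A i y) ^ 2 := by
      rw [← sq_abs (A i x - A i y)]; gcongr
    have h3 : (A i x - A i y) ^ 2 ≤ ∑ i, (A i x - A i y) ^ 2 := h1
    linarith
  obtain ⟨t, ht⟩ := (isCompact_univ (X := UnitAddTorus (Fin n))).elim_finite_subcover
    (fun y => {p | 0 < toC (β y) p}) (fun y => isOpen_lt continuous_const (toC (β y)).continuous)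
    (fun p _ => Set.mem_iUnion.2 ⟨rep p, by
      change 0 < β (rep p) (rep p)
      rw [hβ]; exact Real.smoothTransition.pos_of_pos (by simpa using pow_pos hη 2)⟩)
  have hpos : ∀ x, 0 < ∑ y ∈ t, β y x ^ 2 := by
    intro x
    obtain ⟨y, hy, hyx⟩ := Set.mem_iUnion₂.1 (ht (Set.mem_univ (toTorus x)))
    have h1 : 0 < β y x := by
      have : 0 < toC (β y) (toTorus x) := hyx
      rwa [toC_toTorus] at this
    exact Finset.sum_pos' (fun _ _ => sq_nonneg _) ⟨y, hy, by positivity⟩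
  let ρ : SP n := mk (fun x => (Real.sqrt (∑ y ∈ t, β y x ^ 2))⁻¹)
    (((ContDiff.sum fun y _ => (β y).smooth.pow 2).sqrt fun x => (hpos x).ne').inv
      fun x => (Real.sqrt_pos.2 (hpos x)).ne')
    (fun x m => by
      exact congrArg (fun s => (Real.sqrt s)⁻¹) (Finset.sum_congr rfl
        fun y _ => congrArg (fun c => c ^ 2) ((β y).per x m)))
  let e := t.equivFin.symm
  refine ⟨Fin t.card, inferInstance, fun m => β (e m) * ρ, fun m => e m, ?_, ?_⟩
  · ext x
    have h1 : ρ x ^ 2 * ∑ y ∈ t, β y x ^ 2 = 1 := by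
      change ((Real.sqrt (∑ y ∈ t, β y x ^ 2))⁻¹) ^ 2 * _ = 1
      rw [inv_pow, Real.sq_sqrt (hpos x).le, inv_mul_cancel₀ (hpos x).ne']
    rw [sum_apply, one_apply, ← h1, Finset.mul_sum, ← Finset.sum_coe_sort t, ← e.sum_comp]
    refine Finset.sum_congr rfl fun m _ => ?_
    simp only [mul_apply]; ring
  · intro m i x h
    refine hβη _ i x fun h0 => h ?_
    simp [h0]

lemma sum_nsq_mul {κ : Type*} [Fintype κ] {φ : κ → SP n} (h : ∑ m, φ m * φ m = 1) (f : SP n) :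
    ∑ m, nsq (φ m * f) = nsq f := by
  have : ∑ m, φ m * f * (φ m * f) = f * f := by
    calc _ = (∑ m, φ m * φ m) * (f * f) := by
          rw [Finset.sum_mul]; exact Finset.sum_congr rfl fun m _ => by ring
      _ = _ := by rw [h, one_mul]
  simp only [nsq, ← map_sum, this]

lemma sum_ip_mul {κ : Type*} [Fintype κ] {φ : κ → SP n} (h : ∑ m, φ m * φ m = 1) (A f g : SP n) :
    ∑ m, ip (A * (φ m * f)) (φ m * g) = ip (A * f) g := by
  have : ∑ m, A * (φ m * f) * (φ m * g) = A * f * g := by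
    calc _ = (∑ m, φ m * φ m) * (A * f * g) := by
          rw [Finset.sum_mul]; exact Finset.sum_congr rfl fun m _ => by ring
      _ = _ := by rw [h, one_mul]
  simp only [ip, ← map_sum, this]

/-- Gårding's inequality with variable coefficients. -/
lemma garding {l h : ℕ} (hh : 1 ≤ h) (A : (Fin (2 * h) → Fin n) → Fin l → Fin l → SP n) {lam : ℝ}
    (hlam : 0 < lam)
    (hA : ∀ (x : Vec n) (ξ : Fin n → ℝ) (v : Fin l → ℝ),
      lam * (∑ i, ξ i ^ 2) ^ h * (∑ a, v a ^ 2) ≤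
      (-1) ^ (h + 1) * ∑ I, ∑ a, ∑ b, A I a b x * (∏ j, ξ (I j)) * v a * v b) :
    ∃ C : ℝ, 0 ≤ C ∧ ∀ w : Fin l → SP n,
      ∑ I, ∑ a, ∑ b, ip (A I a b * dI (2 * h) I (w b)) (lapP h (w a))
        ≤ -(lam / 2 * HS (2 * h) w) + C * NS w := by
  classical
  obtain ⟨m, rfl⟩ : ∃ m, h = m + 1 := ⟨h - 1, by omega⟩
  set K : ℝ := (Fintype.card (Fin (2 * (m + 1)) → Fin n)) *
    ((Fintype.card (Fin l)) * (Fintype.card (Fin l)))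
    with hK
  have hK0 : 0 ≤ K := by positivity
  set η : ℝ := lam / (4 * (K + 1)) with hη
  have hη0 : 0 < η := by positivity
  have hKη : K * η ≤ lam / 4 := by
    rw [hη, mul_div_assoc', div_le_div_iff₀ (by positivity) (by positivity)]; nlinarith
  obtain ⟨κ, _, φ, y, hφ, hφA⟩ := exists_partition
    (fun i : (Fin (2 * (m + 1)) → Fin n) × Fin l × Fin l => A i.1 i.2.1 i.2.2) hη0
  -- the frozen principal parts
  have n1 : ∀ p I a b, Negl (2 * (m + 1)) fun w : Fin l → SP n =>
      ip (dI (2 * (m + 1)) I (φ p * w b)) (lapP (m + 1) (φ p * w a))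
        - ip (φ p * dI (2 * (m + 1)) I (w b)) (φ p * lapP (m + 1) (w a)) := by
    intro p I a b
    refine Negl.ip_sub_ip (sq_nonneg ‖toC (φ p)‖)
      (fun w => nsq_mul_le_of_norm (φ p) (fun w => dI (2 * (m + 1)) I (w b))
        ((nsq_dI_le _ _ _).trans (hs_le_HS (2 * (m + 1)) w b)))
      (fun w => nsq_mul_le_of_norm (φ p) (fun w => lapP (m + 1) (w a))
        ((nsq_lapP _ _).le.trans (hs_le_HS (2 * (m + 1)) w a)))
      (negl_comm_dI _ I (φ p) b) (negl_comm_lapP m (φ p) a)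
  have n2 : ∀ p a, Negl (2 * (m + 1)) fun w : Fin l → SP n =>
      ip (lapP (m + 1) (φ p * w a)) (lapP (m + 1) (φ p * w a))
        - ip (φ p * lapP (m + 1) (w a)) (φ p * lapP (m + 1) (w a)) := by
    intro p a
    exact Negl.ip_sub_ip (sq_nonneg ‖toC (φ p)‖)
      (fun w => nsq_mul_le_of_norm (φ p) (fun w => lapP (m + 1) (w a))
        ((nsq_lapP _ _).le.trans (hs_le_HS (2 * (m + 1)) w a)))
      (fun w => nsq_mul_le_of_norm (φ p) (fun w => lapP (m + 1) (w a))
        ((nsq_lapP _ _).le.trans (hs_le_HS (2 * (m + 1)) w a)))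
      (negl_comm_lapP m (φ p) a) (negl_comm_lapP m (φ p) a)
  have N1 := Negl.sum (Finset.univ : Finset κ) fun p _ =>
    Negl.sum Finset.univ fun I _ => Negl.sum Finset.univ fun a _ => Negl.sum Finset.univ fun b _ =>
      (n1 p I a b).const_mul (A I a b (y p))
  have N2 := Negl.sum (Finset.univ : Finset κ) fun p _ =>
    Negl.sum Finset.univ fun a _ => n2 p a
  obtain ⟨C, hC, H⟩ := (N1.neg.add (N2.const_mul (-lam))) (lam / 4) (by positivity)
  refine ⟨C, hC, fun w => ?_⟩
  have Hw := (le_abs_self _).trans (H w)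
  simp only at Hw
  have g1 : ∑ p, (∑ I, ∑ a, ∑ b, A I a b (y p) *
      ip (dI (2 * (m + 1)) I (φ p * w b)) (lapP (m + 1) (φ p * w a)))
      ≤ ∑ p, -(lam * HS (2 * (m + 1)) (fun a => φ p * w a)) :=
    Finset.sum_le_sum fun p _ => garding_const (h := m + 1) (fun I a b => A I a b (y p))
      (fun ξ v => hA (y p) ξ v) (fun a => φ p * w a)
  have g2 : ∑ p, ∑ a, ip (φ p * lapP (m + 1) (w a)) (φ p * lapP (m + 1) (w a)) =
      HS (2 * (m + 1)) w := by
    rw [Finset.sum_comm]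
    refine Finset.sum_congr rfl fun a _ => ?_
    rw [← nsq_lapP, ← sum_nsq_mul hφ (lapP (m + 1) (w a))]; rfl
  have g3 : ∑ p, HS (2 * (m + 1)) (fun a => φ p * w a)
      = ∑ p, ∑ a, ip (lapP (m + 1) (φ p * w a)) (lapP (m + 1) (φ p * w a)) :=
    Finset.sum_congr rfl fun p _ => Finset.sum_congr rfl fun a _ => (nsq_lapP _ _).symm
  have g4 : ∀ p I a b, ip (A I a b * (φ p * dI (2 * (m + 1)) I (w b))) (φ p * lapP (m + 1) (w a))
      ≤ A I a b (y p) * ip (φ p * dI (2 * (m + 1)) I (w b)) (φ p * lapP (m + 1) (w a))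
        + η / 2 * (nsq (φ p * dI (2 * (m + 1)) I (w b)) + nsq (φ p * lapP (m + 1) (w a))) := by
    intro p I a b
    set X := φ p * dI (2 * (m + 1)) I (w b)
    set Y := φ p * lapP (m + 1) (w a)
    have e1 : A I a b * X = A I a b (y p) • X + (A I a b - A I a b (y p) • 1) * X := by
      rw [sub_mul, smul_mul_assoc, one_mul]; ring
    rw [e1, ip_add_left, ip_smul_left]
    have e2 := ip_le_young ((A I a b - A I a b (y p) • 1) * X) Y (ε := 1 / (2 * η)) (by positivity)
    have e3 : nsq ((A I a b - A I a b (y p) • 1) * X) ≤ η ^ 2 * nsq X := by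
      have := nsq_le_of_abs_le (Finset.univ : Finset Unit)
        (f := (A I a b - A I a b (y p) • 1) * X) (g := fun _ => η • X) (c := 0) fun x => by
          simp only [Finset.univ_unique, Finset.sum_singleton, zero_add, mul_apply, sub_apply,
            smul_apply, one_apply, mul_one, mul_pow]
          by_cases h0 : φ p x = 0
          · simp [X, h0]
          · refine mul_le_mul_of_nonneg_right ?_ (sq_nonneg _)
            have := hφA p (I, a, b) x h0
            exact sq_le_sq' (by linarith [(abs_le.1 this).1]) (abs_le.1 this).2
      simpa [nsq_smul] using this
    have e4 : 1 / (2 * η) * (η ^ 2 * nsq X) = η / 2 * nsq X := by field_simp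
    have e5 : 1 / (4 * (1 / (2 * η))) * nsq Y = η / 2 * nsq Y := by field_simp; ring
    have e6 := mul_le_mul_of_nonneg_left e3 (show 0 ≤ 1 / (2 * η) by positivity)
    linarith
  have g5 : ∑ I, ∑ a, ∑ b, ip (A I a b * dI (2 * (m + 1)) I (w b)) (lapP (m + 1) (w a))
      ≤ ∑ p, (∑ I, ∑ a, ∑ b, A I a b (y p) *
        ip (φ p * dI (2 * (m + 1)) I (w b)) (φ p * lapP (m + 1) (w a)))
        + ∑ I, ∑ a, ∑ b, η / 2 * (nsq (dI (2 * (m + 1)) I (w b)) + nsq (lapP (m + 1) (w a))) := by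
    have : ∀ I a b, ip (A I a b * dI (2 * (m + 1)) I (w b)) (lapP (m + 1) (w a))
        ≤ ∑ p, A I a b (y p) * ip (φ p * dI (2 * (m + 1)) I (w b)) (φ p * lapP (m + 1) (w a))
          + η / 2 * (nsq (dI (2 * (m + 1)) I (w b)) + nsq (lapP (m + 1) (w a))) := by
      intro I a b
      rw [← sum_ip_mul hφ]
      refine (Finset.sum_le_sum fun p _ => g4 p I a b).trans (le_of_eq ?_)
      rw [Finset.sum_add_distrib, ← Finset.mul_sum, Finset.sum_add_distrib, sum_nsq_mul hφ,
        sum_nsq_mul hφ]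
    refine (Finset.sum_le_sum fun I _ => Finset.sum_le_sum fun a _ =>
      Finset.sum_le_sum fun b _ => this I a b).trans (le_of_eq ?_)
    simp only [Finset.sum_add_distrib]
    congr 1
    rw [Finset.sum_comm]
    simp only [Finset.sum_comm (s := (Finset.univ : Finset κ))]
    rw [Finset.sum_comm]
  have g6 : ∑ I : Fin (2 * (m + 1)) → Fin n, ∑ a, ∑ b,
      η / 2 * (nsq (dI (2 * (m + 1)) I (w b)) + nsq (lapP (m + 1) (w a))) ≤
        K * η * HS (2 * (m + 1)) w := by
    have : ∀ (I : Fin (2 * (m + 1)) → Fin n) (a b : Fin l),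
        η / 2 * (nsq (dI (2 * (m + 1)) I (w b)) + nsq (lapP (m + 1) (w a))) ≤
          η * HS (2 * (m + 1)) w := by
      intro I a b
      have h1 := (nsq_dI_le _ I (w b)).trans (hs_le_HS (2 * (m + 1)) w b)
      have h2 := (nsq_lapP _ _).le.trans (hs_le_HS (2 * (m + 1)) w a)
      nlinarith
    refine (Finset.sum_le_sum fun I _ => Finset.sum_le_sum fun a _ =>
      Finset.sum_le_sum fun b _ => this I a b).trans (le_of_eq ?_)
    simp only [Finset.sum_const, Finset.card_univ, nsmul_eq_mul]
    rw [hK]; ring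
  have g7 := mul_le_mul_of_nonneg_right hKη (HS_nonneg (2 * (m + 1)) w)
  simp only [mul_sub, Finset.sum_sub_distrib, g2] at Hw
  simp only [Finset.sum_neg_distrib, ← Finset.mul_sum, g3] at g1
  linarith

end SP

namespace SP

variable {n : ℕ}

/-- The linear differential operator of order `r` with coefficients `A`. -/
def linOp {l r : ℕ} (A : (k : Fin (r + 1)) → (Fin (k : ℕ) → Fin n) → Fin l → Fin l → SP n)
    (w : Fin l → SP n) (a : Fin l) : SP n :=
  ∑ k : Fin (r + 1), ∑ I : Fin (k : ℕ) → Fin n, ∑ b, A k I a b * dI k I (w b)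

lemma negl_lower {l r h : ℕ} (hr : r = 2 * h) {k : ℕ} (hk : k < r) (I : Fin k → Fin n) (A : SP n)
    (a b : Fin l) : Negl r fun w : Fin l → SP n => ip (A * dI k I (w b)) (lapP h (w a)) := by
  subst hr
  have h1 : Negl (2 * h) fun w : Fin l → SP n => nsq (A * dI k I (w b)) :=
    Negl.of_le hk (sq_nonneg ‖toC A‖) fun w => by
      rw [abs_of_nonneg (nsq_nonneg _)]
      exact nsq_mul_le_of_norm A (fun w => dI k I (w b)) ((nsq_dI_le _ _ _).trans (hs_le_HS k w b))
  refine (Negl.ip zero_le_one (X := fun w => lapP h (w a)) (fun w => ?_) h1).mono fun w => ?_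
  · rw [nsq_lapP]; linarith [hs_le_HS (2 * h) w a, NS_nonneg w]
  · rw [ip_comm]

lemma garding_full {l h : ℕ} (hh : 1 ≤ h)
    (A : (k : Fin (2 * h + 1)) → (Fin (k : ℕ) → Fin n) → Fin l → Fin l → SP n) {lam : ℝ}
    (hlam : 0 < lam)
    (hA : ∀ (x : Vec n) (ξ : Fin n → ℝ) (v : Fin l → ℝ),
      lam * (∑ i, ξ i ^ 2) ^ h * (∑ a, v a ^ 2) ≤
      (-1) ^ (h + 1) * ∑ I : Fin (2 * h) → Fin n, ∑ a, ∑ b,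
        A (Fin.last (2 * h)) I a b x * (∏ j, ξ (I j)) * v a * v b) :
    ∃ C : ℝ, 0 ≤ C ∧ ∀ w : Fin l → SP n,
      ∑ a, ip (linOp A w a) (lapP h (w a)) ≤ -(3 * lam / 8 * HS (2 * h) w) + C * NS w := by
  obtain ⟨C, hC, H⟩ := garding hh (A (Fin.last (2 * h))) hlam hA
  have N := Negl.sum (Finset.univ : Finset (Fin l)) fun a _ =>
    Negl.sum (Finset.univ : Finset (Fin (2 * h))) fun k _ =>
    Negl.sum (Finset.univ : Finset (Fin (k : ℕ) → Fin n)) fun I _ =>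
    Negl.sum (Finset.univ : Finset (Fin l)) fun b _ =>
      negl_lower rfl k.2 I (A k.castSucc I a b) a b
  obtain ⟨C', hC', H'⟩ := N (lam / 8) (by positivity)
  refine ⟨C + C', by positivity, fun w => ?_⟩
  have e : ∑ a, ip (linOp A w a) (lapP h (w a))
      = (∑ a, ∑ k : Fin (2 * h), ∑ I : Fin (k : ℕ) → Fin n, ∑ b,
          ip (A k.castSucc I a b * dI k I (w b)) (lapP h (w a)))
        + ∑ I, ∑ a, ∑ b, ip (A (Fin.last (2 * h)) I a b * dI (2 * h) I (w b)) (lapP h (w a)) := by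
    have sc := Finset.sum_comm (s := (Finset.univ : Finset (Fin (2 * h) → Fin n)))
      (t := (Finset.univ : Finset (Fin l))) (f := fun I a => ∑ b,
        ip (A (Fin.last (2 * h)) I a b * dI (2 * h) I (w b)) (lapP h (w a)))
    refine Eq.trans ?_ (congrArg _ sc.symm)
    rw [← Finset.sum_add_distrib]
    refine Finset.sum_congr rfl fun a _ => ?_
    rw [linOp, Fin.sum_univ_castSucc, ip_add_left]
    simp only [ip_sum_left]
    rfl
  have h1 := (le_abs_self _).trans (H' w)
  rw [e]
  refine (add_le_add h1 (H w)).trans (le_of_eq ?_)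
  ring

/-- Coercivity of perturbations of a strongly elliptic operator. -/
lemma coercive {l h : ℕ} (hh : 1 ≤ h)
    (A : (k : Fin (2 * h + 1)) → (Fin (k : ℕ) → Fin n) → Fin l → Fin l → SP n) {lam : ℝ}
    (hlam : 0 < lam)
    (hA : ∀ (x : Vec n) (ξ : Fin n → ℝ) (v : Fin l → ℝ),
      lam * (∑ i, ξ i ^ 2) ^ h * (∑ a, v a ^ 2) ≤
      (-1) ^ (h + 1) * ∑ I : Fin (2 * h) → Fin n, ∑ a, ∑ b,
        A (Fin.last (2 * h)) I a b x * (∏ j, ξ (I j)) * v a * v b) :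
    ∃ η C : ℝ, 0 < η ∧ 0 ≤ C ∧ ∀ (w H : Fin l → SP n) (E : ℝ), 0 ≤ E →
      (∀ a, nsq (H a - linOp A w a) ≤ η * (HS (2 * h) w + NS w) + E) →
      ∑ a, ip (H a) (lapP h (w a)) ≤ -(lam / 4 * HS (2 * h) w) + C * (NS w + E) := by
  obtain ⟨C, hC, G⟩ := garding_full hh A hlam hA
  set K : ℝ := l * (4 / lam) with hK
  have hK0 : 0 ≤ K := by positivity
  refine ⟨lam / (16 * (K + 1)), C + lam + K, by positivity, by positivity, fun w H E hE0 hE => ?_⟩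
  set η := lam / (16 * (K + 1)) with hη
  have hη0 : 0 < η := by positivity
  have hKη : K * η ≤ lam / 16 := by
    rw [hη, mul_div_assoc', div_le_div_iff₀ (by positivity) (by positivity)]; nlinarith
  have h1 : ∀ a, ip (H a) (lapP h (w a)) ≤ ip (linOp A w a) (lapP h (w a))
      + (4 / lam * (η * (HS (2 * h) w + NS w) + E) + lam / 16 * hs (2 * h) (w a)) := by
    intro a
    have e1 : H a = linOp A w a + (H a - linOp A w a) := by ring
    have e2 := ip_le_young (H a - linOp A w a) (lapP h (w a)) (ε := 4 / lam) (by positivity)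
    have e3 : 1 / (4 * (4 / lam)) * nsq (lapP h (w a)) = lam / 16 * hs (2 * h) (w a) := by
      rw [nsq_lapP]; field_simp; ring
    have e4 := mul_le_mul_of_nonneg_left (hE a) (show 0 ≤ 4 / lam by positivity)
    have e5 : ip (H a) (lapP h (w a)) = ip (linOp A w a) (lapP h (w a))
        + ip (H a - linOp A w a) (lapP h (w a)) := by rw [← ip_add_left, ← e1]
    rw [e5]
    linarith
  have h2 := Finset.sum_le_sum fun a (_ : a ∈ Finset.univ) => h1 a
  rw [Finset.sum_add_distrib, Finset.sum_add_distrib, ← Finset.mul_sum, ← Finset.mul_sum] at h2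
  simp only [Finset.sum_const, Finset.card_univ, Fintype.card_fin, nsmul_eq_mul] at h2
  have h3 : ∑ a, hs (2 * h) (w a) = HS (2 * h) w := rfl
  have h4 : 4 / lam * ((l : ℝ) * (η * (HS (2 * h) w + NS w) + E))
      = (K * η) * (HS (2 * h) w + NS w) + K * E := by rw [hK]; ring
  have h5 := mul_le_mul_of_nonneg_right hKη (add_nonneg (HS_nonneg (2 * h) w) (NS_nonneg w))
  have h6 := G w
  rw [h3, h4] at h2
  have h7 := mul_nonneg (add_nonneg hC hlam.le) hE0
  have h8 := mul_nonneg (add_nonneg hK0 hlam.le) (NS_nonneg w)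
  nlinarith

end SP

/-- Indices of the components of an `r`-jet. -/
abbrev JIdx (n l r : ℕ) := Σ k : Fin (r + 1), (Fin (k : ℕ) → Fin n) × Fin l

/-- The component of a jet. -/
abbrev Jet.coord {n l r : ℕ} (z : Jet n l r) (c : JIdx n l r) : ℝ := z c.1 c.2.1 c.2.2

/-- The basis vector of jet space belonging to an index. -/
def Jet.basis {n l r : ℕ} (c : JIdx n l r) : Jet n l r :=
  Pi.single c.1 (Pi.single c.2.1 (Pi.single c.2.2 1))

lemma Jet.eq_sum_basis {n l r : ℕ} (z : Jet n l r) : z = ∑ c, z.coord c • Jet.basis c := by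
  rw [Fintype.sum_sigma]
  simp only [Fintype.sum_prod_type]
  conv_lhs => rw [← Finset.univ_sum_single z]
  refine Finset.sum_congr rfl fun k _ => ?_
  conv_lhs => rw [← Finset.univ_sum_single (z k)]
  have h := map_sum
    (LinearMap.single ℝ (fun k : Fin (r + 1) => ((Fin (k : ℕ) → Fin n) → Fin l → ℝ)) k)
    (fun I => Pi.single I (z k I)) Finset.univ
  refine h.trans (Finset.sum_congr rfl fun I _ => ?_)
  have e : z k I = ∑ b, z k I b • Pi.single b (1 : ℝ) := by
    ext b; simp [Pi.single_apply]
  have h2 := map_sum ((LinearMap.single ℝ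
    (fun k : Fin (r + 1) => ((Fin (k : ℕ) → Fin n) → Fin l → ℝ)) k).comp
    (LinearMap.single ℝ (fun _ : (Fin (k : ℕ) → Fin n) => Fin l → ℝ) I))
    (fun b => z k I b • Pi.single b (1 : ℝ)) Finset.univ
  simp only [map_smul] at h2
  rw [← e] at h2
  exact h2

lemma Jet.norm_le {n l r : ℕ} {z : Jet n l r} {K : ℝ} (hK : 0 ≤ K) (h : ∀ c, |z.coord c| ≤ K) :
    ‖z‖ ≤ K :=
  (pi_norm_le_iff_of_nonneg hK).2 fun k => (pi_norm_le_iff_of_nonneg hK).2 fun I =>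
    (pi_norm_le_iff_of_nonneg hK).2 fun b => h ⟨k, I, b⟩

namespace SP

variable {n l r : ℕ}

/-- The derivative of a vector of functions singled out by a jet index. -/
def jd (c : JIdx n l r) (v : Fin l → SP n) : SP n := dI c.1 c.2.1 (v c.2.2)

/-- The `r`-jet of a vector of smooth periodic functions. -/
def jet (r : ℕ) (v : Fin l → SP n) (x : Vec n) : Jet n l r := fun k I b => dI k I (v b) x

@[simp] lemma jet_coord (v : Fin l → SP n) (x : Vec n) (c : JIdx n l r) :
    (jet r v x).coord c = jd c v x := rfl

lemma contDiff_jet (v : Fin l → SP n) : ContDiff ℝ (⊤ : ℕ∞) (jet r v) :=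
  contDiff_pi.2 fun _ => contDiff_pi.2 fun _ => contDiff_pi.2 fun _ => SP.smooth _

lemma jet_per (v : Fin l → SP n) (x : Vec n) (m : Fin n → ℤ) :
    jet r v (x + intVec m) = jet r v x := by
  funext k I b; exact SP.per _ x m

end SP

/-- The natural domain of nonlinearities. -/
abbrev NLdom (n l r : ℕ) (T : ℝ) : Set (Vec n × ℝ × Jet n l r) :=
  Set.univ ×ˢ Set.Icc 0 T ×ˢ Set.univ

/-- Smooth functions of `(x,t,z)`, periodic in `x`. -/
structure NL (n l r : ℕ) (T : ℝ) where
  /-- the underlying function -/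
  toFun : Vec n × ℝ × Jet n l r → ℝ
  smooth' : ContDiffOn ℝ (⊤ : ℕ∞) toFun (NLdom n l r T)
  per' : ∀ x m t z, toFun (x + intVec m, t, z) = toFun (x, t, z)

namespace NL

open SP

variable {n l r : ℕ} {T : ℝ}

lemma uniqueDiffOn_dom [hT : Fact (0 < T)] : UniqueDiffOn ℝ (NLdom n l r T) :=
  uniqueDiffOn_univ.prod ((uniqueDiffOn_Icc hT.out).prod uniqueDiffOn_univ)

open scoped Pointwise in
lemma per_fderivWithin (Ψ : NL n l r T) (x : Vec n) (m : Fin n → ℤ) (t : ℝ) (z : Jet n l r) :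
    fderivWithin ℝ Ψ.toFun (NLdom n l r T) (x + intVec m, t, z)
      = fderivWithin ℝ Ψ.toFun (NLdom n l r T) (x, t, z) := by
  set a : Vec n × ℝ × Jet n l r := (intVec m, 0, 0)
  have h1 : (fun q => Ψ.toFun (q + a)) = Ψ.toFun := by
    funext ⟨x, t, z⟩
    simpa [a] using Ψ.per' x m t z
  have h2 : a +ᵥ NLdom n l r T = NLdom n l r T := by
    ext ⟨x, t, z⟩
    rw [Set.mem_vadd_set_iff_neg_vadd_mem]
    simp [a]
  have h3 := fderivWithin_comp_add_right (𝕜 := ℝ) (f := Ψ.toFun) (s := NLdom n l r T)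
    (x := (x, t, z)) a
  rw [h1, h2] at h3
  rw [h3]
  congr 1
  simp [a]

/-- Derivative of a nonlinearity in a fixed direction. -/
def dir [hT : Fact (0 < T)] (Ψ : NL n l r T) (e : Vec n × ℝ × Jet n l r) : NL n l r T where
  toFun q := fderivWithin ℝ Ψ.toFun (NLdom n l r T) q e
  smooth' := (Ψ.smooth'.fderivWithin uniqueDiffOn_dom (by simp)).clm_apply contDiffOn_const
  per' x m t z := by rw [per_fderivWithin]

/-- Derivative in `x`. -/
def dX [Fact (0 < T)] (Ψ : NL n l r T) (i : Fin n) : NL n l r T := Ψ.dir (eVec i, 0, 0)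

/-- Derivative in the jet variable. -/
def dZ [Fact (0 < T)] (Ψ : NL n l r T) (c : JIdx n l r) : NL n l r T := Ψ.dir (0, 0, Jet.basis c)

/-- Product with a jet coordinate. -/
def mulCoord (Ψ : NL n l r T) (c : JIdx n l r) : NL n l r T where
  toFun q := Ψ.toFun q * q.2.2.coord c
  smooth' := Ψ.smooth'.mul (ContDiff.contDiffOn (by
    have : ContDiff ℝ (⊤ : ℕ∞) fun q : Vec n × ℝ × Jet n l r => q.2.2 :=
      contDiff_snd.comp contDiff_snd
    exact contDiff_pi.1 (contDiff_pi.1 (contDiff_pi.1 this c.1) c.2.1) c.2.2))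
  per' x m t z := by rw [Ψ.per']

/-- Projection of time to `[0,T]`. -/
def clamp (T t : ℝ) : ℝ := max 0 (min T t)

lemma clamp_mem [hT : Fact (0 < T)] (t : ℝ) : clamp T t ∈ Set.Icc 0 T :=
  ⟨le_max_left _ _, max_le hT.out.le (min_le_left _ _)⟩

lemma clamp_of_mem {t : ℝ} (ht : t ∈ Set.Icc 0 T) : clamp T t = t := by
  rw [clamp, min_eq_right ht.2, max_eq_right ht.1]

lemma hasFDerivWithinAt (Ψ : NL n l r T) {q : Vec n × ℝ × Jet n l r} (hq : q ∈ NLdom n l r T) :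
    HasFDerivWithinAt Ψ.toFun (fderivWithin ℝ Ψ.toFun (NLdom n l r T) q) (NLdom n l r T) q :=
  (Ψ.smooth'.differentiableOn (by simp) q hq).hasFDerivWithinAt

lemma norm_jet_le {K : ℝ} (hK : 0 ≤ K) {v : Fin l → SP n} {x : Vec n}
    (h : ∀ c : JIdx n l r, |jd c v x| ≤ K) : ‖jet r v x‖ ≤ K := Jet.norm_le hK h

lemma isCompact_rep : IsCompact {x : Vec n | ∀ i, x i ∈ Set.Icc (0 : ℝ) 1} := by
  have h : IsCompact (Set.pi Set.univ fun _ : Fin n => Set.Icc (0 : ℝ) 1) :=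
    isCompact_univ_pi fun _ => isCompact_Icc
  have := h.image (EuclideanSpace.equiv (Fin n) ℝ).symm.continuous
  refine this.of_isClosed_subset ?_ ?_
  · simp only [Set.ofPred_forall]
    exact isClosed_iInter fun i => isClosed_Icc.preimage (by fun_prop)
  · intro x hx
    exact ⟨fun i => x i, fun i _ => hx i, rfl⟩

/-- Nonlinearities are bounded on bounded sets of jets. -/
lemma exists_bound (Ψ : NL n l r T) (K : ℝ) : ∃ C : ℝ, 0 ≤ C ∧
    ∀ x, ∀ t ∈ Set.Icc 0 T, ∀ z, ‖z‖ ≤ K → |Ψ.toFun (x, t, z)| ≤ C := by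
  have hc : IsCompact ({x : Vec n | ∀ i, x i ∈ Set.Icc (0 : ℝ) 1} ×ˢ Set.Icc 0 T ×ˢ
      Metric.closedBall (0 : Jet n l r) K) :=
    isCompact_rep.prod (isCompact_Icc.prod (isCompact_closedBall _ _))
  obtain ⟨C, hC⟩ := hc.exists_bound_of_continuousOn (f := Ψ.toFun)
    (Ψ.smooth'.continuousOn.mono fun q hq => ⟨trivial, hq.2.1, trivial⟩)
  refine ⟨max C 0, le_max_right _ _, fun x t ht z hz => ?_⟩
  have h1 : Ψ.toFun (rep (toTorus x), t, z) = Ψ.toFun (x, t, z) :=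
    PerZ.apply_rep (f := fun x => Ψ.toFun (x, t, z)) (fun x m => Ψ.per' x m t z) x
  rw [← h1]
  exact (hC _ ⟨fun i => rep_mem _ i, ht, by simpa using hz⟩).trans (le_max_left _ _)

variable [hT : Fact (0 < T)]

/-- Substitution of a jet into a nonlinearity. -/
def comp (Ψ : NL n l r T) (t : ℝ) (v : Fin l → SP n) : SP n :=
  SP.mk (fun x => Ψ.toFun (x, clamp T t, jet r v x))
    (contDiffOn_univ.1 (Ψ.smooth'.comp (contDiff_id.prodMk (contDiff_const.prodMk
      (contDiff_jet v))).contDiffOn fun x _ => ⟨trivial, clamp_mem t, trivial⟩))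
    (fun x m => by
      change Ψ.toFun (x + intVec m, clamp T t, jet r v (x + intVec m)) = _
      rw [jet_per, Ψ.per'])

lemma comp_apply (Ψ : NL n l r T) (t : ℝ) (v : Fin l → SP n) (x : Vec n) :
    Ψ.comp t v x = Ψ.toFun (x, clamp T t, jet r v x) := rfl

@[simp] lemma comp_mulCoord (Ψ : NL n l r T) (c : JIdx n l r) (t : ℝ) (v : Fin l → SP n) :
    (Ψ.mulCoord c).comp t v = Ψ.comp t v * jd c v := rfl

lemma fderivWithin_eq (Ψ : NL n l r T) (q : Vec n × ℝ × Jet n l r) (e : Vec n) (z : Jet n l r) :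
    fderivWithin ℝ Ψ.toFun (NLdom n l r T) q (e, 0, z)
      = fderivWithin ℝ Ψ.toFun (NLdom n l r T) q (e, 0, 0)
        + ∑ c, z.coord c * (Ψ.dZ c).toFun q := by
  have h1 : ((e, 0, z) : Vec n × ℝ × Jet n l r) = (e, 0, 0) + (0, 0, z) := by simp
  have h2 : ((0, 0, z) : Vec n × ℝ × Jet n l r)
      = ∑ c, z.coord c • ((0, 0, Jet.basis c) : Vec n × ℝ × Jet n l r) := by
    have h3 := map_sum ((LinearMap.inr ℝ (Vec n) (ℝ × Jet n l r)).comp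
      (LinearMap.inr ℝ ℝ (Jet n l r))) (fun c => z.coord c • Jet.basis c) Finset.univ
    rw [← z.eq_sum_basis] at h3
    simp only [map_smul] at h3
    exact h3
  rw [h1, map_add, h2, map_sum]
  simp only [map_smul]
  rfl

/-- The chain rule. -/
lemma D_comp (Ψ : NL n l r T) (t : ℝ) (v : Fin l → SP n) (i : Fin n) :
    D i (Ψ.comp t v) = (Ψ.dX i).comp t v + ∑ c, (Ψ.dZ c).comp t v * D i (jd c v) := by
  ext x
  have h1 : HasFDerivAt (fun x => jet r v x)
      (ContinuousLinearMap.pi fun k => ContinuousLinearMap.pi fun I => ContinuousLinearMap.pi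
        fun b => fderiv ℝ (dI k I (v b)) x) x :=
    hasFDerivAt_pi.2 fun k => hasFDerivAt_pi.2 fun I => hasFDerivAt_pi.2 fun b =>
      ((dI k I (v b)).diff x).hasFDerivAt
  have h2 := (hasFDerivAt_id (𝕜 := ℝ) x).prodMk
    ((hasFDerivAt_const (clamp T t) x).prodMk h1)
  have h3 := (Ψ.hasFDerivWithinAt (q := (x, clamp T t, jet r v x))
    ⟨trivial, clamp_mem t, trivial⟩).comp_hasFDerivAt x h2
    (Filter.Eventually.of_forall fun y => Set.mk_mem_prod (Set.mem_univ _)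
      (Set.mk_mem_prod (clamp_mem t) (Set.mem_univ _)))
  rw [D_apply]
  have h4 : fderiv ℝ (Ψ.comp t v) x = _ := h3.fderiv
  rw [h4, ContinuousLinearMap.comp_apply]
  have h5 := Ψ.fderivWithin_eq (x, clamp T t, jet r v x) (eVec i)
    (fun k I b => fderiv ℝ (dI k I (v b)) x (eVec i))
  refine h5.trans ?_
  rw [SP.add_apply, SP.sum_apply]
  congr 1
  exact Finset.sum_congr rfl fun c _ => mul_comm _ _

lemma exists_bound_comp (Ψ : NL n l r T) (K : ℝ) : ∃ C : ℝ, 0 ≤ C ∧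
    ∀ (t : ℝ) (v : Fin l → SP n) (x : Vec n), ‖jet r v x‖ ≤ K → |Ψ.comp t v x| ≤ C := by
  obtain ⟨C, hC, H⟩ := Ψ.exists_bound K
  exact ⟨C, hC, fun t v x h => H x _ (clamp_mem t) _ h⟩

/-- Nonlinearities are uniformly close to their values at `t = 0`, `z = 0`. -/
lemma exists_close (Ψ : NL n l r T) {η : ℝ} (hη : 0 < η) : ∃ ε δ : ℝ, 0 < ε ∧ 0 < δ ∧ δ ≤ T ∧
    ∀ x, ∀ t ∈ Set.Icc 0 δ, ∀ z, ‖z‖ ≤ ε → |Ψ.toFun (x, t, z) - Ψ.toFun (x, 0, 0)| ≤ η := by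
  have hc : IsCompact ({x : Vec n | ∀ i, x i ∈ Set.Icc (0 : ℝ) 1} ×ˢ Set.Icc 0 T ×ˢ
      Metric.closedBall (0 : Jet n l r) 1) :=
    isCompact_rep.prod (isCompact_Icc.prod (isCompact_closedBall _ _))
  have hu := hc.uniformContinuousOn_of_continuous (f := Ψ.toFun)
    (Ψ.smooth'.continuousOn.mono fun q hq => ⟨trivial, hq.2.1, trivial⟩)
  obtain ⟨ρ, hρ, H⟩ := Metric.uniformContinuousOn_iff.1 hu η hη
  have hT0 := hT.out
  refine ⟨min (ρ / 2) 1, min (ρ / 2) T, by positivity, by positivity, min_le_right _ _,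
    fun x t ht z hz => ?_⟩
  have h1 : ∀ t z, Ψ.toFun (rep (toTorus x), t, z) = Ψ.toFun (x, t, z) := fun t z =>
    PerZ.apply_rep (f := fun x => Ψ.toFun (x, t, z)) (fun x m => Ψ.per' x m t z) x
  rw [← h1, ← h1]
  have ht1 := ht.2.trans (min_le_left _ _)
  have hz1 := hz.trans (min_le_left _ _)
  refine (H (rep (toTorus x), t, z) ⟨fun i => rep_mem _ i, ⟨ht.1, ht.2.trans (min_le_right _ _)⟩,
    by simpa using hz.trans (min_le_right _ _)⟩ (rep (toTorus x), 0, 0)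
    ⟨fun i => rep_mem _ i, ⟨le_rfl, hT0.le⟩, by simp⟩ ?_).le
  rw [Prod.dist_eq, Prod.dist_eq]
  simp only [dist_self, dist_zero_right, Real.norm_eq_abs, abs_of_nonneg ht.1]
  exact max_lt hρ (max_lt (by linarith) (by linarith))

end NL

namespace SP

variable {n l r : ℕ} {T : ℝ} [hT : Fact (0 < T)]

variable (n l r T) in
/-- Differential polynomials of weight at most `p` in derivatives of order at most `r + q`. -/
inductive Rem : ℕ → ℕ → (ℝ → (Fin l → SP n) → SP n) → Prop
  | base (p q : ℕ) (Ψ : NL n l r T) : Rem p q fun t v => Ψ.comp t v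
  | add {p q : ℕ} {R R' : ℝ → (Fin l → SP n) → SP n} : Rem p q R → Rem p q R' →
      Rem p q fun t v => R t v + R' t v
  | mul {p p' q k : ℕ} {R : ℝ → (Fin l → SP n) → SP n} (I : Fin (r + k) → Fin n) (b : Fin l) :
      Rem p q R → k ≤ q → p + k ≤ p' → Rem p' q fun t v => R t v * dI (r + k) I (v b)

namespace Rem

variable {p q : ℕ} {R R' : ℝ → (Fin l → SP n) → SP n}

lemma mono (h : Rem n l r T p q R) {p' q' : ℕ} (hp : p ≤ p') (hq : q ≤ q') :
    Rem n l r T p' q' R := by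
  induction h generalizing p' with
  | base p q Ψ => exact base _ _ Ψ
  | add _ _ ih ih' => exact add (ih hp hq) (ih' hp hq)
  | mul I b _ hk hpk ih => exact mul I b (ih le_rfl hq) (hk.trans hq) (hpk.trans hp)

lemma zero : Rem n l r T p q fun _ _ => 0 :=
  base p q ⟨fun _ => 0, contDiffOn_const, fun _ _ _ _ => rfl⟩

lemma sum {ι : Type*} (s : Finset ι) {R : ι → ℝ → (Fin l → SP n) → SP n}
    (h : ∀ i ∈ s, Rem n l r T p q (R i)) : Rem n l r T p q fun t v => ∑ i ∈ s, R i t v := by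
  classical
  induction s using Finset.induction_on with
  | empty => simpa using zero
  | insert i s hi ih =>
    simp only [Finset.sum_insert hi]
    exact (h i (Finset.mem_insert_self _ _)).add
      (ih fun j hj => h j (Finset.mem_insert_of_mem hj))

lemma mul_jd (h : Rem n l r T p q R) (c : JIdx n l r) :
    Rem n l r T p q fun t v => R t v * jd c v := by
  induction h with
  | base p q Ψ => exact base p q (Ψ.mulCoord c)
  | add _ _ ih ih' => simp only [add_mul]; exact add ih ih'
  | mul I b _ hk hpk ih => simp only [mul_right_comm _ _ (jd c _)]; exact mul I b ih hk hpk

/-- Multiplication by a derivative of order at most `r + k`. -/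
lemma mul_dI (h : Rem n l r T p q R) {m k p' : ℕ} (hm : m ≤ r + k) (hk : k ≤ q) (hp : p + k ≤ p')
    (I : Fin m → Fin n) (b : Fin l) : Rem n l r T p' q fun t v => R t v * dI m I (v b) := by
  rcases le_or_gt m r with h1 | h1
  · exact (h.mono (by omega) le_rfl).mul_jd ⟨⟨m, by omega⟩, I, b⟩
  · obtain ⟨j, rfl⟩ : ∃ j, m = r + j := ⟨m - r, by omega⟩
    exact mul I b h (by omega) (by omega)

lemma D_base (Ψ : NL n l r T) (i : Fin n) (p q : ℕ) (hp : 1 ≤ p) (hq : 1 ≤ q) :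
    Rem n l r T p q fun t v => D i (Ψ.comp t v) := by
  simp only [NL.D_comp]
  refine (base _ _ _).add (sum _ fun c _ => ?_)
  have h1 : ∀ v : Fin l → SP n, D i (jd c v)
      = dI (c.1 + 1) (Fin.cons i c.2.1 : Fin (c.1 + 1) → Fin n) (v c.2.2) := fun v => by
    rw [dI_succ]; rfl
  simp only [h1]
  exact (base 0 q (Ψ.dZ c)).mul_dI (k := 1) (by have := c.1.2; omega) hq (by omega) _ _

lemma D (h : Rem n l r T p q R) (i : Fin n) :
    Rem n l r T (p + 1) (q + 1) fun t v => SP.D i (R t v) := by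
  induction h with
  | base p q Ψ => exact D_base Ψ i _ _ (by omega) (by omega)
  | add _ _ ih ih' => simp only [map_add]; exact add ih ih'
  | @mul p p' q k R I b hR hk hpk ih =>
    simp only [D_mul]
    refine add (mul I b ih (by omega) (by omega)) ?_
    have h1 : ∀ v : Fin l → SP n, SP.D i (dI (r + k) I (v b))
        = dI (r + k + 1) (Fin.cons i I : Fin (r + k + 1) → Fin n) (v b) := fun v => by
      rw [dI_succ]; rfl
    simp only [h1]
    exact (hR.mono le_rfl (Nat.le_succ q)).mul_dI (k := k + 1) (by omega) (by omega) (by omega) _ _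

/-- All derivatives up to order `m` are bounded by `K`. -/
def _root_.SP.DBound (m : ℕ) (K : ℝ) (v : Fin l → SP n) : Prop :=
  ∀ k ≤ m, ∀ (I : Fin k → Fin n) (b : Fin l) (x : Vec n), |dI k I (v b) x| ≤ K

omit hT in
lemma _root_.SP.DBound.mono {m m' : ℕ} {K : ℝ} {v : Fin l → SP n} (h : DBound m K v)
    (hm : m' ≤ m) : DBound m' K v := fun k hk => h k (hk.trans hm)

omit hT in
lemma _root_.SP.DBound.norm_jet {K : ℝ} {v : Fin l → SP n} (h : DBound r K v) (hK : 0 ≤ K)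
    (x : Vec n) : ‖jet r v x‖ ≤ K :=
  NL.norm_jet_le hK fun c => h c.1 (by have := c.1.2; omega) _ _ x

lemma exists_bound (h : Rem n l r T p q R) {K : ℝ} (hK : 0 ≤ K) : ∃ C : ℝ, 0 ≤ C ∧
    ∀ t v, DBound (r + p) K v → ∀ x, |R t v x| ≤ C := by
  induction h with
  | base p q Ψ =>
    obtain ⟨C, hC, H⟩ := Ψ.exists_bound_comp K
    exact ⟨C, hC, fun t v hv x => H t v x ((hv.mono (by omega)).norm_jet hK x)⟩
  | add _ _ ih ih' =>
    obtain ⟨C, hC, H⟩ := ih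
    obtain ⟨C', hC', H'⟩ := ih'
    exact ⟨C + C', by positivity, fun t v hv x =>
      (abs_add_le _ _).trans (add_le_add (H t v hv x) (H' t v hv x))⟩
  | mul I b _ hk hpk ih =>
    obtain ⟨C, hC, H⟩ := ih
    refine ⟨C * K, by positivity, fun t v hv x => ?_⟩
    rw [mul_apply, abs_mul]
    exact mul_le_mul (H t v (hv.mono (by omega)) x) (hv _ (by omega) I b x) (abs_nonneg _) hC

/-- Sum of the absolute values of all derivatives up to order `m`. -/
def _root_.SP.dsum (m : ℕ) (v : Fin l → SP n) (x : Vec n) : ℝ :=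
  ∑ c : JIdx n l m, |jd c v x|

omit hT in
lemma _root_.SP.dsum_nonneg (m : ℕ) (v : Fin l → SP n) (x : Vec n) : 0 ≤ dsum m v x :=
  Finset.sum_nonneg fun _ _ => abs_nonneg _

omit hT in
lemma _root_.SP.abs_le_dsum {m k : ℕ} (hk : k ≤ m) (I : Fin k → Fin n) (b : Fin l)
    (v : Fin l → SP n) (x : Vec n) : |dI k I (v b) x| ≤ dsum m v x := by
  have h := Finset.single_le_sum (f := fun c : JIdx n l m => |jd c v x|)
    (fun _ _ => abs_nonneg _) (Finset.mem_univ (⟨⟨k, by omega⟩, I, b⟩ : JIdx n l m))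
  exact h

/-- If the derivatives up to order `r + p / 2` are bounded, a differential polynomial of weight `p`
grows at most linearly. -/
lemma exists_linear_bound (h : Rem n l r T p q R) {K : ℝ} (hK : 0 ≤ K) {s : ℕ}
    (hs : p ≤ 2 * s + 1) :
    ∃ C : ℝ, 0 ≤ C ∧
    ∀ t v, DBound (r + s) K v → ∀ x, |R t v x| ≤ C * (1 + dsum (r + q) v x) := by
  induction h with
  | base p q Ψ =>
    obtain ⟨C, hC, H⟩ := Ψ.exists_bound_comp K
    refine ⟨C, hC, fun t v hv x => (H t v x ((hv.mono (by omega)).norm_jet hK x)).trans ?_⟩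
    nlinarith [dsum_nonneg (r + q) v x]
  | add _ _ ih ih' =>
    obtain ⟨C, hC, H⟩ := ih hs
    obtain ⟨C', hC', H'⟩ := ih' hs
    refine ⟨C + C', by positivity, fun t v hv x => ?_⟩
    refine (abs_add_le _ _).trans ((add_le_add (H t v hv x) (H' t v hv x)).trans (le_of_eq ?_))
    ring
  | @mul p p' q k R I b hR hk hpk ih =>
    rcases le_or_gt k s with h1 | h1
    · obtain ⟨C, hC, H⟩ := ih (by omega)
      refine ⟨C * K, by positivity, fun t v hv x => ?_⟩
      rw [mul_apply, abs_mul]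
      refine (mul_le_mul (H t v hv x) (hv _ (by omega) I b x) (abs_nonneg _)
        (mul_nonneg hC (by linarith [dsum_nonneg (r + q) v x]))).trans (le_of_eq ?_)
      ring
    · obtain ⟨C, hC, H⟩ := hR.exists_bound hK
      refine ⟨C, hC, fun t v hv x => ?_⟩
      rw [mul_apply, abs_mul]
      refine mul_le_mul (H t v (hv.mono (by omega)) x) ?_ (abs_nonneg _) hC
      exact (abs_le_dsum (m := r + q) (by omega) I b v x).trans (by linarith)

end Rem

lemma exists_dI_dI {n k : ℕ} (I : Fin k → Fin n) {m : ℕ} (J : Fin m → Fin n) {N : ℕ}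
    (hN : N = k + m) : ∃ I' : Fin N → Fin n, ∀ f, dI k I (dI m J f) = dI N I' f := by
  induction k generalizing N with
  | zero =>
    obtain rfl : N = m := by omega
    exact ⟨J, fun f => rfl⟩
  | succ k ih =>
    obtain ⟨N, rfl⟩ : ∃ N', N = N' + 1 := ⟨k + m, by omega⟩
    obtain ⟨I', h⟩ := ih (Fin.tail I) (N := N) (by omega)
    exact ⟨(Fin.cons (I 0) I' : Fin (N + 1) → Fin n), fun f => by rw [dI_succ, h]; rfl⟩

/-- The top order part of the derivatives of a nonlinear expression is linear. -/
lemma exists_rem (Ψ : NL n l r T) (p : ℕ) (J : Fin (p + 1) → Fin n) :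
    ∃ R, Rem n l r T (p + 1) p R ∧ ∀ t v, dI (p + 1) J (Ψ.comp t v)
      = ∑ c, (Ψ.dZ c).comp t v * jd c (fun b => dI (p + 1) J (v b)) + R t v := by
  induction p with
  | zero =>
    refine ⟨_, Rem.base 1 0 (Ψ.dX (J 0)), fun t v => ?_⟩
    rw [dI_one, NL.D_comp, add_comm]
    congr 1
    refine Finset.sum_congr rfl fun c _ => ?_
    congr 1
    exact D_dI_comm _ _ _ _
  | succ p ih =>
    obtain ⟨R, hR, H⟩ := ih (Fin.tail J)
    choose I' hI' using fun c : JIdx n l r => exists_dI_dI c.2.1 (Fin.tail J) rfl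
    refine ⟨fun t v => ∑ c : JIdx n l r, D (J 0) ((Ψ.dZ c).comp t v) *
      dI ((c.1 : ℕ) + (p + 1)) (I' c) (v c.2.2) + D (J 0) (R t v), ?_, fun t v => ?_⟩
    · refine (Rem.sum _ fun c _ => ?_).add (hR.D _)
      exact (Rem.D_base (Ψ.dZ c) (J 0) 1 (p + 1) le_rfl (by omega)).mul_dI (k := p + 1)
        (by have := c.1.2; omega) le_rfl (by omega) _ _
    · rw [dI_succ, H, map_add, map_sum, ← add_assoc, ← Finset.sum_add_distrib]
      congr 1
      refine Finset.sum_congr rfl fun c _ => ?_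
      rw [D_mul, add_comm, ← hI']
      congr 2
      exact D_dI_comm _ _ _ _

end SP

namespace SP

variable {n l r : ℕ} {T : ℝ}

/-- All values of the `r`-jet are bounded by `ε`. -/
def JSmall (r : ℕ) (ε : ℝ) (v : Fin l → SP n) : Prop := ∀ x, ‖jet r v x‖ ≤ ε

lemma hs_jd_le (m : ℕ) (c : JIdx n l r) (w : Fin l → SP n) :
    hs m (jd c w) ≤ HS (m + r) w + NS w := by
  have h := c.1.2
  exact (hs_dI_le m c.1 c.2.1 _).trans ((hs_le_HS _ w _).trans (HS_le_add (by omega) w))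

lemma nsq_jd_le (c : JIdx n l r) (w : Fin l → SP n) : nsq (jd c w) ≤ HS r w + NS w := by
  have h := hs_jd_le 0 c w
  rwa [hs_zero, zero_add] at h

lemma nsq_le_of_abs_le_sum {f : SP n} {η : ℝ} {w : Fin l → SP n}
    (h : ∀ x, |f x| ≤ η * ∑ c : JIdx n l r, |jd c w x|) :
    nsq f ≤ (η * Fintype.card (JIdx n l r)) ^ 2 * (HS r w + NS w) := by
  have h1 : nsq f ≤ 0 + ∑ c : JIdx n l r, nsq
      ((η * Real.sqrt (Fintype.card (JIdx n l r))) • jd c w) := by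
    refine nsq_le_of_abs_le _ fun x => ?_
    have e1 : f x ^ 2 ≤ (η * ∑ c : JIdx n l r, |jd c w x|) ^ 2 := by
      rw [← sq_abs]; gcongr; exact h x
    have e2 := sq_sum_le_card_mul_sum_sq (s := Finset.univ) (f := fun c : JIdx n l r => |jd c w x|)
    have e3 : ∀ c : JIdx n l r, ((η * Real.sqrt (Fintype.card (JIdx n l r))) • jd c w) x ^ 2
        = η ^ 2 * (Fintype.card (JIdx n l r) * |jd c w x| ^ 2) := fun c => by
      rw [smul_apply, mul_pow, mul_pow, Real.sq_sqrt (by positivity), sq_abs]; ring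
    simp only [e3, ← Finset.mul_sum, zero_add]
    refine e1.trans ?_
    rw [mul_pow]
    gcongr
    exact e2
  refine h1.trans ?_
  simp only [nsq_smul, ← Finset.mul_sum, zero_add, mul_pow]
  rw [Real.sq_sqrt (by positivity), sq (Fintype.card (JIdx n l r) : ℝ), mul_assoc, mul_assoc,
    mul_assoc]
  gcongr
  refine (Finset.sum_le_sum fun c _ => nsq_jd_le c w).trans ?_
  rw [Finset.sum_const, Finset.card_univ, nsmul_eq_mul]

lemma jd_sub (c : JIdx n l r) (v w : Fin l → SP n) : jd c (v - w) = jd c v - jd c w := by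
  simp [jd]

lemma jet_zero (x : Vec n) : jet r (0 : Fin l → SP n) x = 0 := by
  funext k I b
  have : jet r (0 : Fin l → SP n) x k I b = dI k I (0 : SP n) x := rfl
  rw [this]; simp

variable [hT : Fact (0 < T)]

/-- Coefficients of the linearization at time zero of the zero function. -/
def linCoeff (G : Fin l → NL n l r T) (k : Fin (r + 1)) (I : Fin (k : ℕ) → Fin n) (a b : Fin l) :
    SP n := ((G a).dZ ⟨k, I, b⟩).comp 0 0

lemma linOp_linCoeff (G : Fin l → NL n l r T) (w : Fin l → SP n) (a : Fin l) :
    linOp (linCoeff G) w a = ∑ c, ((G a).dZ c).comp 0 0 * jd c w := by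
  rw [Fintype.sum_sigma]
  simp only [Fintype.sum_prod_type]
  rfl

lemma comp_zero_apply (Ψ : NL n l r T) (x : Vec n) : Ψ.comp 0 0 x = Ψ.toFun (x, 0, 0) := by
  rw [NL.comp_apply, NL.clamp_of_mem ⟨le_rfl, hT.out.le⟩, jet_zero]

lemma exists_close_all {ι : Type*} [Finite ι] (Ψ : ι → NL n l r T) {η : ℝ} (hη : 0 < η) :
    ∃ ε δ : ℝ, 0 < ε ∧ 0 < δ ∧ δ ≤ T ∧ ∀ i x, ∀ t ∈ Set.Icc 0 δ, ∀ z, ‖z‖ ≤ ε →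
      |(Ψ i).toFun (x, t, z) - (Ψ i).toFun (x, 0, 0)| ≤ η := by
  have h : ∀ᶠ ε : ℝ in nhdsWithin 0 (Set.Ioi 0), 0 < ε ∧ ε ≤ T ∧ ∀ i x, ∀ t ∈ Set.Icc 0 ε,
      ∀ z, ‖z‖ ≤ ε → |(Ψ i).toFun (x, t, z) - (Ψ i).toFun (x, 0, 0)| ≤ η := by
    refine Filter.Eventually.and self_mem_nhdsWithin (Filter.Eventually.and
      (Filter.mem_of_superset (Ioc_mem_nhdsGT hT.out) fun _ h => h.2) ?_)
    refine Filter.eventually_all.2 fun i => ?_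
    obtain ⟨ε, δ, hε, hδ, -, H⟩ := (Ψ i).exists_close hη
    refine Filter.mem_of_superset (Ioc_mem_nhdsGT (lt_min hε hδ)) fun e he => ?_
    exact fun x t ht z hz => H x t ⟨ht.1, ht.2.trans (he.2.trans (min_le_right _ _))⟩ z
      (hz.trans (he.2.trans (min_le_left _ _)))
  obtain ⟨ε, h1, h2, h3⟩ := h.exists
  exact ⟨ε, ε, h1, h1, h2, h3⟩

/-- The mean value theorem in the jet variable. -/
lemma _root_.NL.abs_sub_sub_le (Ψ : NL n l r T) {ε η t : ℝ} (ht : t ∈ Set.Icc 0 T) {x : Vec n}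
    {a : JIdx n l r → ℝ} (H : ∀ c z, ‖z‖ ≤ ε → |(Ψ.dZ c).toFun (x, t, z) - a c| ≤ η)
    {z z' : Jet n l r} (hz : ‖z‖ ≤ ε) (hz' : ‖z'‖ ≤ ε) :
    |Ψ.toFun (x, t, z) - Ψ.toFun (x, t, z') - ∑ c, a c * (z - z').coord c|
      ≤ η * ∑ c, |(z - z').coord c| := by
  set y : Jet n l r := z - z' with hy
  let φ : ℝ → ℝ := fun θ => Ψ.toFun (x, t, z' + θ • y) - θ * ∑ c, a c * y.coord c
  have hd : ∀ θ ∈ Set.Icc (0 : ℝ) 1, HasDerivWithinAt φ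
      (∑ c, ((Ψ.dZ c).toFun (x, t, z' + θ • y) - a c) * y.coord c) (Set.Icc 0 1) θ := by
    intro θ hθ
    have h1 : HasDerivWithinAt (fun θ : ℝ => (x, t, z' + θ • y)) ((0, 0, y) : Vec n × ℝ × Jet n l r)
        (Set.Icc 0 1) θ := by
      have e : HasDerivAt (fun θ : ℝ => z' + θ • y) y θ := by
        simpa using ((hasDerivAt_id θ).smul_const y).const_add z'
      exact ((hasDerivAt_const θ x).prodMk ((hasDerivAt_const θ t).prodMk e)).hasDerivWithinAt
    have h2 := (Ψ.hasFDerivWithinAt (q := (x, t, z' + θ • y))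
      (Set.mk_mem_prod (Set.mem_univ _) (Set.mk_mem_prod ht
        (Set.mem_univ _)))).comp_hasDerivWithinAt
        θ h1 (fun θ' _ => Set.mk_mem_prod (Set.mem_univ _) (Set.mk_mem_prod ht (Set.mem_univ _)))
    have h3 : HasDerivAt (fun θ : ℝ => θ * ∑ c, a c * y.coord c) (∑ c, a c * y.coord c) θ := by
      simpa using (hasDerivAt_id θ).mul_const (∑ c, a c * y.coord c)
    refine (h2.sub h3.hasDerivWithinAt).congr_deriv ?_
    rw [NL.fderivWithin_eq]
    have h0 : ((0, 0, 0) : Vec n × ℝ × Jet n l r) = 0 := rfl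
    rw [h0, map_zero, zero_add, ← Finset.sum_sub_distrib]
    exact Finset.sum_congr rfl fun c _ => by ring
  have hb : ∀ θ ∈ Set.Icc (0 : ℝ) 1,
      ‖∑ c, ((Ψ.dZ c).toFun (x, t, z' + θ • y) - a c) * y.coord c‖ ≤ η * ∑ c, |y.coord c| := by
    intro θ hθ
    have hm : ‖z' + θ • y‖ ≤ ε := by
      have := (convex_closedBall (0 : Jet n l r) ε).add_smul_sub_mem (x := z') (y := z)
        (by simpa using hz') (by simpa using hz) hθ
      simpa using this
    rw [Finset.mul_sum]
    refine (norm_sum_le _ _).trans (Finset.sum_le_sum fun c _ => ?_)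
    rw [Real.norm_eq_abs, abs_mul]
    exact mul_le_mul_of_nonneg_right (H c _ hm) (abs_nonneg _)
  have h := (convex_Icc (0 : ℝ) 1).norm_image_sub_le_of_norm_hasDerivWithin_le hd hb
    (Set.left_mem_Icc.2 zero_le_one) (Set.right_mem_Icc.2 zero_le_one)
  have e1 : φ 1 - φ 0 = Ψ.toFun (x, t, z) - Ψ.toFun (x, t, z') - ∑ c, a c * y.coord c := by
    simp [φ, hy]; ring
  rw [e1] at h
  simpa using h

/-- For small times and jets, nonlinear operators are close to their linearization. -/
lemma exists_small (G : Fin l → NL n l r T) {η : ℝ} (hη : 0 < η) :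
    ∃ ε δ : ℝ, 0 < ε ∧ 0 < δ ∧ δ ≤ T ∧ ∀ t ∈ Set.Icc 0 δ,
      (∀ v, JSmall r ε v → ∀ w a,
        nsq (∑ c, ((G a).dZ c).comp t v * jd c w - linOp (linCoeff G) w a)
          ≤ η * (HS r w + NS w)) ∧
      ∀ v v', JSmall r ε v → JSmall r ε v' → ∀ a,
        nsq ((G a).comp t v - (G a).comp t v' - linOp (linCoeff G) (v - v') a)
          ≤ η * (HS r (v - v') + NS (v - v')) := by
  obtain ⟨N, hN⟩ : ∃ N : ℝ, (Fintype.card (JIdx n l r) : ℝ) = N := ⟨_, rfl⟩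
  have hN0 : 0 ≤ N := hN ▸ Nat.cast_nonneg _
  set η' : ℝ := Real.sqrt η / (N + 1) with hη'
  have hη0 : 0 < η' := by positivity
  have hηN : (η' * Fintype.card (JIdx n l r)) ^ 2 ≤ η := by
    rw [hN]
    have : η' * N ≤ Real.sqrt η := by
      rw [hη', div_mul_eq_mul_div, div_le_iff₀ (by positivity)]
      nlinarith [Real.sqrt_nonneg η]
    calc (η' * N) ^ 2 ≤ Real.sqrt η ^ 2 := by gcongr
      _ = η := Real.sq_sqrt hη.le
  obtain ⟨ε, δ, hε, hδ, hδT, H⟩ := exists_close_all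
    (fun p : Fin l × JIdx n l r => (G p.1).dZ p.2) hη0
  refine ⟨ε, δ, hε, hδ, hδT, fun t ht => ⟨fun v hv w a => ?_, fun v v' hv hv' a => ?_⟩⟩
  all_goals have htT : t ∈ Set.Icc 0 T := ⟨ht.1, ht.2.trans hδT⟩
  · refine (nsq_le_of_abs_le_sum (η := η') fun x => ?_).trans (mul_le_mul_of_nonneg_right hηN
      (add_nonneg (HS_nonneg _ _) (NS_nonneg _)))
    rw [linOp_linCoeff, ← Finset.sum_sub_distrib, sum_apply, Finset.mul_sum]
    refine (Finset.abs_sum_le_sum_abs _ _).trans (Finset.sum_le_sum fun c _ => ?_)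
    rw [SP.sub_apply, SP.mul_apply, SP.mul_apply, ← sub_mul, abs_mul, comp_zero_apply,
      NL.comp_apply, NL.clamp_of_mem htT]
    exact mul_le_mul_of_nonneg_right (H (a, c) x t ht _ (hv x)) (abs_nonneg _)
  · refine (nsq_le_of_abs_le_sum (η := η') fun x => ?_).trans (mul_le_mul_of_nonneg_right hηN
      (add_nonneg (HS_nonneg _ _) (NS_nonneg _)))
    have h := (G a).abs_sub_sub_le htT (a := fun c => ((G a).dZ c).toFun (x, 0, 0))
      (fun c z hz => H (a, c) x t ht z hz) (hv x) (hv' x)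
    have e : ∀ c, (jet r v x - jet r v' x).coord c = jd c (v - v') x := fun c => by
      rw [jd_sub]; rfl
    simp only [e] at h
    rw [linOp_linCoeff, SP.sub_apply, SP.sub_apply, sum_apply, NL.comp_apply, NL.comp_apply,
      NL.clamp_of_mem htT]
    simp only [SP.mul_apply, comp_zero_apply]
    exact h

end SP

namespace SP

variable {n l r : ℕ} {T : ℝ}

/-- Differential polynomials are controlled in `L²`. -/
lemma nsq_le_of_abs_le_dsum {f : SP n} {C : ℝ} {m : ℕ} {v : Fin l → SP n}
    (h : ∀ x, |f x| ≤ C * (1 + dsum m v x)) :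
    nsq f ≤ 2 * C ^ 2 + 2 * (C * Fintype.card (JIdx n l m)) ^ 2 * (HS m v + NS v) := by
  have h1 : nsq f ≤ 2 * C ^ 2 + ∑ c : JIdx n l m, nsq
      ((C * Real.sqrt (2 * Fintype.card (JIdx n l m))) • jd c v) := by
    refine nsq_le_of_abs_le _ fun x => ?_
    have e1 : f x ^ 2 ≤ (C * (1 + dsum m v x)) ^ 2 := by
      rw [← sq_abs]; gcongr; exact h x
    have e2 := sq_sum_le_card_mul_sum_sq (s := Finset.univ) (f := fun c : JIdx n l m => |jd c v x|)
    have e3 : ∀ c : JIdx n l m, ((C * Real.sqrt (2 * Fintype.card (JIdx n l m))) • jd c v) x ^ 2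
        = 2 * C ^ 2 * (Fintype.card (JIdx n l m) * |jd c v x| ^ 2) := fun c => by
      rw [smul_apply, mul_pow, mul_pow, Real.sq_sqrt (by positivity), sq_abs]; ring
    simp only [e3, ← Finset.mul_sum]
    have e4 : (1 + dsum m v x) ^ 2 ≤ 2 + 2 * dsum m v x ^ 2 := by
      nlinarith [sq_nonneg (1 - dsum m v x)]
    have e5 := mul_le_mul_of_nonneg_left e4 (sq_nonneg C)
    have e6 := mul_le_mul_of_nonneg_left e2 (sq_nonneg C)
    have e7 : dsum m v x ^ 2 = (∑ c : JIdx n l m, |jd c v x|) ^ 2 := rfl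
    rw [Finset.card_univ] at e6
    rw [mul_pow] at e1
    rw [e7] at e5
    linarith
  refine h1.trans ?_
  simp only [nsq_smul, ← Finset.mul_sum, mul_pow]
  have h2 := Finset.sum_le_sum fun (c : JIdx n l m) (_ : c ∈ Finset.univ) => nsq_jd_le c v
  rw [Finset.sum_const, Finset.card_univ, nsmul_eq_mul] at h2
  rw [Real.sq_sqrt (by positivity)]
  have h3 := mul_le_mul_of_nonneg_left h2
    (show 0 ≤ C ^ 2 * (2 * (Fintype.card (JIdx n l m) : ℝ)) by positivity)
  linarith

lemma exists_nsq_linOp_le (A : (k : Fin (r + 1)) → (Fin (k : ℕ) → Fin n) → Fin l → Fin l → SP n) :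
    ∃ C : ℝ, 0 ≤ C ∧ ∀ w a, nsq (linOp A w a) ≤ C * (HS r w + NS w) := by
  set K : ℝ := ∑ k, ∑ I, ∑ a, ∑ b, ‖toC (A k I a b)‖ with hK
  have hAK : ∀ k I a b x, |A k I a b x| ≤ K := fun k I a b x => by
    refine (abs_le_norm_toC _ _).trans ?_
    refine le_trans ?_ (Finset.single_le_sum (fun k _ => by positivity) (Finset.mem_univ k))
    refine le_trans ?_ (Finset.single_le_sum (fun k _ => by positivity) (Finset.mem_univ I))
    refine le_trans ?_ (Finset.single_le_sum (fun k _ => by positivity) (Finset.mem_univ a))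
    exact Finset.single_le_sum (f := fun b => ‖toC (A k I a b)‖) (fun k _ => by positivity)
      (Finset.mem_univ b)
  refine ⟨_, sq_nonneg (K * Fintype.card (JIdx n l r)), fun w a =>
    nsq_le_of_abs_le_sum fun x => ?_⟩
  rw [Fintype.sum_sigma, Finset.mul_sum, linOp, sum_apply]
  refine (Finset.abs_sum_le_sum_abs _ _).trans (Finset.sum_le_sum fun k _ => ?_)
  rw [Fintype.sum_prod_type, Finset.mul_sum, sum_apply]
  refine (Finset.abs_sum_le_sum_abs _ _).trans (Finset.sum_le_sum fun I _ => ?_)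
  rw [Finset.mul_sum, sum_apply]
  refine (Finset.abs_sum_le_sum_abs _ _).trans (Finset.sum_le_sum fun b _ => ?_)
  rw [SP.mul_apply, abs_mul]
  exact mul_le_mul_of_nonneg_right (hAK k I a b x) (abs_nonneg _)

lemma sum_ip_le (H w : Fin l → SP n) {ε : ℝ} (hε : 0 < ε) :
    ∑ a, ip (H a) (w a) ≤ ε * (∑ a, nsq (H a)) + 1 / (4 * ε) * NS w := by
  rw [NS, Finset.mul_sum, Finset.mul_sum, ← Finset.sum_add_distrib]
  exact Finset.sum_le_sum fun a _ => ip_le_young _ _ hε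

lemma sum_HS_dI (p m : ℕ) (v : Fin l → SP n) :
    ∑ J : Fin p → Fin n, HS m (fun b => dI p J (v b)) = HS (p + m) v := by
  simp only [HS]
  rw [Finset.sum_comm]
  refine Finset.sum_congr rfl fun a _ => ?_
  rw [← ip_lapP_self, ip_lapP_add]
  exact Finset.sum_congr rfl fun J _ => (ip_lapP_self _ _).symm

lemma sum_NS_dI (p : ℕ) (v : Fin l → SP n) :
    ∑ J : Fin p → Fin n, NS (fun b => dI p J (v b)) = HS p v := by
  have h := sum_HS_dI p 0 v
  simpa only [HS, NS, hs_zero, add_zero] using h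

variable [hT : Fact (0 < T)]

/-- Strong ellipticity of the linearization at time zero of the zero function. -/
def Elliptic {h : ℕ} (G : Fin l → NL n l (2 * h) T) (lam : ℝ) : Prop :=
  ∀ (x : Vec n) (ξ : Fin n → ℝ) (v : Fin l → ℝ),
    lam * (∑ i, ξ i ^ 2) ^ h * (∑ a, v a ^ 2) ≤
      (-1) ^ (h + 1) * ∑ I : Fin (2 * h) → Fin n, ∑ a, ∑ b,
        linCoeff G (Fin.last (2 * h)) I a b x * (∏ j, ξ (I j)) * v a * v b

/-- Energy estimates for small times and jets. -/
def EnergyEst {h : ℕ} (G : Fin l → NL n l (2 * h) T) (ε δ : ℝ) : Prop :=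
  (∀ p s : ℕ, ∀ K : ℝ, p ≤ 2 * s → 0 ≤ K → ∃ C : ℝ, 0 ≤ C ∧ ∀ t ∈ Set.Icc 0 δ, ∀ v,
    JSmall (2 * h) ε v → DBound (2 * h + s) K v →
      ∑ a, ip ((G a).comp t v) (lapP (p + 1 + h) (v a)) ≤ C * (1 + NS v)) ∧
  ∃ C : ℝ, 0 ≤ C ∧ ∀ t ∈ Set.Icc 0 δ, ∀ v v', JSmall (2 * h) ε v → JSmall (2 * h) ε v' →
    ∑ a, ip ((G a).comp t v - (G a).comp t v') ((v - v') a + lapP h ((v - v') a))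
      ≤ C * NS (v - v')

lemma exists_rem_bound (Ψ : NL n l r T) {p s : ℕ} (hps : p ≤ 2 * s) {K : ℝ} (hK : 0 ≤ K)
    (J : Fin (p + 1) → Fin n) :
    ∃ C : ℝ, 0 ≤ C ∧ ∀ t v, DBound (r + s) K v →
      nsq (dI (p + 1) J (Ψ.comp t v)
        - ∑ c, (Ψ.dZ c).comp t v * jd c (fun b => dI (p + 1) J (v b)))
        ≤ C * (1 + (HS (r + p) v + NS v)) := by
  obtain ⟨R, hR, H⟩ := exists_rem Ψ p J
  obtain ⟨C, hC, hb⟩ := hR.exists_linear_bound hK (s := s) (by omega)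
  refine ⟨2 * C ^ 2 + 2 * (C * Fintype.card (JIdx n l (r + p))) ^ 2, by positivity,
    fun t v hv => ?_⟩
  rw [H, add_sub_cancel_left]
  refine (nsq_le_of_abs_le_dsum (hb t v hv)).trans ?_
  have h1 := add_nonneg (HS_nonneg (r + p) v) (NS_nonneg v)
  have h2 : 0 ≤ 2 * C ^ 2 * (HS (r + p) v + NS v) := by positivity
  nlinarith [sq_nonneg (C * (Fintype.card (JIdx n l (r + p)) : ℝ))]

lemma exists_energyEst {h : ℕ} (hh : 1 ≤ h) (G : Fin l → NL n l (2 * h) T) {lam : ℝ}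
    (hlam : 0 < lam) (hA : Elliptic G lam) :
    ∃ ε δ : ℝ, 0 < ε ∧ 0 < δ ∧ δ ≤ T ∧ EnergyEst G ε δ := by
  obtain ⟨η, C₀, hη, hC₀, hco⟩ := coercive hh (linCoeff G) hlam hA
  obtain ⟨ε, δ, hε, hδ, hδT, hs⟩ := exists_small G (half_pos hη)
  refine ⟨ε, δ, hε, hδ, hδT, fun p s K hps hK => ?_, ?_⟩
  · choose CR hCR hR using fun (J : Fin (p + 1) → Fin n) (a : Fin l) =>
      exists_rem_bound (G a) hps hK J
    set C₁ : ℝ := ∑ J, ∑ a, CR J a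
    have hC₁ : 0 ≤ C₁ := Finset.sum_nonneg fun J _ => Finset.sum_nonneg fun a _ => hCR J a
    have hle : ∀ J a, CR J a ≤ C₁ := fun J a =>
      (Finset.single_le_sum (f := fun a => CR J a) (fun a _ => hCR J a) (Finset.mem_univ a)).trans
        (Finset.single_le_sum (f := fun J => ∑ a, CR J a)
          (fun J _ => Finset.sum_nonneg fun a _ => hCR J a) (Finset.mem_univ J))
    obtain ⟨N, hN'⟩ : ∃ N : ℝ, (Finset.card (Finset.univ : Finset (Fin (p + 1) → Fin n)) : ℝ) = N :=
      ⟨_, rfl⟩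
    have hN : 0 ≤ N := hN' ▸ Nat.cast_nonneg _
    obtain ⟨Ca, hCa, ha⟩ := HS_interp (n := n) (l := l) (m := p + 1) (M := p + 1 + 2 * h)
      (by omega) (ε := lam / (8 * (C₀ + 1))) (by positivity)
    obtain ⟨Cb, hCb, hb⟩ := HS_interp (n := n) (l := l) (m := 2 * h + p) (M := p + 1 + 2 * h)
      (by omega) (ε := lam / (8 * (N * C₀ * (2 * C₁) + 1))) (by positivity)
    refine ⟨C₀ * Ca + N * C₀ * (2 * C₁) * (1 + Cb), by positivity, fun t ht v hv hvK => ?_⟩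
    have h1 : ∀ J : Fin (p + 1) → Fin n,
        ∑ a, ip (dI (p + 1) J ((G a).comp t v)) (lapP h (dI (p + 1) J (v a)))
          ≤ -(lam / 4 * HS (2 * h) (fun b => dI (p + 1) J (v b)))
            + C₀ * (NS (fun b => dI (p + 1) J (v b))
              + 2 * C₁ * (1 + (HS (2 * h + p) v + NS v))) := by
      intro J
      have hnn : 0 ≤ 1 + (HS (2 * h + p) v + NS v) := by
        linarith [HS_nonneg (2 * h + p) v, NS_nonneg v]
      refine hco (fun b => dI (p + 1) J (v b)) (fun a => dI (p + 1) J ((G a).comp t v)) _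
        (by positivity) fun a => ?_
      have e1 := hR J a t v hvK
      have e2 := (hs t ht).1 v hv (fun b => dI (p + 1) J (v b)) a
      have e3 := nsq_add_le (dI (p + 1) J ((G a).comp t v)
          - ∑ c, ((G a).dZ c).comp t v * jd c (fun b => dI (p + 1) J (v b)))
        (∑ c, ((G a).dZ c).comp t v * jd c (fun b => dI (p + 1) J (v b))
          - linOp (linCoeff G) (fun b => dI (p + 1) J (v b)) a)
      rw [sub_add_sub_cancel] at e3
      have e4 := mul_le_mul_of_nonneg_right (hle J a) hnn
      linarith
    have h2 := Finset.sum_le_sum fun J (_ : J ∈ Finset.univ) => h1 J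
    rw [Finset.sum_comm, Finset.sum_add_distrib, Finset.sum_neg_distrib, ← Finset.mul_sum,
      ← Finset.mul_sum, Finset.sum_add_distrib, sum_HS_dI, sum_NS_dI, Finset.sum_const,
      nsmul_eq_mul, hN'] at h2
    simp only [← ip_lapP_add] at h2
    have h3 := ha v
    have h4 := hb v
    have h5 := HS_nonneg (p + 1 + 2 * h) v
    have h6 : C₀ * (lam / (8 * (C₀ + 1))) ≤ lam / 8 := by
      rw [mul_div_assoc', div_le_div_iff₀ (by positivity) (by positivity)]; nlinarith
    have h7 : N * C₀ * (2 * C₁) * (lam / (8 * (N * C₀ * (2 * C₁) + 1))) ≤ lam / 8 := by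
      have : 0 ≤ N * C₀ * (2 * C₁) := by positivity
      rw [mul_div_assoc', div_le_div_iff₀ (by positivity) (by positivity)]; nlinarith
    have h8 := mul_le_mul_of_nonneg_left h3 hC₀
    have h9 := mul_le_mul_of_nonneg_left h4 (show 0 ≤ N * C₀ * (2 * C₁) by positivity)
    have h10 := mul_le_mul_of_nonneg_right h6 h5
    have h11 := mul_le_mul_of_nonneg_right h7 h5
    have h12 : 0 ≤ N * C₀ * (2 * C₁) * Cb := by positivity
    have h13 : 0 ≤ C₀ * Ca := by positivity
    have h2' : ∑ a, ip ((G a).comp t v) (lapP (p + 1 + h) (v a))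
      ≤ -(lam / 4 * HS (p + 1 + 2 * h) v) + (C₀ * HS (p + 1) v
        + N * C₀ * (2 * C₁) * (1 + (HS (2 * h + p) v + NS v))) := by
      refine h2.trans (le_of_eq ?_); ring
    refine h2'.trans ?_
    nlinarith [NS_nonneg v]
  · obtain ⟨CL, hCL, hL⟩ := exists_nsq_linOp_le (linCoeff G)
    set B : ℝ := l * (2 * CL + η) with hB
    have hB0 : 0 ≤ B := by positivity
    set ε' : ℝ := lam / (4 * (B + 1)) with hε'
    have hε'0 : 0 < ε' := by positivity
    have hεB : ε' * B ≤ lam / 4 := by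
      rw [hε', div_mul_eq_mul_div, div_le_div_iff₀ (by positivity) (by positivity)]; nlinarith
    refine ⟨C₀ + lam / 4 + 1 / (4 * ε'), by positivity, fun t ht v v' hv hv' => ?_⟩
    have e1 := (hs t ht).2 v v' hv hv'
    have hX := HS_nonneg (2 * h) (v - v')
    have hY := NS_nonneg (v - v')
    have e2 := hco (v - v') (fun a => (G a).comp t v - (G a).comp t v') 0 le_rfl fun a =>
      (e1 a).trans (by nlinarith)
    have e3 : ∀ a, nsq ((G a).comp t v - (G a).comp t v')
        ≤ (2 * CL + η) * (HS (2 * h) (v - v') + NS (v - v')) := fun a => by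
      have f1 := nsq_add_le ((G a).comp t v - (G a).comp t v' - linOp (linCoeff G) (v - v') a)
        (linOp (linCoeff G) (v - v') a)
      rw [sub_add_cancel] at f1
      have f2 := hL (v - v') a
      have f3 := e1 a
      linarith
    have e4 := Finset.sum_le_sum fun a (_ : a ∈ Finset.univ) => e3 a
    rw [Finset.sum_const, Finset.card_univ, Fintype.card_fin, nsmul_eq_mul] at e4
    have e5 := sum_ip_le (fun a => (G a).comp t v - (G a).comp t v') (v - v') hε'0
    have e6 := mul_le_mul_of_nonneg_left e4 hε'0.le
    have e7 := mul_le_mul_of_nonneg_right hεB (add_nonneg hX hY)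
    simp only [ip_add_right, Finset.sum_add_distrib]
    have e8 : ε' * ((l : ℝ) * ((2 * CL + η) * (HS (2 * h) (v - v') + NS (v - v'))))
      = ε' * B * (HS (2 * h) (v - v') + NS (v - v')) := by rw [hB]; ring
    rw [e8] at e6
    linarith

end SP

namespace SP

variable {n l r : ℕ} {T : ℝ}

lemma ip_eq_avgC (f g : SP n) : ip f g = avgC (toC f * toC g) := rfl

lemma abs_ip_le_sup {f : SP n} {c : ℝ} (h : ∀ x, |f x| ≤ c) (g : SP n) :
    |ip f g| ≤ c * ‖toC g‖ := by
  have h1 : ∀ x, |(f * g) x| ≤ c * ‖toC g‖ := fun x => by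
    rw [SP.mul_apply, abs_mul]
    exact mul_le_mul (h x) (abs_le_norm_toC g x) (abs_nonneg _) ((abs_nonneg _).trans (h x))
  have h2 : avg ((c * ‖toC g‖) • (1 : SP n)) = c * ‖toC g‖ := by
    rw [map_smul, avg_one, smul_eq_mul, mul_one]
  have h3 : ip f g ≤ c * ‖toC g‖ := by
    rw [← h2]
    exact avg_mono fun x => by simpa using (abs_le.1 (h1 x)).2
  have h4 : -(c * ‖toC g‖) ≤ ip f g := by
    rw [← h2, ← map_neg]
    exact avg_mono fun x => by simpa using (abs_le.1 (h1 x)).1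
  exact abs_le.2 ⟨h4, h3⟩

/-- Linear combinations of fixed functions. -/
def recon {ι : Type*} [Fintype ι] (φ : ι → SP n) (y : Fin l → ι → ℝ) (a : Fin l) : SP n :=
  ∑ j, y a j • φ j

lemma jd_recon {ι : Type*} [Fintype ι] (φ : ι → SP n) (y : Fin l → ι → ℝ) (c : JIdx n l r)
    (x : Vec n) : jd c (recon φ y) x = ∑ j, y c.2.2 j * dI c.1 c.2.1 (φ j) x := by
  rw [jd, recon, map_sum, sum_apply]
  simp

lemma recon_sub {ι : Type*} [Fintype ι] (φ : ι → SP n) (y y' : Fin l → ι → ℝ) :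
    recon φ y - recon φ y' = recon φ (y - y') := by
  funext a
  simp only [recon, Pi.sub_apply, sub_smul, Finset.sum_sub_distrib]

lemma exists_abs_jd_recon_le {ι : Type*} [Fintype ι] (φ : ι → SP n) : ∃ C : ℝ, 0 ≤ C ∧
    ∀ (y : Fin l → ι → ℝ) (c : JIdx n l r) (x : Vec n), |jd c (recon φ y) x| ≤ C * ‖y‖ := by
  refine ⟨∑ c : JIdx n l r, ∑ j, ‖toC (dI c.1 c.2.1 (φ j))‖, by positivity, fun y c x => ?_⟩
  rw [jd_recon, mul_comm]
  refine (Finset.abs_sum_le_sum_abs _ _).trans ?_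
  refine le_trans ?_ (mul_le_mul_of_nonneg_left (Finset.single_le_sum
    (f := fun c : JIdx n l r => ∑ j, ‖toC (dI c.1 c.2.1 (φ j))‖) (fun c _ => by positivity)
    (Finset.mem_univ c)) (norm_nonneg y))
  rw [Finset.mul_sum]
  refine Finset.sum_le_sum fun j _ => ?_
  rw [abs_mul]
  exact mul_le_mul ((norm_le_pi_norm (y c.2.2) j).trans (norm_le_pi_norm y c.2.2))
    (abs_le_norm_toC _ _) (abs_nonneg _) (norm_nonneg _)

variable [hT : Fact (0 < T)]

lemma _root_.NL.continuousOn_comp (Ψ : NL n l r T) (v : Fin l → SP n) :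
    ContinuousOn (fun t => toC (Ψ.comp t v)) (Set.Icc 0 T) := by
  refine continuousOn_toC (f := fun t => Ψ.comp t v) ?_
  have h : ContinuousOn (fun p : Vec n × ℝ => Ψ.toFun (p.1, p.2, jet r v p.1))
      (Set.univ ×ˢ Set.Icc 0 T) :=
    Ψ.smooth'.continuousOn.comp (continuous_fst.prodMk (continuous_snd.prodMk
      ((contDiff_jet v).continuous.comp continuous_fst))).continuousOn
      fun p hp => Set.mk_mem_prod (Set.mem_univ _) (Set.mk_mem_prod hp.2 (Set.mem_univ _))
  refine h.congr fun p hp => ?_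
  rw [NL.comp_apply, NL.clamp_of_mem hp.2]

/-- Nonlinearities are Lipschitz on bounded sets of jets. -/
lemma _root_.NL.exists_lipschitz (Ψ : NL n l r T) (K : ℝ) : ∃ L : ℝ, 0 ≤ L ∧
    ∀ (t : ℝ) (v v' : Fin l → SP n) (x : Vec n), ‖jet r v x‖ ≤ K → ‖jet r v' x‖ ≤ K →
      |Ψ.comp t v x - Ψ.comp t v' x| ≤ L * ∑ c : JIdx n l r, |jd c (v - v') x| := by
  choose L hL H using fun c => (Ψ.dZ c).exists_bound K
  refine ⟨∑ c, L c, Finset.sum_nonneg fun c _ => hL c, fun t v v' x hv hv' => ?_⟩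
  have h := Ψ.abs_sub_sub_le (NL.clamp_mem t) (x := x) (a := 0) (η := ∑ c, L c)
    (fun c z hz => by
      rw [Pi.zero_apply, sub_zero]
      exact (H c x _ (NL.clamp_mem t) z hz).trans
        (Finset.single_le_sum (f := L) (fun c _ => hL c) (Finset.mem_univ c))) hv hv'
  have e : ∀ c, (jet r v x - jet r v' x).coord c = jd c (v - v') x := fun c => by
    rw [jd_sub]; rfl
  simp only [e, Pi.zero_apply, zero_mul, Finset.sum_const_zero, sub_zero] at h
  exact h

/-- The Galerkin system has a global solution. -/
lemma exists_galerkin_ode {ι : Type*} [Fintype ι] (φ : ι → SP n) (G : Fin l → NL n l r T) {M : ℝ}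
    (hM : ∀ a t v x, |(G a).comp t v x| ≤ M) :
    ∃ y : ℝ → Fin l → ι → ℝ, y 0 = 0 ∧ ∀ t ∈ Set.Icc 0 T, HasDerivWithinAt y
      (fun a j => ip ((G a).comp t (recon φ (y t))) (φ j)) (Set.Icc 0 T) t := by
  have hT0 := hT.out.le
  set Φ : ℝ := ∑ j, ‖toC (φ j)‖ with hΦ
  have hΦ0 : 0 ≤ Φ := by positivity
  have hΦj : ∀ j, ‖toC (φ j)‖ ≤ Φ := fun j =>
    Finset.single_le_sum (f := fun j => ‖toC (φ j)‖) (fun _ _ => norm_nonneg _) (Finset.mem_univ j)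
  set B : ℝ := max M 0 * Φ with hB
  have hB0 : 0 ≤ B := by positivity
  obtain ⟨C, hC, hjd⟩ := exists_abs_jd_recon_le (l := l) (r := r) φ
  choose L hL hlip using fun a => (G a).exists_lipschitz (C * (B * T))
  set Lt : ℝ := ∑ a, L a with hLt
  have hLt0 : 0 ≤ Lt := Finset.sum_nonneg fun a _ => hL a
  set κ : ℝ := Lt * (Fintype.card (JIdx n l r) * C) * Φ with hκ
  have hκ0 : 0 ≤ κ := by positivity
  have hpl : IsPicardLindelof
      (fun t (y : Fin l → ι → ℝ) a j => ip ((G a).comp t (recon φ y)) (φ j))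
      (⟨0, le_rfl, hT0⟩ : Set.Icc 0 T) 0 ⟨B * T, by positivity⟩ 0 ⟨B, hB0⟩ ⟨κ, hκ0⟩ := by
    refine ⟨fun t ht => ?_, fun y hy => ?_, fun t ht y hy => ?_, ?_⟩
    · refine LipschitzOnWith.of_dist_le_mul fun y hy y' hy' => ?_
      rw [dist_eq_norm, dist_eq_norm]
      have hy1 : ‖y‖ ≤ B * T := mem_closedBall_zero_iff.1 hy
      have hy2 : ‖y'‖ ≤ B * T := mem_closedBall_zero_iff.1 hy'
      refine (pi_norm_le_iff_of_nonneg (by positivity)).2 fun a =>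
        (pi_norm_le_iff_of_nonneg (by positivity)).2 fun j => ?_
      have e1 : ∀ x, |((G a).comp t (recon φ y) - (G a).comp t (recon φ y')) x|
          ≤ Lt * (Fintype.card (JIdx n l r) * C) * ‖y - y'‖ := fun x => by
        rw [SP.sub_apply]
        refine (hlip a t _ _ x
          (NL.norm_jet_le (by positivity) fun c => (hjd y c x).trans (by gcongr))
          (NL.norm_jet_le (by positivity) fun c => (hjd y' c x).trans (by gcongr))).trans ?_
        have e2 : ∑ c : JIdx n l r, |jd c (recon φ y - recon φ y') x|
            ≤ Fintype.card (JIdx n l r) * (C * ‖y - y'‖) := by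
          rw [recon_sub]
          refine (Finset.sum_le_sum fun c _ => hjd (y - y') c x).trans (le_of_eq ?_)
          rw [Finset.sum_const, Finset.card_univ, nsmul_eq_mul]
        have e3 : L a ≤ Lt := Finset.single_le_sum (f := L) (fun a _ => hL a) (Finset.mem_univ a)
        calc _ ≤ Lt * (Fintype.card (JIdx n l r) * (C * ‖y - y'‖)) :=
              mul_le_mul e3 e2 (Finset.sum_nonneg fun _ _ => abs_nonneg _) hLt0
          _ = _ := by ring
      change ‖ip ((G a).comp t (recon φ y)) (φ j) - ip ((G a).comp t (recon φ y')) (φ j)‖ ≤ _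
      rw [← ip_sub_left]
      refine (abs_ip_le_sup e1 (φ j)).trans ?_
      have := mul_le_mul_of_nonneg_left (hΦj j)
        (show 0 ≤ Lt * (Fintype.card (JIdx n l r) * C) * ‖y - y'‖ by positivity)
      refine this.trans (le_of_eq ?_)
      change _ = κ * _
      rw [hκ]; ring
    · refine continuousOn_pi.2 fun a => continuousOn_pi.2 fun j => ?_
      have h := ((G a).continuousOn_comp (recon φ y)).mul
        (continuousOn_const (c := toC (φ j)))
      exact avgC.continuous.comp_continuousOn h
    · refine (pi_norm_le_iff_of_nonneg hB0).2 fun a => (pi_norm_le_iff_of_nonneg hB0).2 fun j => ?_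
      refine (abs_ip_le_sup (fun x => (hM a t (recon φ y) x).trans (le_max_left M 0))
        (φ j)).trans ?_
      exact mul_le_mul_of_nonneg_left (hΦj j) (le_max_right _ _)
    · change B * max (T - 0) (0 - 0) ≤ B * T - 0
      rw [sub_zero, sub_zero, sub_zero, max_eq_left hT0]
  obtain ⟨y, hy0, hy⟩ := hpl.exists_eq_forall_mem_Icc_hasDerivWithinAt₀
  exact ⟨y, hy0, hy⟩

end SP

namespace SP

variable {n l r : ℕ} {T : ℝ}

/-- Differentiability of a curve of smooth periodic functions, uniformly for all spatial
derivatives. -/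
def HasSDeriv (f : ℝ → SP n) (g : SP n) (S : Set ℝ) (t : ℝ) : Prop :=
  ∀ (k : ℕ) (I : Fin k → Fin n),
    HasDerivWithinAt (fun τ => toC (dI k I (f τ))) (toC (dI k I g)) S t

namespace HasSDeriv

variable {f f' : ℝ → SP n} {g g' : SP n} {S : Set ℝ} {t : ℝ}

lemma mono (h : HasSDeriv f g S t) {S' : Set ℝ} (hS : S' ⊆ S) : HasSDeriv f g S' t :=
  fun k I => (h k I).mono hS

lemma sub (h : HasSDeriv f g S t) (h' : HasSDeriv f' g' S t) :
    HasSDeriv (fun τ => f τ - f' τ) (g - g') S t := fun k I => by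
  simp only [map_sub]; exact (h k I).sub (h' k I)

lemma dI (h : HasSDeriv f g S t) (m : ℕ) (J : Fin m → Fin n) :
    HasSDeriv (fun τ => SP.dI m J (f τ)) (SP.dI m J g) S t := fun k I => by
  obtain ⟨I', hI⟩ := exists_dI_dI I J rfl
  simp only [hI]; exact h _ I'

lemma toC (h : HasSDeriv f g S t) :
    HasDerivWithinAt (fun τ => SP.toC (f τ)) (SP.toC g) S t := h 0 Fin.elim0

lemma nsq (h : HasSDeriv f g S t) :
    HasDerivWithinAt (fun τ => SP.nsq (f τ)) (2 * ip g (f t)) S t := by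
  have h1 := (avgC (n := n)).hasFDerivAt.comp_hasDerivWithinAt t (h.toC.mul h.toC)
  have h2 : avgC (SP.toC g * SP.toC (f t) + SP.toC (f t) * SP.toC g) = 2 * ip g (f t) := by
    rw [map_add, ← ip_eq_avgC, ← ip_eq_avgC, ip_comm (f t)]; ring
  exact h1.congr_deriv h2

lemma hs (h : HasSDeriv f g S t) (m : ℕ) :
    HasDerivWithinAt (fun τ => SP.hs m (f τ)) (2 * ip g (lapP m (f t))) S t := by
  have h1 := ip_lapP_add m 0 g (f t)
  simp only [add_zero, lapP_zero] at h1
  rw [h1, Finset.mul_sum]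
  exact HasDerivWithinAt.fun_sum fun J _ => (h.dI m J).nsq

end HasSDeriv

/-- The inhomogeneous Sobolev energy. -/
def ES (m : ℕ) (v : Fin l → SP n) : ℝ := NS v + HS m v

lemma ES_nonneg (m : ℕ) (v : Fin l → SP n) : 0 ≤ ES m v := add_nonneg (NS_nonneg v) (HS_nonneg m v)

lemma HasSDeriv.ES {v : ℝ → Fin l → SP n} {g : Fin l → SP n} {S : Set ℝ} {t : ℝ}
    (h : ∀ a, HasSDeriv (fun τ => v τ a) (g a) S t) (m : ℕ) :
    HasDerivWithinAt (fun τ => SP.ES m (v τ))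
      (2 * ∑ a, ip (g a) (v t a + lapP m (v t a))) S t := by
  have h1 : HasDerivWithinAt (fun τ => SP.ES m (v τ))
      (∑ a, 2 * ip (g a) (v t a) + ∑ a, 2 * ip (g a) (lapP m (v t a))) S t :=
    HasDerivWithinAt.add (HasDerivWithinAt.fun_sum fun a _ => (h a).nsq)
      (HasDerivWithinAt.fun_sum fun a _ => (h a).hs m)
  refine h1.congr_deriv ?_
  simp only [ip_add_right, Finset.sum_add_distrib, Finset.mul_sum, mul_add]

lemma eq_zero_of_qc {f : SP n} (h : ∀ k, qc k f = 0) : f = 0 := by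
  obtain ⟨C, -, H⟩ := sobolev n
  have h1 : nsq f = 0 := (hasSum_nsq f).unique (by simp only [h]; exact hasSum_zero)
  have h2 : hs n f = 0 := (hasSum_hs n f).unique (by simp only [h, mul_zero]; exact hasSum_zero)
  ext x
  have := H f x
  rw [h1, h2, add_zero, mul_zero] at this
  simpa using pow_eq_zero_iff two_ne_zero |>.1 (le_antisymm this (sq_nonneg _))

lemma proj_eq_self {N : ℕ} {f : SP n} (h : ∀ k ∉ box n N, ac k f = 0 ∧ bc k f = 0) :
    proj N f = f := by
  refine sub_eq_zero.1 (eq_zero_of_qc fun k => ?_)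
  rw [qc, ac_sub, bc_sub, ac_proj, bc_proj]
  split_ifs with hk
  · simp
  · simp [h k hk]

lemma proj_cosK {N : ℕ} {j : Fin n → ℤ} (hj : j ∈ box n N) : proj N (cosK j) = cosK j := by
  refine proj_eq_self fun k hk => ⟨?_, bc_cosK _ _⟩
  rw [ac_cosK, if_neg, if_neg]
  · simp
  · rintro rfl; exact hk hj
  · intro h
    rw [eq_neg_of_add_eq_zero_left h, neg_mem_box] at hj
    exact hk hj

lemma proj_sinK {N : ℕ} {j : Fin n → ℤ} (hj : j ∈ box n N) : proj N (sinK j) = sinK j := by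
  refine proj_eq_self fun k hk => ⟨ac_sinK _ _, ?_⟩
  rw [bc_sinK, if_neg, if_neg]
  · simp
  · intro h
    rw [eq_neg_of_add_eq_zero_left h, neg_mem_box] at hj
    exact hk hj
  · rintro rfl; exact hk hj

lemma HasSDeriv.recon {ι : Type*} [Fintype ι] (φ : ι → SP n) {y : ℝ → Fin l → ι → ℝ}
    {y' : Fin l → ι → ℝ} {S : Set ℝ} {t : ℝ} (h : HasDerivWithinAt y y' S t) (a : Fin l) :
    HasSDeriv (fun τ => recon φ (y τ) a) (recon φ y' a) S t := fun k I => by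
  simp only [SP.recon, map_sum, map_smul]
  refine HasDerivWithinAt.fun_sum fun j _ => ?_
  have h1 : HasDerivWithinAt (fun τ => y τ a j) (y' a j) S t :=
    hasDerivWithinAt_pi.1 (hasDerivWithinAt_pi.1 h a) j
  exact h1.smul_const (SP.toC (SP.dI k I (φ j)))

variable [hT : Fact (0 < T)]

/-- Galerkin approximations of the nonlinear evolution equation with zero initial value. -/
structure IsGalerkin (G : Fin l → NL n l r T) (N : ℕ) (v : ℝ → Fin l → SP n) : Prop where
  zero : v 0 = 0
  proj_eq : ∀ t a, proj N (v t a) = v t a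
  deriv : ∀ t ∈ Set.Icc 0 T, ∀ a,
    HasSDeriv (fun τ => v τ a) (proj N ((G a).comp t (v t))) (Set.Icc 0 T) t

lemma exists_isGalerkin (G : Fin l → NL n l r T) {M : ℝ} (hM : ∀ a t v x, |(G a).comp t v x| ≤ M)
    (N : ℕ) : ∃ v, IsGalerkin G N v := by
  let φ : box n N × Bool → SP n := fun j => if j.2 then cosK j.1 else sinK j.1
  have hp : ∀ j, proj N (φ j) = φ j := by
    rintro ⟨j, b⟩
    cases b
    · exact proj_sinK j.2
    · exact proj_cosK j.2
  have hf : ∀ f, proj N f = ∑ j, ip f (φ j) • φ j := fun f => by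
    rw [Fintype.sum_prod_type, proj, ← Finset.sum_coe_sort]
    refine Finset.sum_congr rfl fun k _ => ?_
    rw [Fintype.sum_bool]
    rfl
  obtain ⟨y, hy0, hy⟩ := exists_galerkin_ode φ G hM
  refine ⟨fun t => recon φ (y t), ?_, fun t a => ?_, fun t ht a => ?_⟩
  · funext a
    simp [recon, hy0]
  · have h := map_sum (projL N) (fun j => y t a j • φ j) Finset.univ
    simp only [projL_apply, map_smul, hp] at h
    exact h
  · rw [hf]
    exact HasSDeriv.recon φ (hy t ht) a

lemma IsGalerkin.hasDerivWithinAt_ES {G : Fin l → NL n l r T} {N : ℕ} {v : ℝ → Fin l → SP n}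
    (hv : IsGalerkin G N v) {t : ℝ} (ht : t ∈ Set.Icc 0 T) (m : ℕ) :
    HasDerivWithinAt (fun τ => ES m (v τ))
      (2 * ∑ a, ip ((G a).comp t (v t)) (v t a + lapP m (v t a))) (Set.Icc 0 T) t := by
  refine (HasSDeriv.ES (hv.deriv t ht) m).congr_deriv ?_
  congr 1
  refine Finset.sum_congr rfl fun a _ => ?_
  rw [ip_proj, proj_add, ← lapP_proj, hv.proj_eq]

end SP

lemma HasDerivWithinAt.Ici_of_Icc {E : Type*} [NormedAddCommGroup E] [NormedSpace ℝ E]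
    {f : ℝ → E} {f' : E} {a b x : ℝ} (h : HasDerivWithinAt f f' (Set.Icc a b) x)
    (hx : x ∈ Set.Ico a b) : HasDerivWithinAt f f' (Set.Ici x) x :=
  h.mono_of_mem_nhdsWithin (Icc_mem_nhdsGE_of_mem hx)

/-- Grönwall's inequality with zero initial value. -/
lemma le_mul_exp_of_hasDerivWithinAt {f f' : ℝ → ℝ} {b C D : ℝ}
    (hf : ∀ t ∈ Set.Icc 0 b, HasDerivWithinAt f (f' t) (Set.Icc 0 b) t) (h0 : f 0 = 0)
    (hC : 0 ≤ C) (hD : 0 ≤ D) (h : ∀ t ∈ Set.Icc 0 b, f' t ≤ C * f t + D) {t : ℝ}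
    (ht : t ∈ Set.Icc 0 b) : f t ≤ D * (b * Real.exp (C * b)) := by
  have hE : ∀ s, HasDerivAt (fun s => Real.exp (-(C * s))) (Real.exp (-(C * s)) * -C) s :=
    fun s => by
    have := ((hasDerivAt_id s).const_mul C).neg.exp
    simpa using this
  have h1 : ∀ s ∈ Set.Icc 0 b, HasDerivWithinAt (fun s => Real.exp (-(C * s)) * f s)
      (Real.exp (-(C * s)) * -C * f s + Real.exp (-(C * s)) * f' s) (Set.Icc 0 b) s :=
    fun s hs => (hE s).hasDerivWithinAt.mul (hf s hs)
  have h2 := image_le_of_deriv_right_le_deriv_boundary (B := fun s => D * s) (B' := fun _ => D)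
    (fun s hs => (h1 s hs).continuousWithinAt)
    (fun s hs => (h1 s (Set.Ico_subset_Icc_self hs)).Ici_of_Icc hs)
    (by simp [h0]) (by fun_prop)
    (fun s _ => by simpa using ((hasDerivAt_id s).const_mul D).hasDerivWithinAt)
    (fun s hs => by
      have h3 := h s (Set.Ico_subset_Icc_self hs)
      have h4 : Real.exp (-(C * s)) ≤ 1 :=
        Real.exp_le_one_iff.2 (neg_nonpos.2 (mul_nonneg hC hs.1))
      nlinarith [Real.exp_pos (-(C * s)), mul_le_mul_of_nonneg_right h4 hD]) ht
  have h5 : f t = Real.exp (C * t) * (Real.exp (-(C * t)) * f t) := by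
    rw [← mul_assoc, ← Real.exp_add]; simp
  rw [h5]
  calc Real.exp (C * t) * (Real.exp (-(C * t)) * f t)
      ≤ Real.exp (C * b) * (D * b) :=
        (mul_le_mul_of_nonneg_left h2 (Real.exp_pos _).le).trans
          (mul_le_mul (Real.exp_le_exp.2 (mul_le_mul_of_nonneg_left ht.2 hC))
            (mul_le_mul_of_nonneg_left ht.2 hD) (mul_nonneg hD ht.1) (Real.exp_pos _).le)
    _ = D * (b * Real.exp (C * b)) := by ring

namespace SP

variable {n l r : ℕ} {T : ℝ}

lemma exists_sq_dI_le (n : ℕ) {m s : ℕ} (h : m + n ≤ s) : ∃ C : ℝ, 0 < C ∧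
    ∀ {l : ℕ} (v : Fin l → SP n), ∀ k ≤ m, ∀ (I : Fin k → Fin n) (b : Fin l) (x : Vec n),
      dI k I (v b) x ^ 2 ≤ C * ES s v := by
  obtain ⟨C, hC, H⟩ := sobolev n
  refine ⟨C * 3, by positivity, fun v k hk I b x => (H _ x).trans ?_⟩
  rw [mul_assoc]
  refine mul_le_mul_of_nonneg_left ?_ hC.le
  have h1 := nsq_dI_le k I (v b)
  have h2 := hs_dI_le n k I (v b)
  have h3 := hs_le_add (show k ≤ s by omega) (v b)
  have h4 := hs_le_add (show n + k ≤ s by omega) (v b)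
  have h5 := nsq_le_NS v b
  have h6 := hs_le_HS s v b
  have h7 := HS_nonneg s v
  have h8 := NS_nonneg v
  rw [ES]
  linarith

lemma ES_le_ES {m s : ℕ} (h : m ≤ s) (v : Fin l → SP n) : ES m v ≤ 2 * ES s v := by
  have := HS_le_add h v
  have := HS_nonneg s v
  simp only [ES]
  linarith

variable [hT : Fact (0 < T)]

lemma EnergyEst.exists_deriv_le {h : ℕ} {G : Fin l → NL n l (2 * h) T} {ε δ M : ℝ}
    (hG : EnergyEst G ε δ) (hM : ∀ a t v x, |(G a).comp t v x| ≤ M) (q : ℕ) {K : ℝ} (hK : 0 ≤ K) :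
    ∃ C : ℝ, 0 ≤ C ∧ ∀ t ∈ Set.Icc 0 δ, ∀ v, JSmall (2 * h) ε v → DBound (2 * h + q) K v →
      2 * ∑ a, ip ((G a).comp t v) (v a + lapP (2 * q + 1 + h) (v a)) ≤
        C * ES (2 * q + 1 + h) v + C := by
  obtain ⟨C, hC, H⟩ := hG.1 (2 * q) q K le_rfl hK
  refine ⟨2 * (C + 1 + l * M ^ 2), by positivity, fun t ht v hv hv' => ?_⟩
  have h1 := H t ht v hv hv'
  have h2 := sum_ip_le (fun a => (G a).comp t v) v one_pos
  have h3 : ∑ a, nsq ((G a).comp t v) ≤ l * M ^ 2 := by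
    refine (Finset.sum_le_sum fun a _ => nsq_le_sup (hM a t v)).trans ?_
    simp
  have h4 := HS_nonneg (2 * q + 1 + h) v
  have h5 := NS_nonneg v
  have h6 : 0 ≤ (l : ℝ) * M ^ 2 := by positivity
  simp only [ip_add_right, Finset.sum_add_distrib]
  rw [ES]
  nlinarith [mul_nonneg hC h4, mul_nonneg h6 h4, mul_nonneg h6 h5]

/-- Galerkin approximations are bounded in all Sobolev norms on a common time interval. -/
lemma EnergyEst.exists_uniform {h : ℕ} {G : Fin l → NL n l (2 * h) T} {ε δ M : ℝ} (hε : 0 < ε)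
    (hδ : 0 < δ) (hδT : δ ≤ T)
    (hG : EnergyEst G ε δ) (hM : ∀ a t v x, |(G a).comp t v x| ≤ M) :
    ∃ δ', 0 < δ' ∧ δ' ≤ δ ∧
      (∀ N v, IsGalerkin G N v → ∀ t ∈ Set.Icc 0 δ', JSmall (2 * h) ε (v t)) ∧
      ∀ s, ∃ C : ℝ, 0 ≤ C ∧ ∀ N v, IsGalerkin G N v → ∀ t ∈ Set.Icc 0 δ', ES s (v t) ≤ C := by
  obtain ⟨S, hS, HS⟩ := exists_sq_dI_le n (m := 2 * h + (h + n)) (s := 2 * (h + n) + 1 + h)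
    (by omega)
  obtain ⟨C, hC, HC⟩ := hG.exists_deriv_le hM (h + n) zero_le_one
  obtain ⟨e, he, he1, heε⟩ : ∃ e : ℝ, 0 < e ∧ e ≤ 1 ∧ e ≤ ε :=
    ⟨min 1 ε, lt_min one_pos hε, min_le_left _ _, min_le_right _ _⟩
  obtain ⟨η, hη⟩ : ∃ η : ℝ, η = e ^ 2 / S := ⟨_, rfl⟩
  have hη0 : 0 < η := by rw [hη]; positivity
  have hSη : S * η = e ^ 2 := by rw [hη]; field_simp
  have small : ∀ v : Fin l → SP n, ES (2 * (h + n) + 1 + h) v ≤ η →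
      DBound (2 * h + (h + n)) e v := fun v hv k hk I b x =>
    abs_le_of_sq_le_sq ((HS v k hk I b x).trans
      (hSη ▸ mul_le_mul_of_nonneg_left hv hS.le)) he.le
  have jsmall : ∀ v : Fin l → SP n, ES (2 * (h + n) + 1 + h) v ≤ η → JSmall (2 * h) ε v :=
    fun v hv x =>
      (((small v hv).mono (Nat.le_add_right _ _)).norm_jet he.le x).trans heε
  obtain ⟨A, hA⟩ : ∃ A : ℝ, A = C * η + C + 1 := ⟨_, rfl⟩
  have hA0 : 0 < A := by rw [hA]; positivity
  have hd : ∀ δ', δ' ≤ δ → ∀ N v, IsGalerkin G N v → ∀ s, ∀ t ∈ Set.Icc 0 δ',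
      HasDerivWithinAt (fun τ => ES s (v τ))
      (2 * ∑ a, ip ((G a).comp t (v t)) (v t a + lapP s (v t a))) (Set.Icc 0 δ') t :=
    fun δ' hδ' N v hv s t ht =>
      (hv.hasDerivWithinAt_ES ⟨ht.1, ht.2.trans (hδ'.trans hδT)⟩ s).mono
        (Set.Icc_subset_Icc_right (hδ'.trans hδT))
  have hz : ∀ s, ES s (0 : Fin l → SP n) = 0 := fun s => by
    simp [ES, NS, SP.HS, SP.hs, SP.nsq]
  have base : ∀ N v, IsGalerkin G N v → ∀ t ∈ Set.Icc 0 (min δ (η / A)),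
      ES (2 * (h + n) + 1 + h) (v t) ≤ η := fun N v hv t ht => by
    have hle : ∀ x ∈ Set.Icc 0 (min δ (η / A)), A * x ≤ η := fun x hx => by
      have := (le_div_iff₀ hA0).1 (hx.2.trans (min_le_right _ _))
      linarith
    refine le_trans ?_ (hle t ht)
    refine image_le_of_deriv_right_lt_deriv_boundary (B := fun s => A * s) (B' := fun _ => A)
      (fun s hs => (hd _ (min_le_left _ _) N v hv _ s hs).continuousWithinAt)
      (fun s hs => (hd _ (min_le_left _ _) N v hv _ s
        (Set.Ico_subset_Icc_self hs)).Ici_of_Icc hs)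
      (by simp [hv.zero, hz]) (fun s => by simpa using (hasDerivAt_id s).const_mul A)
      (fun s hs hs' => ?_) ht
    have hs1 := Set.Ico_subset_Icc_self hs
    have h1 : ES (2 * (h + n) + 1 + h) (v s) ≤ η := hs'.le.trans (hle s hs1)
    have h2 := HC s ⟨hs1.1, hs1.2.trans (min_le_left _ _)⟩ (v s) (jsmall _ h1)
      (fun k hk I b x => (small _ h1 k hk I b x).trans he1)
    refine h2.trans_lt ?_
    rw [hA]
    nlinarith
  refine ⟨min δ (η / A), lt_min hδ (by positivity), min_le_left _ _,
    fun N v hv t ht => jsmall _ (base N v hv t ht), ?_⟩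
  have key : ∀ j, ∃ C : ℝ, 0 ≤ C ∧ ∀ N v, IsGalerkin G N v →
      ∀ t ∈ Set.Icc 0 (min δ (η / A)), ES (2 * (h + n + j) + 1 + h) (v t) ≤ C := fun j => by
    induction j with
    | zero => exact ⟨η, hη0.le, base⟩
    | succ j ih =>
      obtain ⟨B, hB, HB⟩ := ih
      obtain ⟨S', hS', HS'⟩ := exists_sq_dI_le n (m := 2 * h + (h + n + (j + 1)))
        (s := 2 * (h + n + j) + 1 + h) (by omega)
      obtain ⟨C', hC', HC'⟩ := hG.exists_deriv_le hM (h + n + (j + 1))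
        (Real.sqrt_nonneg (S' * B))
      refine ⟨_, ?_, fun N v hv t ht => le_mul_exp_of_hasDerivWithinAt
        (hd _ (min_le_left _ _) N v hv _) (by simp [hv.zero, hz]) hC' hC' (fun s hs => ?_) ht⟩
      · have : 0 < min δ (η / A) := lt_min hδ (by positivity)
        positivity
      · refine HC' s ⟨hs.1, hs.2.trans (min_le_left _ _)⟩ _ (jsmall _ (base N v hv s hs)) ?_
        intro k hk I b x
        refine Real.abs_le_sqrt ((HS' _ k hk I b x).trans ?_)
        exact mul_le_mul_of_nonneg_left (HB N v hv s hs) hS'.le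
  intro s
  obtain ⟨C, hC, H⟩ := key s
  exact ⟨2 * C, by positivity, fun N v hv t ht => (ES_le_ES (by omega) _).trans
    (mul_le_mul_of_nonneg_left (H N v hv t ht) two_pos.le)⟩

end SP

namespace SP

variable {n l r : ℕ} {T : ℝ}

/-- The covector with given components. -/
def covec (n : ℕ) : (Fin n → ℝ) →L[ℝ] (Vec n →L[ℝ] ℝ) :=
  ∑ i, (ContinuousLinearMap.proj i).smulRight (EuclideanSpace.proj i)

lemma covec_apply (c : Fin n → ℝ) (x : Vec n) : covec n c x = ∑ i, c i * x i := by
  simp [covec]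

lemma hasFDerivAt (f : SP n) (x : Vec n) : HasFDerivAt f (covec n fun i => D i f x) x := by
  convert (f.diff x).hasFDerivAt using 1
  refine ContinuousLinearMap.ext fun y => ?_
  conv_rhs => rw [← (EuclideanSpace.basisFun (Fin n) ℝ).sum_repr y]
  rw [covec_apply, map_sum]
  refine Finset.sum_congr rfl fun i _ => ?_
  rw [map_smul, D_apply, smul_eq_mul, mul_comm]
  simp

/-- A family closed under partial differentiation consists of smooth functions. -/
lemma contDiff_of_family {g : (k : ℕ) → (Fin k → Fin n) → Vec n → ℝ}
    (h : ∀ k I x, HasFDerivAt (g k I) (covec n fun i => g (k + 1) (Fin.cons i I) x) x) (k : ℕ)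
    (I : Fin k → Fin n) : ContDiff ℝ (⊤ : ℕ∞) (g k I) := by
  refine contDiff_infty.2 fun m => ?_
  induction m generalizing k with
  | zero =>
    exact contDiff_zero.2 (continuous_iff_continuousAt.2 fun x => (h k I x).continuousAt)
  | succ m ih =>
    exact contDiff_succ_iff_hasFDerivAt.2 ⟨_, (covec n).contDiff.comp
      (contDiff_pi.2 fun i => ih (k + 1) (Fin.cons i I)), h k I⟩

lemma dI_cons (i : Fin n) {k : ℕ} (I : Fin k → Fin n) (f : SP n) :
    dI (k + 1) (Fin.cons i I) f = D i (dI k I f) := by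
  rw [dI_succ, Fin.cons_zero, Fin.tail_cons]

/-- Completeness of the space of smooth periodic functions. -/
lemma exists_limit {f : ℕ → SP n} (h : ∀ k I, CauchySeq fun N => toC (dI k I (f N))) :
    ∃ g : SP n, ∀ k I, Filter.Tendsto (fun N => toC (dI k I (f N))) Filter.atTop
      (nhds (toC (dI k I g))) := by
  choose F hF using fun k I => cauchySeq_tendsto_of_complete (h k I)
  have hu : ∀ k I, TendstoUniformly (fun N x => dI k I (f N) x) (fun x => F k I (toTorus x))
      Filter.atTop := fun k I => by
    have := (ContinuousMap.tendsto_iff_tendstoUniformly.1 (hF k I)).comp (toTorus (n := n))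
    simpa only [Function.comp_def, toC_toTorus] using this
  have hd : ∀ k I x, HasFDerivAt (fun x => F k I (toTorus x))
      (covec n fun i => F (k + 1) (Fin.cons i I) (toTorus x)) x := fun k I x => by
    refine hasFDerivAt_of_tendstoUniformly (l := Filter.atTop)
      (f := fun N x => dI k I (f N) x)
      (f' := fun N x => covec n fun i => D i (dI k I (f N)) x)
      (g' := fun x => covec n fun i => F (k + 1) (Fin.cons i I) (toTorus x)) ?_
      (fun N x => hasFDerivAt _ x) (fun x => (hu k I).tendsto_at x) x
    refine (covec n).uniformContinuous.comp_tendstoUniformly ?_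
    refine Metric.tendstoUniformly_iff.2 fun ε hε => ?_
    have := Filter.eventually_all.2 fun i =>
      Metric.tendstoUniformly_iff.1 (hu (k + 1) (Fin.cons i I)) ε hε
    filter_upwards [this] with N hN x
    refine (dist_pi_lt_iff hε).2 fun i => ?_
    rw [← dI_cons]
    exact hN i x
  obtain ⟨g, hg⟩ : ∃ g : SP n, ∀ x, g x = F 0 Fin.elim0 (toTorus x) :=
    ⟨mk _ (contDiff_of_family hd 0 Fin.elim0) fun x m =>
      tendsto_nhds_unique ((hu 0 Fin.elim0).tendsto_at (x + intVec m))
        (((hu 0 Fin.elim0).tendsto_at x).congr fun N => (SP.per _ x m).symm), fun _ => rfl⟩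
  have key : ∀ k (I : Fin k → Fin n) x, dI k I g x = F k I (toTorus x) := fun k => by
    induction k with
    | zero => intro I x; rw [Subsingleton.elim I Fin.elim0]; exact hg x
    | succ k ih =>
      intro I x
      rw [dI_succ, D_apply, funext (ih (Fin.tail I)), (hd k (Fin.tail I) x).fderiv, covec_apply,
        Finset.sum_eq_single (I 0), Fin.cons_self_tail]
      · simp
      · intro i _ hi; simp [hi]
      · simp
  refine ⟨g, fun k I => ?_⟩
  have e : toC (dI k I g) = F k I := ContinuousMap.ext fun t => by
    rw [toC_apply, key, toTorus_rep]
  rw [e]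
  exact hF k I

/-- Convergence in `L²` with bounds for all derivatives implies smooth convergence. -/
lemma tendsto_norm_toC_dI {ι : Type*} {L : Filter ι} {f : ι → SP n}
    (hb : ∀ m, ∃ C, ∀ᶠ i in L, hs m (f i) ≤ C)
    (h0 : Filter.Tendsto (fun i => nsq (f i)) L (nhds 0)) (k : ℕ) (I : Fin k → Fin n) :
    Filter.Tendsto (fun i => ‖toC (dI k I (f i))‖) L (nhds 0) := by
  have h1 : Filter.Tendsto (fun i => hs (k + n) (f i)) L (nhds 0) := by
    obtain ⟨B, hB⟩ := hb (k + n + 1)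
    refine Metric.tendsto_nhds.2 fun η hη => ?_
    obtain ⟨C, hC, H⟩ := hs_interp (n := n) (Nat.lt_succ_self (k + n))
      (ε := η / (2 * (|B| + 1))) (by positivity)
    filter_upwards [hB, h0.eventually_lt_const (show 0 < η / (2 * (C + 1)) by positivity)]
      with i hi hi'
    rw [Real.dist_0_eq_abs, abs_of_nonneg (hs_nonneg _ _)]
    have e1 : η / (2 * (|B| + 1)) * hs (k + n + 1) (f i) ≤ η / 2 := by
      rw [div_mul_eq_mul_div, div_le_div_iff₀ (by positivity) two_pos]
      nlinarith [le_abs_self B]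
    have e2 : C * nsq (f i) < η / 2 := by
      rw [lt_div_iff₀ (by positivity)] at hi'
      nlinarith [nsq_nonneg (f i)]
    linarith [H (f i)]
  obtain ⟨S, hS, HS⟩ := exists_sq_dI_le n (m := k) le_rfl
  have h2 : Filter.Tendsto (fun i => Real.sqrt (S * (nsq (f i) + hs (k + n) (f i)))) L
      (nhds 0) := by
    have := ((h0.add h1).const_mul S).sqrt
    simpa using this
  refine squeeze_zero (fun i => norm_nonneg _) (fun i => ?_) h2
  refine norm_toC_le (Real.sqrt_nonneg _) fun x => Real.abs_le_sqrt ?_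
  have := HS (fun _ : Fin 1 => f i) k le_rfl I 0 x
  simpa [ES, NS, SP.HS] using this

variable [hT : Fact (0 < T)]

lemma Rem.dI {p q : ℕ} {R : ℝ → (Fin l → SP n) → SP n} (h : Rem n l r T p q R) (k : ℕ)
    (I : Fin k → Fin n) : Rem n l r T (p + k) (q + k) fun t v => SP.dI k I (R t v) := by
  induction k with
  | zero => exact h
  | succ k ih => exact (ih (Fin.tail I)).D (I 0)

lemma exists_bound_dI_comp (Ψ : NL n l r T) (k : ℕ) {K : ℝ} (hK : 0 ≤ K) : ∃ C : ℝ, 0 ≤ C ∧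
    ∀ t v, DBound (r + k) K v → ∀ (I : Fin k → Fin n) x, |dI k I (Ψ.comp t v) x| ≤ C := by
  choose C hC H using fun I => ((Rem.base 0 0 Ψ).dI k I).exists_bound hK
  refine ⟨∑ I, C I, Finset.sum_nonneg fun I _ => hC I, fun t v hv I x => ?_⟩
  exact (H I t v (by rwa [zero_add]) x).trans
    (Finset.single_le_sum (fun I _ => hC I) (Finset.mem_univ I))

lemma exists_hs_comp_le (Ψ : NL n l r T) (k : ℕ) {K : ℝ} (hK : 0 ≤ K) : ∃ C : ℝ, 0 ≤ C ∧
    ∀ t v, DBound (r + k) K v → hs k (Ψ.comp t v) ≤ C := by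
  obtain ⟨C, -, H⟩ := exists_bound_dI_comp Ψ k hK
  exact ⟨∑ _I : Fin k → Fin n, C ^ 2, by positivity, fun t v hv =>
    Finset.sum_le_sum fun I _ => nsq_le_sup (H t v hv I)⟩

end SP

open Filter Topology in
/-- Differentiation of limits on a closed interval. -/
lemma hasDerivWithinAt_of_tendstoUniformlyOn_Icc {E : Type*} [NormedAddCommGroup E]
    [NormedSpace ℝ E] {f f' : ℕ → ℝ → E} {g g' : ℝ → E} {a b : ℝ}
    (hf : ∀ N, ∀ t ∈ Set.Icc a b, HasDerivWithinAt (f N) (f' N t) (Set.Icc a b) t)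
    (hf' : TendstoUniformlyOn f' g' atTop (Set.Icc a b)) (hg' : ContinuousOn g' (Set.Icc a b))
    (hg : ∀ t ∈ Set.Icc a b, Tendsto (fun N => f N t) atTop (𝓝 (g t))) {t : ℝ}
    (ht : t ∈ Set.Icc a b) : HasDerivWithinAt g (g' t) (Set.Icc a b) t := by
  refine hasDerivWithinAt_iff_isLittleO.2 (Asymptotics.isLittleO_iff.2 fun c hc => ?_)
  obtain ⟨η, hη, H⟩ := Metric.continuousWithinAt_iff.1 (hg' t ht) (c / 2) (half_pos hc)
  have hN := Metric.tendstoUniformlyOn_iff.1 hf' (c / 2) (half_pos hc)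
  filter_upwards [self_mem_nhdsWithin, mem_nhdsWithin_of_mem_nhds (Metric.ball_mem_nhds t hη)]
    with s hs hsη
  refine le_of_tendsto ((((hg s hs).sub (hg t ht)).sub_const ((s - t) • g' t)).norm) ?_
  filter_upwards [hN] with N hN
  have h1 : ∀ x ∈ Set.Icc a b ∩ Metric.ball t η, HasDerivWithinAt (fun x => f N x - x • g' t)
      (f' N x - (1 : ℝ) • g' t) (Set.Icc a b ∩ Metric.ball t η) x := fun x hx =>
    ((hf N x hx.1).mono Set.inter_subset_left).sub
      ((hasDerivAt_id x).hasDerivWithinAt.smul_const (g' t))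
  have h2 := ((convex_Icc a b).inter (convex_ball t η)).norm_image_sub_le_of_norm_hasDerivWithin_le
    (C := c) h1 (fun x hx => by
      rw [one_smul]
      have e1 := hN x hx.1
      have e2 := H hx.1 hx.2
      rw [dist_comm, dist_eq_norm] at e1
      rw [dist_eq_norm] at e2
      calc ‖f' N x - g' t‖ = ‖(f' N x - g' x) + (g' x - g' t)‖ := by congr 1; abel
        _ ≤ c := (norm_add_le _ _).trans (by linarith))
    ⟨ht, Metric.mem_ball_self hη⟩ ⟨hs, hsη⟩
  have e : f N s - f N t - (s - t) • g' t = f N s - s • g' t - (f N t - t • g' t) := by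
    rw [sub_smul]; abel
  exact e ▸ h2

namespace SP

variable {n l r : ℕ} {T : ℝ}

lemma hs_sub_le (m : ℕ) (f g : SP n) : hs m (f - g) ≤ 2 * hs m f + 2 * hs m g := by
  simp only [hs, Finset.mul_sum, ← Finset.sum_add_distrib, map_sub]
  refine Finset.sum_le_sum fun I _ => ?_
  have := nsq_add_le (dI m I f) (-dI m I g)
  rw [nsq_neg, ← sub_eq_add_neg] at this
  linarith

lemma ES_sub_le (m : ℕ) (v v' : Fin l → SP n) : ES m (v - v') ≤ 2 * ES m v + 2 * ES m v' := by
  have h : ∀ k, HS k (v - v') ≤ 2 * HS k v + 2 * HS k v' := fun k => by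
    simp only [HS, Finset.mul_sum, ← Finset.sum_add_distrib]
    exact Finset.sum_le_sum fun a _ => hs_sub_le k (v a) (v' a)
  have h0 := h 0
  simp only [HS, hs_zero] at h0
  have := h m
  simp only [ES, NS]
  linarith

lemma nsq_le_ES (m : ℕ) (v : Fin l → SP n) (a : Fin l) : nsq (v a) ≤ ES m v :=
  (nsq_le_NS v a).trans (le_add_of_nonneg_right (HS_nonneg m v))

lemma hs_le_ES (m : ℕ) (v : Fin l → SP n) (a : Fin l) : hs m (v a) ≤ ES m v :=
  (hs_le_HS m v a).trans (le_add_of_nonneg_left (NS_nonneg v))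

lemma continuousOn_of_toC {f : ℝ → SP n} {S : Set ℝ} (h : ContinuousOn (fun t => toC (f t)) S) :
    ContinuousOn (fun p : Vec n × ℝ => f p.2 p.1) (Set.univ ×ˢ S) := by
  have hcont : ContinuousOn (fun p : Vec n × ℝ => toC (f p.2)) (Set.univ ×ˢ S) :=
    h.comp continuous_snd.continuousOn fun p hp => hp.2
  have h2 : Continuous (toTorus (n := n)) := isOpenQuotientMap_toTorus.continuous
  have h3 := hcont.eval (h2.comp continuous_fst).continuousOn
  simpa only [Function.comp_def, toC_toTorus] using h3

variable [hT : Fact (0 < T)]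

lemma Rem.contDiffOn {p q : ℕ} {R : ℝ → (Fin l → SP n) → SP n} (h : Rem n l r T p q R)
    {v : ℝ → Fin l → SP n} {S : Set ℝ} (hS : S ⊆ Set.Icc 0 T) {m : ℕ}
    (hv : ∀ (k : ℕ) (I : Fin k → Fin n) b, ContDiffOn ℝ m
      (fun p : Vec n × ℝ => SP.dI k I (v p.2 b) p.1) (Set.univ ×ˢ S)) :
    ContDiffOn ℝ m (fun p : Vec n × ℝ => R p.2 (v p.2) p.1) (Set.univ ×ˢ S) := by
  induction h with
  | base p q Ψ =>
    have h1 : ContDiffOn ℝ m (fun p : Vec n × ℝ => Ψ.toFun (p.1, p.2, jet r (v p.2) p.1))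
        (Set.univ ×ˢ S) :=
      (Ψ.smooth'.of_le (by exact_mod_cast le_top)).comp
        (contDiffOn_fst.prodMk (contDiffOn_snd.prodMk
          (contDiffOn_pi.2 fun k => contDiffOn_pi.2 fun I => contDiffOn_pi.2 fun b => hv k I b)))
        fun p hp => Set.mk_mem_prod (Set.mem_univ _) (Set.mk_mem_prod (hS hp.2) (Set.mem_univ _))
    exact h1.congr fun p hp => by rw [NL.comp_apply, NL.clamp_of_mem (hS hp.2)]
  | add _ _ ih ih' => exact ih.add ih'
  | mul I b _ _ _ ih => exact ih.mul (hv _ I b)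

end SP

section

open Filter Topology

namespace SP

variable {n l r : ℕ} {T : ℝ}

lemma ip_le_of_nsq_le {f g : SP n} {c B B' : ℝ} (hc : 0 < c) (hf : c ^ 2 * nsq f ≤ B)
    (hg : nsq g ≤ B') : |ip f g| ≤ (B + B') * c⁻¹ := by
  refine (abs_ip_le_young f g hc).trans ?_
  have h1 : c * nsq f ≤ B * c⁻¹ := by
    rw [← div_eq_mul_inv, le_div_iff₀ hc]; linarith
  have h2 : 1 / (4 * c) * nsq g ≤ B' * c⁻¹ := by
    rw [← div_eq_mul_inv, one_div_mul_eq_div, div_le_div_iff₀ (by positivity) hc]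
    nlinarith [nsq_nonneg g]
  linarith

lemma nsq_add_lapP_le (h : ℕ) (f : SP n) : nsq (f + lapP h f) ≤ 2 * nsq f + 2 * hs (2 * h) f := by
  have := nsq_add_le f (lapP h f)
  rw [nsq_lapP] at this
  linarith

variable [hT : Fact (0 < T)]

/-- Galerkin approximations with bounds that are uniform in the dimension. -/
structure IsUniformGalerkin (G : Fin l → NL n l r T) (ε δ : ℝ) (v : ℕ → ℝ → Fin l → SP n) :
    Prop where
  galerkin : ∀ N, IsGalerkin G N (v N)
  le : δ ≤ T
  small : ∀ N, ∀ t ∈ Set.Icc 0 δ, JSmall r ε (v N t)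
  bound : ∀ s, ∃ C : ℝ, 0 ≤ C ∧ ∀ N, ∀ t ∈ Set.Icc 0 δ, ES s (v N t) ≤ C

namespace IsUniformGalerkin

variable {G : Fin l → NL n l r T} {ε δ : ℝ} {v : ℕ → ℝ → Fin l → SP n}

lemma exists_dBound (hv : IsUniformGalerkin G ε δ v) (m : ℕ) :
    ∃ K : ℝ, 0 ≤ K ∧ ∀ N, ∀ t ∈ Set.Icc 0 δ, DBound m K (v N t) := by
  obtain ⟨S, hS, HS⟩ := exists_sq_dI_le n (m := m) le_rfl
  obtain ⟨C, -, HC⟩ := hv.bound (m + n)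
  exact ⟨Real.sqrt (S * C), Real.sqrt_nonneg _, fun N t ht k hk I b x =>
    Real.abs_le_sqrt ((HS _ k hk I b x).trans (mul_le_mul_of_nonneg_left (HC N t ht) hS.le))⟩

lemma exists_hs_comp (hv : IsUniformGalerkin G ε δ v) (m : ℕ) :
    ∃ C : ℝ, 0 ≤ C ∧ ∀ N, ∀ t ∈ Set.Icc 0 δ, ∀ a, hs m ((G a).comp t (v N t)) ≤ C := by
  obtain ⟨K, hK, HK⟩ := hv.exists_dBound (r + m)
  choose C hC HC using fun a => exists_hs_comp_le (G a) m hK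
  exact ⟨∑ a, C a, Finset.sum_nonneg fun a _ => hC a, fun N t ht a =>
    (HC a t _ (HK N t ht)).trans (Finset.single_le_sum (fun a _ => hC a) (Finset.mem_univ a))⟩

lemma hasSDeriv (hv : IsUniformGalerkin G ε δ v) (N : ℕ) {t : ℝ} (ht : t ∈ Set.Icc 0 δ)
    (a : Fin l) :
    HasSDeriv (fun τ => v N τ a) (proj N ((G a).comp t (v N t))) (Set.Icc 0 δ) t :=
  ((hv.galerkin N).deriv t ⟨ht.1, ht.2.trans hv.le⟩ a).mono (Set.Icc_subset_Icc_right hv.le)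

end IsUniformGalerkin

namespace IsUniformGalerkin

variable {h : ℕ} {G : Fin l → NL n l (2 * h) T} {ε δ : ℝ} {v : ℕ → ℝ → Fin l → SP n}

/-- Convergence of the Galerkin approximations in the energy norm. -/
lemma exists_ES_sub_le (hv : IsUniformGalerkin G ε δ v) (hδ : 0 ≤ δ) (hG : EnergyEst G ε δ) :
    ∃ C : ℝ, 0 ≤ C ∧ ∀ M N : ℕ, 0 < M → 0 < N → ∀ t ∈ Set.Icc 0 δ,
      ES h (v M t - v N t) ≤ C * ((M : ℝ)⁻¹ + (N : ℝ)⁻¹) := by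
  obtain ⟨C, hC, HC⟩ := hG.2
  obtain ⟨B, hB, HB⟩ := hv.bound (2 * h)
  obtain ⟨B', hB', HB'⟩ := hv.exists_hs_comp 1
  obtain ⟨E, hE⟩ : ∃ E : ℝ, E = 2 * (l * (B' + 16 * B)) := ⟨_, rfl⟩
  have hE0 : 0 ≤ E := by rw [hE]; positivity
  refine ⟨E * (δ * Real.exp (2 * C * δ)), by positivity, fun M N hM hN t ht => ?_⟩
  have hM' : (0 : ℝ) < M := Nat.cast_pos.2 hM
  have hN' : (0 : ℝ) < N := Nat.cast_pos.2 hN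
  have key := le_mul_exp_of_hasDerivWithinAt (C := 2 * C) (D := E * ((M : ℝ)⁻¹ + (N : ℝ)⁻¹))
    (f := fun t => ES h (v M t - v N t))
    (fun s hs => HasSDeriv.ES (v := fun t => v M t - v N t)
      (fun a => (hv.hasSDeriv M hs a).sub (hv.hasSDeriv N hs a)) h)
    (by simp [(hv.galerkin M).zero, (hv.galerkin N).zero, ES, NS, SP.HS, SP.hs, SP.nsq])
    (by positivity) (by positivity) (fun s hs => ?_) ht
  · calc _ ≤ _ := key
      _ = _ := by ring
  · have h1 := HC s hs _ _ (hv.small M s hs) (hv.small N s hs)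
    have h2 : ∀ a, nsq ((v M s - v N s) a + lapP h ((v M s - v N s) a)) ≤ 16 * B := fun a => by
      have e1 := nsq_add_lapP_le h ((v M s - v N s) a)
      have e2 := nsq_le_ES (2 * h) (v M s - v N s) a
      have e3 := hs_le_ES (2 * h) (v M s - v N s) a
      have e4 := ES_sub_le (2 * h) (v M s) (v N s)
      have e5 := HB M s hs
      have e6 := HB N s hs
      linarith
    have h3 : ∀ a, ∀ P : ℕ, 0 < P → |ip ((G a).comp s (v P s) - proj P ((G a).comp s (v P s)))
        ((v M s - v N s) a + lapP h ((v M s - v N s) a))| ≤ (B' + 16 * B) * (P : ℝ)⁻¹ :=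
      fun a P hP => ip_le_of_nsq_le (Nat.cast_pos.2 hP)
        ((nsq_sub_proj_le P _).trans (HB' P s hs a)) (h2 a)
    have h4 : ∑ a, ip (proj M ((G a).comp s (v M s)) - proj N ((G a).comp s (v N s)))
        ((v M s - v N s) a + lapP h ((v M s - v N s) a))
        ≤ ∑ a, ip ((G a).comp s (v M s) - (G a).comp s (v N s))
          ((v M s - v N s) a + lapP h ((v M s - v N s) a))
          + ∑ _a : Fin l, ((B' + 16 * B) * (M : ℝ)⁻¹ + (B' + 16 * B) * (N : ℝ)⁻¹) := by
      rw [← Finset.sum_add_distrib]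
      refine Finset.sum_le_sum fun a _ => ?_
      have e1 := abs_le.1 (h3 a M hM)
      have e2 := abs_le.1 (h3 a N hN)
      simp only [ip_sub_left] at e1 e2 ⊢
      linarith [e1.1, e2.2]
    have h5 : NS (v M s - v N s) ≤ ES h (v M s - v N s) :=
      le_add_of_nonneg_right (HS_nonneg _ _)
    have h6 := mul_le_mul_of_nonneg_left h5 hC
    rw [Finset.sum_const, Finset.card_univ, Fintype.card_fin, nsmul_eq_mul] at h4
    rw [hE]
    calc _ ≤ 2 * (C * ES h (v M s - v N s)
          + l * ((B' + 16 * B) * (M : ℝ)⁻¹ + (B' + 16 * B) * (N : ℝ)⁻¹)) :=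
        mul_le_mul_of_nonneg_left (h4.trans (by linarith)) two_pos.le
      _ = _ := by ring

lemma uniformCauchySeqOn (hv : IsUniformGalerkin G ε δ v) (hδ : 0 ≤ δ) (hG : EnergyEst G ε δ)
    (a : Fin l) (k : ℕ) (I : Fin k → Fin n) :
    UniformCauchySeqOn (fun N t => toC (dI k I (v N t a))) atTop (Set.Icc 0 δ) := by
  obtain ⟨C, hC, H⟩ := hv.exists_ES_sub_le hδ hG
  have h1 := tendsto_norm_toC_dI (L := (atTop ×ˢ atTop) ×ˢ 𝓟 (Set.Icc 0 δ))
    (f := fun p : (ℕ × ℕ) × ℝ => v p.1.1 p.2 a - v p.1.2 p.2 a) (fun m => by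
      obtain ⟨B, -, HB⟩ := hv.bound m
      refine ⟨2 * B + 2 * B, eventually_prod_principal_iff.2 (Eventually.of_forall
        fun p t ht => (hs_sub_le m _ _).trans ?_)⟩
      have e1 := (hs_le_ES m _ a).trans (HB p.1 t ht)
      have e2 := (hs_le_ES m _ a).trans (HB p.2 t ht)
      linarith) (by
      have e1 : Tendsto (fun p : (ℕ × ℕ) × ℝ => C * ((p.1.1 : ℝ)⁻¹ + (p.1.2 : ℝ)⁻¹))
          ((atTop ×ˢ atTop) ×ˢ 𝓟 (Set.Icc 0 δ)) (𝓝 0) := by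
        have e2 : Tendsto (fun N : ℕ => (N : ℝ)⁻¹) atTop (𝓝 0) := tendsto_inv_atTop_nhds_zero_nat
        have e3 := (((e2.comp tendsto_fst).add (e2.comp tendsto_snd)).const_mul C).comp
          (tendsto_fst (f := (atTop : Filter ℕ) ×ˢ (atTop : Filter ℕ)) (g := 𝓟 (Set.Icc 0 δ)))
        simpa only [add_zero, mul_zero, Function.comp_def] using e3
      refine squeeze_zero' (Eventually.of_forall fun _ => nsq_nonneg _)
        (eventually_prod_principal_iff.2 ?_) e1
      filter_upwards [(eventually_gt_atTop 0).prod_mk (eventually_gt_atTop 0)] with p hp t ht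
      exact (nsq_le_ES h (v p.1 t - v p.2 t) a).trans (H p.1 p.2 hp.1 hp.2 t ht)) k I
  intro u hu
  obtain ⟨η, hη, hηu⟩ := Metric.mem_uniformity_dist.1 hu
  have h2 := eventually_prod_principal_iff.1 (h1.eventually_lt_const hη)
  filter_upwards [h2] with p hp t ht
  refine hηu ?_
  have := hp t ht
  simp only [map_sub] at this
  rwa [dist_eq_norm]

end IsUniformGalerkin

end SP

end

section

open Filter Topology

namespace SP

variable {n l r : ℕ} {T : ℝ}

variable [hT : Fact (0 < T)]

/-- Uniform convergence of all spatial derivatives on `[0, δ]`. -/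
def TendstoS (v : ℕ → ℝ → Fin l → SP n) (w : ℝ → Fin l → SP n) (δ : ℝ) : Prop :=
  ∀ a (k : ℕ) (I : Fin k → Fin n), TendstoUniformlyOn (fun N t => toC (dI k I (v N t a)))
    (fun t => toC (dI k I (w t a))) atTop (Set.Icc 0 δ)

namespace TendstoS

variable {v : ℕ → ℝ → Fin l → SP n} {w : ℝ → Fin l → SP n} {δ : ℝ}

omit hT in
lemma apply (hw : TendstoS v w δ) (a : Fin l) {k : ℕ} (I : Fin k → Fin n) {t : ℝ}
    (ht : t ∈ Set.Icc 0 δ) (x : Vec n) :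
    Tendsto (fun N => dI k I (v N t a) x) atTop (𝓝 (dI k I (w t a) x)) := by
  have h := ((ContinuousEvalConst.continuous_eval_const (F := C(UnitAddTorus (Fin n), ℝ))
    (toTorus x)).tendsto _).comp ((hw a k I).tendsto_at ht)
  simpa only [Function.comp_def, toC_toTorus] using h

omit hT in
lemma dBound (hw : TendstoS v w δ) {m : ℕ} {K t : ℝ} (ht : t ∈ Set.Icc 0 δ)
    (h : ∀ N, DBound m K (v N t)) : DBound m K (w t) := fun k hk I b x =>
  le_of_tendsto (hw.apply b I ht x).abs (Eventually.of_forall fun N => h N k hk I b x)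

omit hT in
lemma jSmall (hw : TendstoS v w δ) {ε t : ℝ} (ht : t ∈ Set.Icc 0 δ)
    (h : ∀ N, JSmall r ε (v N t)) : JSmall r ε (w t) := fun x =>
  le_of_tendsto (f := fun N => ‖jet r (v N t) x‖) (Tendsto.norm (tendsto_pi_nhds.2 fun _ =>
    tendsto_pi_nhds.2 fun I => tendsto_pi_nhds.2 fun b => hw.apply b I ht x))
    (Eventually.of_forall fun N => h N x)

omit hT in
lemma norm_sub (hw : TendstoS v w δ) (a : Fin l) {k : ℕ} (I : Fin k → Fin n) :
    Tendsto (fun p : ℕ × ℝ => ‖toC (dI k I (v p.1 p.2 a - w p.2 a))‖)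
      (atTop ×ˢ 𝓟 (Set.Icc 0 δ)) (𝓝 0) := by
  have h := tendstoUniformlyOn_iff_tendsto.1 (hw a k I)
  have h1 := (tendsto_uniformity_iff_dist_tendsto_zero.1 h)
  refine h1.congr fun p => ?_
  rw [dist_comm, dist_eq_norm, map_sub, map_sub]

end TendstoS

namespace IsUniformGalerkin

section

variable {h : ℕ} {G : Fin l → NL n l (2 * h) T} {ε δ : ℝ} {v : ℕ → ℝ → Fin l → SP n}

lemma exists_tendstoS (hv : IsUniformGalerkin G ε δ v) (hδ : 0 ≤ δ) (hG : EnergyEst G ε δ) :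
    ∃ w, TendstoS v w δ := by
  have h1 : ∀ t a, ∃ g : SP n, t ∈ Set.Icc 0 δ → ∀ k I,
      Tendsto (fun N => toC (dI k I (v N t a))) atTop (𝓝 (toC (dI k I g))) := fun t a => by
    by_cases ht : t ∈ Set.Icc 0 δ
    · obtain ⟨g, hg⟩ := exists_limit (f := fun N => v N t a) fun k I =>
        (hv.uniformCauchySeqOn hδ hG a k I).cauchySeq ht
      exact ⟨g, fun _ => hg⟩
    · exact ⟨0, fun h => absurd h ht⟩
  choose w hw using h1
  exact ⟨w, fun a k I => (hv.uniformCauchySeqOn hδ hG a k I).tendstoUniformlyOn_of_tendsto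
    fun t ht => hw t a ht k I⟩

end

variable {G : Fin l → NL n l r T} {ε δ : ℝ} {v : ℕ → ℝ → Fin l → SP n} {w : ℝ → Fin l → SP n}

lemma tendsto_nsq_comp_sub (hv : IsUniformGalerkin G ε δ v) (hw : TendstoS v w δ) (a : Fin l) :
    Tendsto (fun p : ℕ × ℝ => nsq ((G a).comp p.2 (v p.1 p.2) - (G a).comp p.2 (w p.2)))
      (atTop ×ˢ 𝓟 (Set.Icc 0 δ)) (𝓝 0) := by
  obtain ⟨L, hL, HL⟩ := (G a).exists_lipschitz ε
  have h1 : Tendsto (fun p : ℕ × ℝ =>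
      (L * ∑ c : JIdx n l r, ‖toC (dI c.1 c.2.1 (v p.1 p.2 c.2.2 - w p.2 c.2.2))‖) ^ 2)
      (atTop ×ˢ 𝓟 (Set.Icc 0 δ)) (𝓝 0) := by
    have := ((tendsto_finsetSum Finset.univ fun c (_ : c ∈ Finset.univ) =>
      hw.norm_sub c.2.2 c.2.1 (k := (c : JIdx n l r).1)).const_mul L).pow 2
    simpa only [Finset.sum_const_zero, mul_zero, ne_eq, OfNat.ofNat_ne_zero, not_false_eq_true,
      zero_pow] using this
  refine squeeze_zero' (Eventually.of_forall fun _ => nsq_nonneg _)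
    (eventually_prod_principal_iff.2 (Eventually.of_forall fun N t ht => ?_)) h1
  refine nsq_le_sup fun x => ?_
  refine (HL t _ _ x (hv.small N t ht x) (hw.jSmall ht (fun N => hv.small N t ht) x)).trans ?_
  exact mul_le_mul_of_nonneg_left (Finset.sum_le_sum fun c _ => abs_le_norm_toC _ x) hL

lemma tendsto_norm_rhs (hv : IsUniformGalerkin G ε δ v) (hw : TendstoS v w δ) (a : Fin l)
    {k : ℕ} (I : Fin k → Fin n) :
    Tendsto (fun p : ℕ × ℝ => ‖toC (dI k I (proj p.1 ((G a).comp p.2 (v p.1 p.2))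
      - (G a).comp p.2 (w p.2)))‖) (atTop ×ˢ 𝓟 (Set.Icc 0 δ)) (𝓝 0) := by
  refine tendsto_norm_toC_dI (fun m => ?_) ?_ k I
  · obtain ⟨K, hK, HK⟩ := hv.exists_dBound (r + m)
    obtain ⟨C, hC, HC⟩ := exists_hs_comp_le (G a) m hK
    refine ⟨2 * C + 2 * C, eventually_prod_principal_iff.2 (Eventually.of_forall
      fun N t ht => (hs_sub_le m _ _).trans ?_)⟩
    have e1 := (hs_proj_le m N ((G a).comp t (v N t))).trans (HC t _ (HK N t ht))
    have e2 := HC t _ (hw.dBound ht fun N => HK N t ht)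
    linarith
  · obtain ⟨B, hB, HB⟩ := hv.exists_hs_comp 1
    have h1 : Tendsto (fun p : ℕ × ℝ => 2 * nsq ((G a).comp p.2 (v p.1 p.2)
        - (G a).comp p.2 (w p.2)) + 2 * (B * ((p.1 : ℝ)⁻¹) ^ 2))
        (atTop ×ˢ 𝓟 (Set.Icc 0 δ)) (𝓝 0) := by
      have e2 : Tendsto (fun N : ℕ => (N : ℝ)⁻¹) atTop (𝓝 0) := tendsto_inv_atTop_nhds_zero_nat
      have e3 := ((hv.tendsto_nsq_comp_sub hw a).const_mul 2).add
        ((((e2.comp (tendsto_fst (g := 𝓟 (Set.Icc 0 δ)))).pow 2).const_mul B).const_mul 2)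
      simpa using e3
    refine squeeze_zero' (Eventually.of_forall fun _ => nsq_nonneg _)
      (eventually_prod_principal_iff.2 ?_) h1
    filter_upwards [eventually_gt_atTop 0] with N hN t ht
    have hN' : (0 : ℝ) < N := Nat.cast_pos.2 hN
    obtain ⟨f, hf⟩ : ∃ f, f = (G a).comp t (v N t) := ⟨_, rfl⟩
    obtain ⟨g, hg⟩ : ∃ g, g = (G a).comp t (w t) := ⟨_, rfl⟩
    have e1 := nsq_add_le (f - g) (-(f - proj N f))
    rw [nsq_neg, show f - g + -(f - proj N f) = proj N f - g by ring] at e1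
    have e2 : nsq (f - proj N f) ≤ B * ((N : ℝ)⁻¹) ^ 2 := by
      rw [inv_pow, ← div_eq_mul_inv, le_div_iff₀ (by positivity), mul_comm]
      exact (nsq_sub_proj_le N f).trans (hf ▸ HB N t ht a)
    simp only [← hf, ← hg]
    linarith

lemma continuousOn_limit (hv : IsUniformGalerkin G ε δ v) (hw : TendstoS v w δ) (a : Fin l)
    {k : ℕ} (I : Fin k → Fin n) :
    ContinuousOn (fun t => toC (dI k I (w t a))) (Set.Icc 0 δ) :=
  (hw a k I).continuousOn (Frequently.of_forall fun N _ ht =>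
    (hv.hasSDeriv N ht a k I).continuousWithinAt)

/-- The limit of the Galerkin approximations solves the equation. -/
lemma hasSDeriv_limit (hv : IsUniformGalerkin G ε δ v) (hw : TendstoS v w δ) (a : Fin l)
    {t : ℝ} (ht : t ∈ Set.Icc 0 δ) :
    HasSDeriv (fun τ => w τ a) ((G a).comp t (w t)) (Set.Icc 0 δ) t := fun k I => by
  have hc : ContinuousOn (fun t => toC (dI k I ((G a).comp t (w t)))) (Set.Icc 0 δ) := by
    refine continuousOn_toC (f := fun t => dI k I ((G a).comp t (w t))) ?_
    have := ((Rem.base 0 0 (G a)).dI k I).contDiffOn (m := 0) (v := w)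
      (Set.Icc_subset_Icc_right hv.le) fun k I b => by
        simpa using continuousOn_of_toC (hv.continuousOn_limit hw b I)
    exact this.continuousOn
  refine hasDerivWithinAt_of_tendstoUniformlyOn_Icc
    (f' := fun N t => toC (dI k I (proj N ((G a).comp t (v N t)))))
    (fun N t ht => hv.hasSDeriv N ht a k I) ?_ hc (fun _ ht => (hw a k I).tendsto_at ht) ht
  refine tendstoUniformlyOn_iff_tendsto.2 (tendsto_uniformity_iff_dist_tendsto_zero.2 ?_)
  refine (hv.tendsto_norm_rhs hw a I).congr fun p => ?_
  rw [dist_comm, dist_eq_norm, map_sub, map_sub]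

lemma limit_zero (hv : IsUniformGalerkin G ε δ v) (hδ : 0 ≤ δ) (hw : TendstoS v w δ) :
    w 0 = 0 := by
  funext a
  ext x
  have h := hw.apply a Fin.elim0 (Set.left_mem_Icc.2 hδ) x
  refine tendsto_nhds_unique h (tendsto_const_nhds.congr fun N => ?_)
  rw [(hv.galerkin N).zero]
  rfl

end IsUniformGalerkin

omit hT in
lemma JSmall.mono {ε ε' : ℝ} {v : Fin l → SP n} (h : JSmall r ε v) (hε : ε ≤ ε') :
    JSmall r ε' v := fun x => (h x).trans hε

lemma EnergyEst.mono {h : ℕ} {G : Fin l → NL n l (2 * h) T} {ε ε' δ : ℝ} (hG : EnergyEst G ε δ)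
    (hε : ε' ≤ ε) : EnergyEst G ε' δ := by
  refine ⟨fun p s K hp hK => ?_, ?_⟩
  · obtain ⟨C, hC, H⟩ := hG.1 p s K hp hK
    exact ⟨C, hC, fun t ht v hv => H t ht v (hv.mono hε)⟩
  · obtain ⟨C, hC, H⟩ := hG.2
    exact ⟨C, hC, fun t ht v v' hv hv' => H t ht v v' (hv.mono hε) (hv'.mono hε)⟩

/-- Short-time existence for the evolution equation with zero initial value. -/
theorem EnergyEst.exists_solution {h : ℕ} {G : Fin l → NL n l (2 * h) T} {ε δ M : ℝ} (hε : 0 < ε)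
    (hδ : 0 < δ) (hδT : δ ≤ T) (hG : EnergyEst G ε δ)
    (hM : ∀ a t v x, |(G a).comp t v x| ≤ M) :
    ∃ δ', 0 < δ' ∧ δ' ≤ δ ∧ ∃ w : ℝ → Fin l → SP n, w 0 = 0 ∧
      (∀ t ∈ Set.Icc 0 δ', JSmall (2 * h) ε (w t)) ∧
      ∀ t ∈ Set.Icc 0 δ', ∀ a,
        HasSDeriv (fun τ => w τ a) ((G a).comp t (w t)) (Set.Icc 0 δ') t := by
  obtain ⟨δ', h0, hle, hs, hb⟩ := hG.exists_uniform hε hδ hδT hM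
  choose v hv using fun N => exists_isGalerkin G hM N
  have hu : IsUniformGalerkin G ε δ' v :=
    ⟨hv, hle.trans hδT, fun N t ht => hs N _ (hv N) t ht, fun s => by
      obtain ⟨C, hC, H⟩ := hb s
      exact ⟨C, hC, fun N t ht => H N _ (hv N) t ht⟩⟩
  have hG' : EnergyEst G ε δ' := by
    refine ⟨fun p s K hp hK => ?_, ?_⟩
    · obtain ⟨C, hC, H⟩ := hG.1 p s K hp hK
      exact ⟨C, hC, fun t ht => H t (Set.Icc_subset_Icc_right hle ht)⟩
    · obtain ⟨C, hC, H⟩ := hG.2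
      exact ⟨C, hC, fun t ht => H t (Set.Icc_subset_Icc_right hle ht)⟩
  obtain ⟨w, hw⟩ := hu.exists_tendstoS h0.le hG'
  exact ⟨δ', h0, hle, w, hu.limit_zero h0.le hw,
    fun t ht => hw.jSmall ht fun N => hu.small N t ht, fun t ht a => hu.hasSDeriv_limit hw a ht⟩

end SP

end

section

open Filter Topology

namespace SP

variable {n l r : ℕ} {T : ℝ}

/-- A curve of smooth periodic functions, differentiable in the uniform sense, is differentiable
as a function of space and time. -/
lemma HasSDeriv.hasFDerivWithinAt {f : ℝ → SP n} {g : SP n} {S : Set ℝ} {t : ℝ}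
    (h : HasSDeriv f g S t) (x : Vec n) :
    HasFDerivWithinAt (fun p : Vec n × ℝ => f p.2 p.1)
      ((covec n fun i => SP.D i (f t) x).comp (ContinuousLinearMap.fst ℝ (Vec n) ℝ)
        + g x • ContinuousLinearMap.snd ℝ (Vec n) ℝ) (Set.univ ×ˢ S) (x, t) := by
  have h1 : HasFDerivWithinAt (fun p : Vec n × ℝ => f t p.1)
      ((covec n fun i => SP.D i (f t) x).comp (ContinuousLinearMap.fst ℝ (Vec n) ℝ))
      (Set.univ ×ˢ S) (x, t) :=
    ((SP.hasFDerivAt (f t) x).comp (x, t) hasFDerivAt_fst).hasFDerivWithinAt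
  have h2 : HasFDerivWithinAt (fun p : Vec n × ℝ => f p.2 p.1 - f t p.1)
      (g x • ContinuousLinearMap.snd ℝ (Vec n) ℝ) (Set.univ ×ˢ S) (x, t) := by
    have hsnd : Tendsto (fun p : Vec n × ℝ => p.2) (𝓝[Set.univ ×ˢ S] (x, t)) (𝓝[S] t) := by
      rw [nhdsWithin_prod_eq]; exact tendsto_snd
    have hO : (fun p : Vec n × ℝ => p.2 - t) =O[𝓝[Set.univ ×ˢ S] (x, t)]
        fun p => p - (x, t) := Asymptotics.isBigO_of_le _ fun p => norm_snd_le (p - (x, t))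
    have e1 := (hasDerivWithinAt_iff_isLittleO.1 h.toC).comp_tendsto hsnd
    have e2 : (fun p : Vec n × ℝ => f p.2 p.1 - f t p.1 - (p.2 - t) * g p.1)
        =o[𝓝[Set.univ ×ˢ S] (x, t)] fun p => p.2 - t := by
      refine (Asymptotics.IsBigO.of_bound 1 (Eventually.of_forall fun p => ?_)).trans_isLittleO e1
      rw [one_mul, Real.norm_eq_abs, ← toC_toTorus (f p.2), ← toC_toTorus (f t), ← toC_toTorus g]
      exact (SP.toC (f p.2) - SP.toC (f t) - (p.2 - t) • SP.toC g).norm_coe_le_norm (toTorus p.1)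
    have e3 : (fun p : Vec n × ℝ => (p.2 - t) * (g p.1 - g x))
        =o[𝓝[Set.univ ×ˢ S] (x, t)] fun p => p.2 - t := by
      have : (fun p : Vec n × ℝ => g p.1 - g x) =o[𝓝[Set.univ ×ˢ S] (x, t)]
          fun _ => (1 : ℝ) := by
        rw [Asymptotics.isLittleO_one_iff]
        have hc : Continuous fun p : Vec n × ℝ => g p.1 - g x :=
          ((SP.cont g).comp continuous_fst).sub continuous_const
        have := hc.tendsto (x, t)
        rw [sub_self] at this
        exact this.mono_left nhdsWithin_le_nhds
      simpa using (Asymptotics.isBigO_refl (fun p : Vec n × ℝ => p.2 - t) _).mul_isLittleO this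
    refine HasFDerivWithinAt.of_isLittleO (((e2.add e3).trans_isBigO hO).congr_left fun p => ?_)
    simp only [sub_self, sub_zero, _root_.smul_apply, ContinuousLinearMap.coe_snd',
      Prod.snd_sub, smul_eq_mul]
    ring
  refine (h1.add h2).congr_of_eventuallyEq (Eventually.of_forall fun p => ?_) ?_ <;>
    simp

variable [hT : Fact (0 < T)]

/-- Solutions of the evolution equation are smooth in space and time. -/
lemma contDiffOn_of_hasSDeriv {G : Fin l → NL n l r T} {δ : ℝ} (hδ : 0 < δ) (hδT : δ ≤ T)
    {w : ℝ → Fin l → SP n} (hw : ∀ t ∈ Set.Icc 0 δ, ∀ a,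
      HasSDeriv (fun τ => w τ a) ((G a).comp t (w t)) (Set.Icc 0 δ) t) (m : ℕ) :
    ∀ (k : ℕ) (I : Fin k → Fin n) (a : Fin l),
      ContDiffOn ℝ m (fun p : Vec n × ℝ => SP.dI k I (w p.2 a) p.1)
        (Set.univ ×ˢ Set.Icc 0 δ) := by
  induction m with
  | zero =>
    intro k I a
    simpa using continuousOn_of_toC fun t ht => (hw t ht a k I).continuousWithinAt
  | succ m ih =>
    intro k I a
    have hU : UniqueDiffOn ℝ ((Set.univ : Set (Vec n)) ×ˢ Set.Icc 0 δ) :=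
      uniqueDiffOn_univ.prod (uniqueDiffOn_Icc hδ)
    have hcomp := ((Rem.base 0 0 (G a)).dI k I).contDiffOn (v := w)
      (Set.Icc_subset_Icc_right hδT) (m := m) fun k I b => ih k I b
    have h1 : ContDiffOn ℝ m
        (fun p : Vec n × ℝ => covec n fun i => SP.D i (SP.dI k I (w p.2 a)) p.1)
        (Set.univ ×ˢ Set.Icc 0 δ) :=
      (covec n).contDiff.comp_contDiffOn (contDiffOn_pi.2 fun i => by
        simp only [← dI_cons]; exact ih (k + 1) (Fin.cons i I) a)
    push_cast
    refine (contDiffOn_succ_iff_hasFDerivWithinAt_of_uniqueDiffOn hU).2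
      ⟨by simp, fun p => (covec n fun i => SP.D i (SP.dI k I (w p.2 a)) p.1).comp
        (ContinuousLinearMap.fst ℝ (Vec n) ℝ) + SP.dI k I ((G a).comp p.2 (w p.2)) p.1 •
        ContinuousLinearMap.snd ℝ (Vec n) ℝ, ?_, ?_⟩
    · exact (h1.clm_comp contDiffOn_const).add (hcomp.smul contDiffOn_const)
    · rintro ⟨x, t⟩ ⟨-, ht⟩
      exact ((hw t ht a).dI k I).hasFDerivWithinAt x

end SP

end

section

open Filter Topology

/-- A continuous function which starts at zero and vanishes as long as it stays small vanishes. -/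
lemma eq_zero_of_small {φ : ℝ → ℝ} {b e : ℝ} (he : 0 < e) (hφ : ContinuousOn φ (Set.Icc 0 b))
    (h0 : φ 0 = 0) (h : ∀ t ∈ Set.Icc 0 b, (∀ s ∈ Set.Icc 0 t, φ s ≤ e) → φ t = 0) {t : ℝ}
    (ht : t ∈ Set.Icc 0 b) : φ t = 0 := by
  refine h t ht fun s hs => not_lt.1 fun hlt => ?_
  have hK : IsCompact (Set.Icc 0 b ∩ φ ⁻¹' {e}) :=
    isCompact_Icc.of_isClosed_subset (hφ.preimage_isClosed_of_isClosed isClosed_Icc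
      isClosed_singleton) Set.inter_subset_left
  have cross : ∀ s ∈ Set.Icc 0 b, e < φ s → ∃ c ∈ Set.Icc 0 s, φ c = e := fun s hs hes =>
    intermediate_value_Icc hs.1 (hφ.mono (Set.Icc_subset_Icc_right hs.2))
      ⟨h0.trans_le he.le, hes.le⟩
  have hsb : s ∈ Set.Icc 0 b := ⟨hs.1, hs.2.trans ht.2⟩
  obtain ⟨c, hc, hce⟩ := cross s hsb hlt
  obtain ⟨m, ⟨hm, hme⟩, hmin⟩ := hK.exists_isLeast ⟨c, ⟨hc.1, hc.2.trans hsb.2⟩, hce⟩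
  have := h m hm fun x hx => not_lt.1 fun hx' => by
    obtain ⟨y, hy, hye⟩ := cross x ⟨hx.1, hx.2.trans hm.2⟩ hx'
    have h1 : m ≤ y := hmin ⟨⟨hy.1, (hy.2.trans hx.2).trans hm.2⟩, hye⟩
    have h2 : x = m := le_antisymm hx.2 (h1.trans hy.2)
    rw [h2] at hx'
    exact hx'.ne' hme
  exact he.ne' (hme.symm.trans this)

namespace SP

variable {n l r : ℕ} {T : ℝ}

lemma eq_zero_of_nsq {f : SP n} (h : nsq f = 0) : f = 0 := by
  obtain ⟨C, hC, H⟩ := sobolev n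
  have h1 : hs n f = 0 := by
    refine le_antisymm (le_of_forall_pos_le_add fun ε hε => ?_) (hs_nonneg n f)
    have hp : 0 < hs (n + 1) f + 1 := by linarith [hs_nonneg (n + 1) f]
    obtain ⟨D, -, HD⟩ := hs_interp (n := n) (Nat.lt_succ_self n) (div_pos hε hp)
    have h2 := HD f
    rw [h, mul_zero, add_zero] at h2
    refine h2.trans ?_
    rw [zero_add, div_mul_eq_mul_div, div_le_iff₀ hp]
    nlinarith
  ext x
  have h2 := H f x
  rw [h, h1, add_zero, mul_zero] at h2
  exact pow_eq_zero_iff two_ne_zero |>.1 (le_antisymm h2 (sq_nonneg _))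

lemma eq_zero_of_ES {m : ℕ} {v : Fin l → SP n} (h : ES m v = 0) : v = 0 := by
  have h1 : NS v = 0 := le_antisymm
    (by linarith [HS_nonneg m v, show ES m v = NS v + HS m v from rfl])
    (NS_nonneg v)
  funext a
  exact eq_zero_of_nsq ((Finset.sum_eq_zero_iff_of_nonneg fun b _ => nsq_nonneg (v b)).1 h1 a
    (Finset.mem_univ a))

variable [hT : Fact (0 < T)]

/-- Two small curves solving the evolution equation with the same initial value agree. -/
lemma EnergyEst.eq_of_small {h : ℕ} {G : Fin l → NL n l (2 * h) T} {ε δ b : ℝ}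
    (hG : EnergyEst G ε δ) (hb : b ≤ δ) {w v : ℝ → Fin l → SP n}
    (h0 : v 0 = w 0) (hw : ∀ t ∈ Set.Icc 0 b, JSmall (2 * h) ε (w t))
    (hv : ∀ t ∈ Set.Icc 0 b, JSmall (2 * h) ε (v t))
    (hw' : ∀ t ∈ Set.Icc 0 b, ∀ a,
      HasSDeriv (fun τ => w τ a) ((G a).comp t (w t)) (Set.Icc 0 b) t)
    (hv' : ∀ t ∈ Set.Icc 0 b, ∀ a,
      HasSDeriv (fun τ => v τ a) ((G a).comp t (v t)) (Set.Icc 0 b) t) {t : ℝ}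
    (ht : t ∈ Set.Icc 0 b) : v t = w t := by
  obtain ⟨C, hC, H⟩ := hG.2
  have h1 : ∀ t ∈ Set.Icc 0 b, HasDerivWithinAt (fun τ => SP.ES h (v τ - w τ))
      (2 * ∑ a, ip ((G a).comp t (v t) - (G a).comp t (w t))
        ((v t - w t) a + lapP h ((v t - w t) a))) (Set.Icc 0 b) t := fun t ht =>
    HasSDeriv.ES (v := fun τ => v τ - w τ) (fun a => (hv' t ht a).sub (hw' t ht a)) h
  have h2 := le_mul_exp_of_hasDerivWithinAt (C := 2 * C) (D := 0) h1
    (by rw [h0, sub_self]; simp [SP.ES, NS, SP.HS, SP.hs, SP.nsq]) (by positivity) le_rfl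
    (fun s hs => by
      have e1 := H s ⟨hs.1, hs.2.trans hb⟩ _ _ (hv s hs) (hw s hs)
      have e2 := mul_nonneg hC (HS_nonneg h (v s - w s))
      have e3 : SP.ES h (v s - w s) = NS (v s - w s) + SP.HS h (v s - w s) := rfl
      rw [e3]
      linarith) ht
  rw [zero_mul] at h2
  exact sub_eq_zero.1 (eq_zero_of_ES (le_antisymm h2 (SP.ES_nonneg h _)))

/-- Uniqueness: a small solution of the evolution equation agrees with every curve with the same
initial value that satisfies the equation as long as its jet is small. -/
theorem EnergyEst.unique {h : ℕ} {G : Fin l → NL n l (2 * h) T} {ε δ b : ℝ} (hε : 0 < ε)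
    (hG : EnergyEst G ε δ) (hb : b ≤ δ) {w v : ℝ → Fin l → SP n} {g : ℝ → Fin l → SP n}
    (h0 : v 0 = w 0) (hw : ∀ t ∈ Set.Icc 0 b, JSmall (2 * h) (ε / 2) (w t))
    (hw' : ∀ t ∈ Set.Icc 0 b, ∀ a,
      HasSDeriv (fun τ => w τ a) ((G a).comp t (w t)) (Set.Icc 0 b) t)
    (hv' : ∀ t ∈ Set.Icc 0 b, ∀ a, HasSDeriv (fun τ => v τ a) (g t a) (Set.Icc 0 b) t)
    (hg : ∀ t ∈ Set.Icc 0 b, JSmall (2 * h) ε (v t) → ∀ a, g t a = (G a).comp t (v t)) {t : ℝ}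
    (ht : t ∈ Set.Icc 0 b) : v t = w t := by
  obtain ⟨φ, hφ⟩ : ∃ φ : ℝ → ℝ, φ = fun t =>
    ∑ c : JIdx n l (2 * h), ‖toC (dI c.1 c.2.1 (v t c.2.2 - w t c.2.2))‖ +
      ∑ a, ‖toC (v t a - w t a)‖ := ⟨_, rfl⟩
  have hcont : ∀ (k : ℕ) (I : Fin k → Fin n) a,
      ContinuousOn (fun t => toC (dI k I (v t a - w t a))) (Set.Icc 0 b) := fun k I a t ht =>
    (((hv' t ht a).sub (hw' t ht a)) k I).continuousWithinAt
  have key : ∀ t ∈ Set.Icc 0 b, φ t = 0 := fun t ht => by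
    refine eq_zero_of_small (half_pos hε) ?_ ?_ (fun t ht hs => ?_) ht
    · rw [hφ]
      exact (continuousOn_finsetSum _ fun c _ => (hcont _ _ _).norm).add
        (continuousOn_finsetSum _ fun a _ => (hcont 0 Fin.elim0 a).norm)
    · simp [hφ, h0]
    · have hsm : ∀ s ∈ Set.Icc 0 t, JSmall (2 * h) ε (v s) := fun s hs' x => by
        have h1 : ‖jet (2 * h) (v s) x - jet (2 * h) (w s) x‖ ≤ ε / 2 := by
          refine Jet.norm_le (half_pos hε).le fun c => le_trans ?_ (hs s hs')
          have e1 : |dI c.1 c.2.1 (v s c.2.2 - w s c.2.2) x|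
              ≤ ‖toC (dI c.1 c.2.1 (v s c.2.2 - w s c.2.2))‖ := abs_le_norm_toC _ x
          rw [map_sub, SP.sub_apply] at e1
          refine e1.trans ?_
          rw [← map_sub, hφ]
          have e2 := Finset.single_le_sum (f := fun c : JIdx n l (2 * h) =>
            ‖toC (dI c.1 c.2.1 (v s c.2.2 - w s c.2.2))‖) (fun _ _ => norm_nonneg _)
            (Finset.mem_univ c)
          have e3 : 0 ≤ ∑ a, ‖toC (v s a - w s a)‖ := Finset.sum_nonneg fun _ _ => norm_nonneg _
          exact e2.trans (le_add_of_nonneg_right e3)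
        have h2 := hw s ⟨hs'.1, hs'.2.trans ht.2⟩ x
        have h3 := norm_sub_norm_le (jet (2 * h) (v s) x) (jet (2 * h) (w s) x)
        linarith
      have hsub : Set.Icc 0 t ⊆ Set.Icc 0 b := Set.Icc_subset_Icc_right ht.2
      have := hG.eq_of_small (ht.2.trans hb) h0
        (fun s hs => (hw s (hsub hs)).mono (half_le_self hε.le)) hsm
        (fun s hs a => (hw' s (hsub hs) a).mono hsub)
        (fun s hs a => hg s (hsub hs) (hsm s hs) a ▸ (hv' s (hsub hs) a).mono hsub)
        (Set.right_mem_Icc.2 ht.1)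
      simp [hφ, this]
  have h1 := key t ht
  rw [hφ] at h1
  have h2 : ∑ a, ‖toC (v t a - w t a)‖ = 0 := le_antisymm
    (by rw [← h1]; exact le_add_of_nonneg_left (Finset.sum_nonneg fun _ _ => norm_nonneg _))
    (Finset.sum_nonneg fun _ _ => norm_nonneg _)
  funext a
  have h3 := (Finset.sum_eq_zero_iff_of_nonneg fun _ _ => norm_nonneg _).1 h2 a (Finset.mem_univ a)
  rw [norm_eq_zero] at h3
  ext x
  have h4 := congrArg (fun q => q (toTorus x)) h3
  simp only [toC_toTorus] at h4
  exact sub_eq_zero.1 h4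

end SP

end

namespace NL

open SP

variable {n : ℕ} {δ : ℝ}

section

variable {l r : ℕ}

lemma dir_comm [hδ : Fact (0 < δ)] (Ψ : NL n l r δ) (e e' : Vec n × ℝ × Jet n l r)
    {q : Vec n × ℝ × Jet n l r} (hq : q ∈ NLdom n l r δ) :
    ((Ψ.dir e).dir e').toFun q = ((Ψ.dir e').dir e).toFun q := by
  have hd : DifferentiableWithinAt ℝ (fderivWithin ℝ Ψ.toFun (NLdom n l r δ)) (NLdom n l r δ) q :=
    (Ψ.smooth'.fderivWithin uniqueDiffOn_dom (m := (⊤ : ℕ∞))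
      (by simp)).differentiableOn (by simp) q hq
  have h1 : ∀ e e', ((Ψ.dir e).dir e').toFun q =
      fderivWithin ℝ (fderivWithin ℝ Ψ.toFun (NLdom n l r δ)) (NLdom n l r δ) q e' e :=
    fun e e' => by
      change fderivWithin ℝ (fun q => fderivWithin ℝ Ψ.toFun (NLdom n l r δ) q e) _ q e' = _
      rw [fderivWithin_clm_apply (uniqueDiffOn_dom q hq) hd (differentiableWithinAt_const e)]
      simp
  have hcl : q ∈ closure (interior (NLdom n l r δ)) := by
    rw [NLdom, interior_prod_eq, interior_prod_eq, closure_prod_eq, closure_prod_eq,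
      interior_univ, interior_univ, interior_Icc, closure_Ioo hδ.out.ne, closure_univ,
      closure_univ]
    exact hq
  rw [h1, h1]
  exact (contDiffOn_infty.1 Ψ.smooth' 2 q hq).isSymmSndFDerivWithinAt
    (by simp) uniqueDiffOn_dom hcl hq e' e

end

/-- The slice of a function of `(x,t)` at a fixed time. -/
def slice (U : NL n 0 0 δ) [Fact (0 < δ)] (t : ℝ) : SP n := U.comp t 0

variable [hδ : Fact (0 < δ)] (U : NL n 0 0 δ)

lemma slice_apply {t : ℝ} (ht : t ∈ Set.Icc 0 δ) (x : Vec n) : U.slice t x = U.toFun (x, t, 0) := by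
  rw [slice, comp_apply, clamp_of_mem ht]
  congr 3
  exact Subsingleton.elim _ _

lemma slice_congr {V : NL n 0 0 δ} (h : ∀ q ∈ NLdom n 0 0 δ, U.toFun q = V.toFun q) (t : ℝ) :
    U.slice t = V.slice t := by
  ext x
  exact h _ ⟨trivial, clamp_mem t, trivial⟩

lemma D_slice (i : Fin n) (t : ℝ) : D i (U.slice t) = (U.dX i).slice t := by
  rw [slice, D_comp, slice, Finset.sum_eq_zero fun c _ => c.2.2.elim0, add_zero]

/-- Iterated spatial derivatives. -/
def dXs (U : NL n 0 0 δ) : (k : ℕ) → (Fin k → Fin n) → NL n 0 0 δ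
  | 0, _ => U
  | k + 1, I => (dXs U k (Fin.tail I)).dX (I 0)

/-- The time derivative. -/
def dT : NL n 0 0 δ := U.dir (0, 1, 0)

lemma dI_slice (k : ℕ) (I : Fin k → Fin n) (t : ℝ) :
    dI k I (U.slice t) = (U.dXs k I).slice t := by
  induction k with
  | zero => rfl
  | succ k ih => rw [dI_succ, ih, D_slice]; rfl

lemma slice_dT_dXs (k : ℕ) (I : Fin k → Fin n) (t : ℝ) :
    (U.dXs k I).dT.slice t = (U.dT.dXs k I).slice t := by
  induction k with
  | zero => rfl
  | succ k ih =>
    change ((U.dXs k (Fin.tail I)).dX (I 0)).dT.slice t =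
      ((U.dT.dXs k (Fin.tail I)).dX (I 0)).slice t
    rw [← D_slice, ← ih, D_slice]
    exact slice_congr _ (fun q hq => dir_comm _ _ _ hq) t

lemma hasDerivWithinAt_slice {t : ℝ} (ht : t ∈ Set.Icc 0 δ) :
    HasDerivWithinAt (fun τ => toC (U.slice τ)) (toC (U.dT.slice t)) (Set.Icc 0 δ) t := by
  refine hasDerivWithinAt_of_pointwise (f' := fun t => toC (U.dT.slice t))
    (U.dT.continuousOn_comp 0) (fun x t ht => ?_) ht
  have h1 : HasDerivWithinAt (fun τ : ℝ => ((rep x, τ, 0) : Vec n × ℝ × Jet n 0 0))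
      ((0 : Vec n), (1 : ℝ), (0 : Jet n 0 0)) (Set.Icc 0 δ) t :=
    (hasDerivWithinAt_const t _ _).prodMk
      ((hasDerivWithinAt_id t _).prodMk (hasDerivWithinAt_const t _ _))
  have h2 := (U.hasFDerivWithinAt (q := (rep x, t, 0))
    (Set.mk_mem_prod (Set.mem_univ _) (Set.mk_mem_prod ht
        (Set.mem_univ _)))).comp_hasDerivWithinAt t h1
    fun τ hτ => Set.mk_mem_prod (Set.mem_univ _) (Set.mk_mem_prod hτ (Set.mem_univ _))
  refine (h2.congr (fun τ hτ => ?_) ?_).congr_deriv ?_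
  · exact U.slice_apply hτ (rep x)
  · exact U.slice_apply ht (rep x)
  · exact (U.dT.slice_apply ht (rep x)).symm

/-- The slices of a smooth function of `(x,t)` form a differentiable curve. -/
lemma hasSDeriv_slice {t : ℝ} (ht : t ∈ Set.Icc 0 δ) :
    HasSDeriv U.slice (U.dT.slice t) (Set.Icc 0 δ) t := fun k I => by
  simp only [dI_slice, ← slice_dT_dXs]
  exact (U.dXs k I).hasDerivWithinAt_slice ht

end NL

lemma jetBasisG_eq_basis {n l : ℕ} (r : ℕ) (I : Fin r → Fin n) (b : Fin l) :
    jetBasisG r r I b = Jet.basis ⟨Fin.last r, I, b⟩ := by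
  funext k J c
  by_cases hk : k = Fin.last r
  · subst hk
    have h1 : J ∘ Fin.cast (rfl : r = ((Fin.last r : Fin (r + 1)) : ℕ)) = J := rfl
    simp only [jetBasisG, Fin.val_last, dif_pos, Jet.basis, Pi.single_eq_same, h1]
    by_cases hJ : J = I
    · subst hJ
      simp [Pi.single_apply]
    · rw [if_neg fun h => hJ h.1, Pi.single_eq_of_ne hJ]
      rfl
  · have h2 : ¬ (k : ℕ) = r := fun h => hk (Fin.ext h)
    simp only [jetBasisG, dif_neg h2, Jet.basis, Pi.single_eq_of_ne hk]
    rfl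

lemma hasDerivWithinAt_euclidean {l : ℕ} {f : ℝ → Vec l} {f' : Vec l} {S : Set ℝ} {t : ℝ} :
    HasDerivWithinAt f f' S t ↔ ∀ a, HasDerivWithinAt (fun s => f s a) (f' a) S t := by
  simp only [hasDerivWithinAt_iff_hasFDerivWithinAt]
  rw [hasFDerivWithinAt_euclidean]
  refine forall_congr' fun a => iff_of_eq ?_
  congr 1

namespace SP

variable {n l r : ℕ} {T : ℝ}

lemma iteratedFDeriv_component {w : Vec n → Vec l} {v : Fin l → SP n}
    (h : ∀ x a, w x a = v a x) (k : ℕ) (I : Fin k → Fin n) (x : Vec n) (b : Fin l) :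
    pderivW Set.univ k I w x b = dI k I (v b) x := by
  have hw : ContDiff ℝ (⊤ : ℕ∞) w := contDiff_euclidean.2 fun a => by
    simp only [h]; exact SP.smooth (v a)
  have h1 := (EuclideanSpace.proj (𝕜 := ℝ) b).iteratedFDeriv_comp_left (f := w) (x := x)
    (contDiff_infty.1 hw k).contDiffAt (i := k) le_rfl
  have h2 : (EuclideanSpace.proj (𝕜 := ℝ) b : Vec l → ℝ) ∘ w = v b := funext fun y => h y b
  rw [h2] at h1
  rw [← iteratedFDeriv_apply, h1, pderivW, iteratedFDerivWithin_univ]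
  rfl

lemma jetOf_eq_jet {w : Vec n → Vec l} {v : Fin l → SP n} (h : ∀ x a, w x a = v a x) (x : Vec n) :
    jetOf Set.univ r w x = jet r v x := by
  funext k I b; exact iteratedFDeriv_component h k I x b

lemma jet_add (v w : Fin l → SP n) (x : Vec n) : jet r (v + w) x = jet r v x + jet r w x := by
  funext k I b
  simp [jet]

/-- Smoothly truncated translate of a nonlinearity near the jet of a periodic function. -/
lemma exists_NL (U : Fin l → SP n) {W : Set (Jet n l r)} (hWo : IsOpen W)
    (hU : ∀ x, jet r U x ∈ W) {F : Vec n → ℝ → Jet n l r → Vec l}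
    (hF : ContDiffOn ℝ (⊤ : ℕ∞) (fun q : Vec n × ℝ × Jet n l r => F q.1 q.2.1 q.2.2)
      (Set.univ ×ˢ Set.Icc (0 : ℝ) T ×ˢ W))
    (hFper : ∀ x m t z, F (x + intVec m) t z = F x t z) :
    ∃ (G : Fin l → NL n l r T) (M ρ : ℝ), 0 < ρ ∧
      (∀ a x t z, t ∈ Set.Icc 0 T → |(G a).toFun (x, t, z)| ≤ M) ∧
      (∀ x z, ‖z‖ ≤ ρ → jet r U x + z ∈ W) ∧
      ∀ a x t z, ‖z‖ ≤ ρ → (G a).toFun (x, t, z) = F x t (jet r U x + z) a := by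
  have hjper : PerZ (jet r U) := fun x m => jet_per U x m
  have hcomp : IsCompact (jet r U '' {x : Vec n | ∀ i, x i ∈ Set.Icc (0 : ℝ) 1}) :=
    NL.isCompact_rep.image (contDiff_jet U).continuous
  obtain ⟨ρ, hρ, hW⟩ := hcomp.exists_thickening_subset_open hWo
    (Set.image_subset_iff.2 fun x _ => hU x)
  have hball : ∀ x z, ‖z‖ < ρ → jet r U x + z ∈ W := fun x z hz => by
    refine hW (Metric.mem_thickening_iff.2 ⟨jet r U x, ?_, by simpa [dist_eq_norm] using hz⟩)
    rw [← PerZ.apply_rep hjper x]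
    exact Set.mem_image_of_mem _ (rep_mem _)
  obtain ⟨χ, hχ⟩ : ∃ χ : ContDiffBump (0 : Jet n l r), χ.rIn = ρ / 4 ∧ χ.rOut = ρ / 2 :=
    ⟨⟨ρ / 4, ρ / 2, by positivity, by linarith⟩, rfl, rfl⟩
  obtain ⟨κ, hκ⟩ : ∃ κ : Jet n l r → Jet n l r, κ = fun z => χ z • z := ⟨_, rfl⟩
  have hκs : ContDiff ℝ (⊤ : ℕ∞) κ := hκ ▸ χ.contDiff.smul contDiff_id
  have hκle : ∀ z, ‖κ z‖ ≤ ρ / 2 := fun z => by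
    rw [hκ]
    by_cases hz : ‖z‖ ≤ ρ / 2
    · rw [norm_smul, Real.norm_of_nonneg χ.nonneg]
      exact (mul_le_of_le_one_left (norm_nonneg z) χ.le_one).trans hz
    · have : χ z = 0 := χ.zero_of_le_dist (by rw [dist_zero_right, hχ.2]; exact (not_le.1 hz).le)
      simp only [this, zero_smul, norm_zero]
      positivity
  have hκ1 : ∀ z, ‖z‖ ≤ ρ / 4 → κ z = z := fun z hz => by
    have : χ z = 1 := χ.one_of_mem_closedBall (by rwa [mem_closedBall_zero_iff, hχ.1])
    rw [hκ]
    simp only [this, one_smul]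
  have hκmem : ∀ x z, jet r U x + κ z ∈ W := fun x z => hball x _ ((hκle z).trans_lt (by linarith))
  have hsm : ContDiffOn ℝ (⊤ : ℕ∞) (fun q : Vec n × ℝ × Jet n l r =>
      F q.1 q.2.1 (jet r U q.1 + κ q.2.2)) (NLdom n l r T) :=
    hF.comp (t := Set.univ ×ˢ Set.Icc (0 : ℝ) T ×ˢ W)
      (f := fun q : Vec n × ℝ × Jet n l r => (q.1, q.2.1, jet r U q.1 + κ q.2.2))
      (contDiff_fst.prodMk ((contDiff_fst.comp contDiff_snd).prodMk
        (((contDiff_jet U).comp contDiff_fst).add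
          (hκs.comp (contDiff_snd.comp contDiff_snd))))).contDiffOn
      fun q hq => Set.mk_mem_prod (Set.mem_univ _) (Set.mk_mem_prod hq.2.1 (hκmem _ _))
  obtain ⟨M, hM⟩ : ∃ M : ℝ, ∀ x t z, t ∈ Set.Icc 0 T → ‖F x t (jet r U x + κ z)‖ ≤ M := by
    have hc : ContinuousOn (fun q : Vec n × ℝ × Jet n l r => F q.1 q.2.1 (jet r U q.1 + q.2.2))
        ({x : Vec n | ∀ i, x i ∈ Set.Icc (0 : ℝ) 1} ×ˢ Set.Icc 0 T ×ˢ
          Metric.closedBall 0 (ρ / 2)) :=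
      hF.continuousOn.comp (t := Set.univ ×ˢ Set.Icc (0 : ℝ) T ×ˢ W)
        (f := fun q : Vec n × ℝ × Jet n l r => (q.1, q.2.1, jet r U q.1 + q.2.2))
        (continuous_fst.prodMk ((continuous_fst.comp continuous_snd).prodMk
          (((contDiff_jet U).continuous.comp continuous_fst).add
            (continuous_snd.comp continuous_snd)))).continuousOn
        fun q hq => Set.mk_mem_prod (Set.mem_univ _) (Set.mk_mem_prod hq.2.1
          (hball _ _ ((mem_closedBall_zero_iff.1 hq.2.2).trans_lt (by linarith))))
    obtain ⟨M, hM⟩ := (NL.isCompact_rep.prod (isCompact_Icc.prod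
      (isCompact_closedBall _ _))).exists_bound_of_continuousOn hc
    refine ⟨M, fun x t z ht => ?_⟩
    have hp : PerZ fun x => F x t (jet r U x + κ z) := fun x m => by
      beta_reduce
      rw [hjper x m]
      exact hFper x m t _
    rw [← PerZ.apply_rep hp x]
    exact hM (rep (toTorus x), t, κ z) (Set.mk_mem_prod (rep_mem _)
      (Set.mk_mem_prod ht (mem_closedBall_zero_iff.2 (hκle z))))
  refine ⟨fun a => ⟨fun q => F q.1 q.2.1 (jet r U q.1 + κ q.2.2) a, contDiffOn_euclidean.1 hsm a,
    fun x m t z => ?_⟩, M, ρ / 4, by positivity, fun a x t z ht => ?_,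
    fun x z hz => hball x z (hz.trans_lt (by linarith)), fun a x t z hz => ?_⟩
  · simp only [hFper, jet_per]
  · exact (PiLp.norm_apply_le _ a).trans (hM x t z ht)
  · simp only [hκ1 z hz]

end SP

namespace SP

variable {n l r : ℕ} {T : ℝ}

variable [hT : Fact (0 < T)]

lemma linCoeff_eq_fderivWithin {U : Fin l → SP n} {W : Set (Jet n l r)} (hWo : IsOpen W)
    {F : Vec n → ℝ → Jet n l r → Vec l} {G : Fin l → NL n l r T} {ρ : ℝ} (hρ : 0 < ρ)
    (hU : ∀ x, jet r U x ∈ W)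
    (hG : ∀ a x t z, ‖z‖ ≤ ρ → (G a).toFun (x, t, z) = F x t (jet r U x + z) a)
    (I : Fin r → Fin n) (a b : Fin l) (x : Vec n) :
    linCoeff G (Fin.last r) I a b x
      = fderivWithin ℝ (fun z => F x 0 z a) W (jet r U x) (jetBasisG r r I b) := by
  have h0 : (x, 0, 0) ∈ NLdom n l r T :=
    Set.mk_mem_prod (Set.mem_univ _) (Set.mk_mem_prod ⟨le_rfl, hT.out.le⟩ (Set.mem_univ _))
  have h1 : HasFDerivAt (fun z : Jet n l r => ((x, 0, z - jet r U x) : Vec n × ℝ × Jet n l r))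
      (ContinuousLinearMap.prod 0 (ContinuousLinearMap.prod 0
        (ContinuousLinearMap.id ℝ (Jet n l r)))) (jet r U x) :=
    (hasFDerivAt_const x _).prodMk ((hasFDerivAt_const 0 _).prodMk
      ((hasFDerivAt_id _).sub_const _))
  have h2 : HasFDerivWithinAt (G a).toFun (fderivWithin ℝ (G a).toFun (NLdom n l r T) (x, 0, 0))
      (NLdom n l r T) (x, 0, jet r U x - jet r U x) := by
    rw [sub_self]; exact (G a).hasFDerivWithinAt h0
  have h3 := h2.comp (s := Set.univ) (jet r U x) h1.hasFDerivWithinAt fun z _ =>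
    Set.mk_mem_prod (Set.mem_univ x)
      (Set.mk_mem_prod (Set.left_mem_Icc.2 hT.out.le) (Set.mem_univ _))
  rw [hasFDerivWithinAt_univ] at h3
  have h4 : (fun z => F x 0 z a) =ᶠ[nhds (jet r U x)]
      (G a).toFun ∘ fun z => (x, 0, z - jet r U x) := by
    filter_upwards [Metric.closedBall_mem_nhds (jet r U x) hρ] with z hz
    rw [mem_closedBall_iff_norm] at hz
    simp [hG a x 0 _ hz]
  rw [fderivWithin_of_isOpen hWo (hU x), (h3.congr_of_eventuallyEq h4).fderiv, jetBasisG_eq_basis,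
    linCoeff, comp_zero_apply]
  rfl

lemma tDerivW_apply {u : Vec n → ℝ → Vec l} {x : Vec n} {t δ : ℝ} {g : Vec l} (hδ : 0 < δ)
    (ht : t ∈ Set.Icc 0 δ) (h : ∀ a, HasDerivWithinAt (fun s => u x s a) (g a) (Set.Icc 0 δ) t) :
    tDerivW (Set.Icc 0 δ) u x t = g :=
  (hasDerivWithinAt_euclidean.2 h).derivWithin (uniqueDiffOn_Icc hδ t ht)

lemma HasSDeriv.apply {f : ℝ → SP n} {g : SP n} {S : Set ℝ} {t : ℝ} (h : HasSDeriv f g S t)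
    (x : Vec n) : HasDerivWithinAt (fun τ => f τ x) (g x) S t := by
  have h1 := (ContinuousMap.evalCLM ℝ (toTorus x)).hasFDerivAt.comp_hasDerivWithinAt t h.toC
  simpa only [Function.comp_def, ContinuousMap.evalCLM_apply, toC_toTorus] using h1

lemma HasSDeriv.sub_const {f : ℝ → SP n} {g : SP n} {S : Set ℝ} {t : ℝ} (h : HasSDeriv f g S t)
    (c : SP n) : HasSDeriv (fun τ => f τ - c) g S t := fun k I => by
  simp only [map_sub]; exact (h k I).sub_const _

end SP

namespace SP

variable {n l : ℕ} {T : ℝ} [hT : Fact (0 < T)]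

lemma elliptic_of_stronglyParabolic {h : ℕ} (hh : 1 ≤ h) {U : Fin l → SP n}
    {W : Set (Jet n l (2 * h))} (hWo : IsOpen W) {F : Vec n → ℝ → Jet n l (2 * h) → Vec l}
    {G : Fin l → NL n l (2 * h) T} {ρ lam : ℝ} (hρ : 0 < ρ) (hU : ∀ x, jet (2 * h) U x ∈ W)
    (hG : ∀ a x t z, ‖z‖ ≤ ρ → (G a).toFun (x, t, z) = F x t (jet (2 * h) U x + z) a)
    (hpar : ∀ (x ξ : Vec n) (v : Vec l), lam * ‖ξ‖ ^ (2 * h) * ‖v‖ ^ 2 ≤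
      (-1 : ℝ) ^ (2 * h / 2 - 1) * ∑ I : Fin (2 * h) → Fin n, ∑ a : Fin l, ∑ b : Fin l,
        (fderivWithin ℝ (fun z => F x 0 z a) W (jet (2 * h) U x)
          (jetBasisG (2 * h) (2 * h) I b)) * (∏ j, ξ (I j)) * v a * v b) :
    Elliptic G lam := by
  intro x ξ v
  have h1 := hpar x (WithLp.toLp 2 ξ) (WithLp.toLp 2 v)
  have h2 : (-1 : ℝ) ^ (2 * h / 2 - 1) = (-1) ^ (h + 1) := by
    obtain ⟨m, rfl⟩ := Nat.exists_eq_add_of_le' hh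
    rw [Nat.mul_div_cancel_left _ two_pos, Nat.add_sub_cancel, pow_succ, pow_succ]
    ring
  rw [h2, pow_mul, EuclideanSpace.real_norm_sq_eq, EuclideanSpace.real_norm_sq_eq] at h1
  simpa only [linCoeff_eq_fderivWithin hWo hρ hU hG] using h1

/-- A component of a periodic smooth function of `(x,t)`, as a nonlinearity without jet
variables. -/
def componentNL {u : Vec n → ℝ → Vec l}
    (hu : ContDiffOn ℝ (⊤ : ℕ∞) (fun q : Vec n × ℝ => u q.1 q.2) (Set.univ ×ˢ Set.Icc 0 T))
    (hp : PerZ u) (a : Fin l) : NL n 0 0 T where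
  toFun q := u q.1 q.2.1 a
  smooth' := (contDiffOn_euclidean.1 hu a).comp
    (f := fun q : Vec n × ℝ × Jet n 0 0 => (q.1, q.2.1))
    (contDiff_fst.prodMk (contDiff_fst.comp contDiff_snd)).contDiffOn
    fun _ hq => Set.mk_mem_prod hq.1 hq.2.1
  per' x m t _ := congrArg (fun g : ℝ → Vec l => g t a) (hp x m)

end SP

/-- **Short-time existence and uniqueness of smooth solutions for fully nonlinear
parabolic systems on the torus** (Theorem 1.1 for `M = 𝕋^n` with the trivial bundle):
for `C^∞` periodic `u₀`, `W` an open neighborhood of the range of `j_r u₀`, and `F`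
`C^∞` on `ℝ^n × [0,T] × W`, periodic in `x`, with the equation strongly parabolic at
`u₀`, there is `δ ∈ (0,T]` such that `∂u/∂t = F(x,t,j_r u)`, `u(⋅,0) = u₀` has one and
only one `C^∞` periodic solution on `ℝ^n × [0,δ]` with jet staying in `W`. -/
theorem fully_nonlinear_short_time_existence_smooth_torus
    (n l r : ℕ) (hn : 1 ≤ n) (hl : 1 ≤ l) (hr : 2 ≤ r) (hrev : Even r)
    (T : ℝ) (hT : 0 < T)
    (u₀ : Vec n → Vec l) (hu₀sm : ContDiff ℝ (⊤ : ℕ∞) u₀) (hu₀per : PerZ u₀)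
    (W : Set (Jet n l r)) (hWo : IsOpen W)
    (hWn : ∀ x : Vec n, jetOf Set.univ r u₀ x ∈ W)
    (F : Vec n → ℝ → Jet n l r → Vec l)
    (hF : ContDiffOn ℝ (⊤ : ℕ∞) (fun q : Vec n × ℝ × Jet n l r => F q.1 q.2.1 q.2.2)
      (Set.univ ×ˢ Set.Icc (0 : ℝ) T ×ˢ W))
    (hFper : ∀ (x : Vec n) (m : Fin n → ℤ) (t : ℝ) (z : Jet n l r),
      F (x + (EuclideanSpace.equiv (Fin n) ℝ).symm fun i => (m i : ℝ)) t z = F x t z)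
    (lam : ℝ) (hlam : 0 < lam)
    (hpar : ∀ x : Vec n, ∀ ξ : Vec n, ∀ v : Vec l,
      lam * ‖ξ‖ ^ r * ‖v‖ ^ 2 ≤
        (-1 : ℝ) ^ (r / 2 - 1) *
          ∑ I : Fin r → Fin n, ∑ a : Fin l, ∑ b : Fin l,
            (fderivWithin ℝ (fun z => F x 0 z a) W
                (jetOf Set.univ r u₀ x) (jetBasisG r r I b))
              * (∏ j, ξ (I j)) * v a * v b) :
    ∃ δ : ℝ, 0 < δ ∧ δ ≤ T ∧
      ∃ u : Vec n → ℝ → Vec l,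
        (ContDiffOn ℝ (⊤ : ℕ∞) (fun q : Vec n × ℝ => u q.1 q.2) (Set.univ ×ˢ Set.Icc 0 δ) ∧
          PerZ u ∧
          (∀ x : Vec n, ∀ t ∈ Set.Icc (0 : ℝ) δ,
            jetOf Set.univ r (fun y => u y t) x ∈ W) ∧
          (∀ x : Vec n, ∀ t ∈ Set.Icc (0 : ℝ) δ,
            tDerivW (Set.Icc 0 δ) u x t = F x t (jetOf Set.univ r (fun y => u y t) x)) ∧
          (∀ x : Vec n, u x 0 = u₀ x)) ∧
        ∀ u' : Vec n → ℝ → Vec l,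
          (ContDiffOn ℝ (⊤ : ℕ∞) (fun q : Vec n × ℝ => u' q.1 q.2) (Set.univ ×ˢ Set.Icc 0 δ) ∧
            PerZ u' ∧
            (∀ x : Vec n, ∀ t ∈ Set.Icc (0 : ℝ) δ,
              jetOf Set.univ r (fun y => u' y t) x ∈ W) ∧
            (∀ x : Vec n, ∀ t ∈ Set.Icc (0 : ℝ) δ,
              tDerivW (Set.Icc 0 δ) u' x t
                = F x t (jetOf Set.univ r (fun y => u' y t) x)) ∧
            (∀ x : Vec n, u' x 0 = u₀ x)) →
          ∀ x : Vec n, ∀ t ∈ Set.Icc (0 : ℝ) δ, u' x t = u x t := by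
  have : Fact (0 < T) := ⟨hT⟩
  obtain ⟨h, rfl⟩ : ∃ h, r = 2 * h := hrev.two_dvd
  have hh : 1 ≤ h := by omega
  obtain ⟨U, hU⟩ : ∃ U : Fin l → SP n, ∀ x a, U a x = u₀ x a :=
    ⟨fun a => SP.mk (fun x => u₀ x a) (contDiff_euclidean.1 hu₀sm a)
      fun x m => congrArg (fun z : Vec l => z a) (hu₀per x m), fun _ _ => rfl⟩
  have hj : ∀ x, jetOf Set.univ (2 * h) u₀ x = SP.jet (2 * h) U x :=
    SP.jetOf_eq_jet fun x a => (hU x a).symm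
  simp only [hj] at hWn hpar
  obtain ⟨G, M, ρ, hρ, hM, hGW, hG⟩ := SP.exists_NL U hWo hWn hF hFper
  obtain ⟨ε₁, δ₁, hε₁, hδ₁, hδ₁T, hE₁⟩ := SP.exists_energyEst hh G hlam
    (SP.elliptic_of_stronglyParabolic hh hWo hρ hWn hG hpar)
  obtain ⟨ε, hε, hεε₁, hερ⟩ : ∃ ε, 0 < ε ∧ ε ≤ ε₁ ∧ ε ≤ ρ :=
    ⟨min ε₁ ρ, lt_min hε₁ hρ, min_le_left _ _, min_le_right _ _⟩
  have hE := hE₁.mono hεε₁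
  obtain ⟨δ, hδ, hδδ₁, w, hw0, hws, hw⟩ := (hE.mono (half_le_self hε.le)).exists_solution
    (half_pos hε) hδ₁ hδ₁T (M := M) fun a t v x => by
      rw [NL.comp_apply]; exact hM a x _ _ (NL.clamp_mem t)
  have hδT : δ ≤ T := hδδ₁.trans hδ₁T
  have : Fact (0 < δ) := ⟨hδ⟩
  have hcomp : ∀ (v : Fin l → SP n) x t a, t ∈ Set.Icc 0 δ → ‖SP.jet (2 * h) v x‖ ≤ ε →
      (G a).comp t v x = F x t (SP.jet (2 * h) (U + v) x) a := fun v x t a ht hv => by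
    rw [NL.comp_apply, NL.clamp_of_mem ⟨ht.1, ht.2.trans hδT⟩, hG a x t _ (hv.trans hερ),
      SP.jet_add]
  have hsmall : ∀ t ∈ Set.Icc 0 δ, ∀ x, ‖SP.jet (2 * h) (w t) x‖ ≤ ε := fun t ht x =>
    (hws t ht x).trans (half_le_self hε.le)
  obtain ⟨u, hu⟩ : ∃ u : Vec n → ℝ → Vec l, ∀ x t a, u x t a = U a x + w t a x :=
    ⟨fun x t => WithLp.toLp 2 fun a => U a x + w t a x, fun _ _ _ => rfl⟩
  have hju : ∀ x t, jetOf Set.univ (2 * h) (fun y => u y t) x = SP.jet (2 * h) (U + w t) x :=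
    fun x t => SP.jetOf_eq_jet (fun x a => hu x t a) x
  refine ⟨δ, hδ, hδT, u, ⟨?_, fun x m => ?_, fun x t ht => ?_, fun x t ht => ?_, fun x => ?_⟩,
    fun u' ⟨hs', hp', _, hpde', hi'⟩ => ?_⟩
  · refine contDiffOn_euclidean.2 fun a => contDiffOn_infty.2 fun m => ?_
    simp only [hu]
    exact (((U a).smooth.comp contDiff_fst).contDiffOn.of_le (by exact_mod_cast le_top)).add
      (SP.contDiffOn_of_hasSDeriv hδ hδT hw m 0 Fin.elim0 a)
  · ext t a
    rw [hu, hu]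
    exact congrArg₂ (· + ·) ((U a).per x m) ((w t a).per x m)
  · rw [hju, SP.jet_add]
    exact hGW x _ ((hsmall t ht x).trans hερ)
  · rw [hju]
    refine SP.tDerivW_apply hδ ht fun a => ?_
    simp only [hu]
    rw [← hcomp (w t) x t a ht (hsmall t ht x)]
    exact ((hw t ht a).apply x).const_add _
  · ext a
    rw [hu, hw0, hU]
    exact add_zero _
  · obtain ⟨V, hV⟩ : ∃ V : Fin l → NL n 0 0 δ, V = SP.componentNL hs' hp' := ⟨_, rfl⟩
    have hVs : ∀ a x, ∀ t ∈ Set.Icc 0 δ, (V a).slice t x = u' x t a := fun a x t ht => by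
      rw [NL.slice_apply _ ht, hV]; rfl
    obtain ⟨v, hv⟩ : ∃ v : ℝ → Fin l → SP n, v = fun t a => (V a).slice t - U a := ⟨_, rfl⟩
    have hvd : ∀ t ∈ Set.Icc 0 δ, ∀ a,
        SP.HasSDeriv (fun τ => v τ a) ((V a).dT.slice t) (Set.Icc 0 δ) t := fun t ht a => by
      rw [hv]; exact ((V a).hasSDeriv_slice ht).sub_const _
    have hUv : ∀ t ∈ Set.Icc 0 δ, ∀ x a, u' x t a = (U + v t) a x := fun t ht x a => by
      rw [← hVs a x t ht, hv, Pi.add_apply, add_sub_cancel]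
    have h0 : v 0 = w 0 := by
      ext a x
      have h1 := hUv 0 ⟨le_rfl, hδ.le⟩ x a
      rw [hi', ← hU, Pi.add_apply, SP.add_apply, left_eq_add] at h1
      rw [h1, hw0]; rfl
    have hvg : ∀ t ∈ Set.Icc 0 δ, SP.JSmall (2 * h) ε (v t) →
        ∀ a, (V a).dT.slice t = (G a).comp t (v t) := fun t ht hsm a => by
      ext x
      rw [hcomp _ _ _ _ ht (hsm x), ← SP.jetOf_eq_jet (hUv t ht) x, ← hpde' x t ht,
        SP.tDerivW_apply (g := WithLp.toLp 2 fun a => (V a).dT.slice t x) hδ ht fun a => ?_]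
      exact (((V a).hasSDeriv_slice ht).apply x).congr (fun s hs => (hVs a x s hs).symm)
        (hVs a x t ht).symm
    intro x t ht
    ext a
    rw [hUv t ht, hu, hE.unique hε hδδ₁ h0 hws hw hvd hvg ht]
    rfl
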